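/- arXiv:2312.10909 — 2 statements merged into one kernel-verified Lean document; each statement's English description precedes it below -/
import Mathlib

section
/- For every integer n ≥ 391, (√12·π²·e^{μ(n)}/(36·μ(n)^8))·(μ(n)^6 − μ(n)^5 − 1) < p(n) < (√12·π²·e^{μ(n)}/(36·μ(n)^8))·(μ(n)^6 − μ(n)^5 + 1). -/
/-- The partition function: the number of partitions of `n`. -/
def partitionFn (n : ℕ) : ℕ := Fintype.card (Nat.Partition n)

/-- `μ(n) = π √(24 n - 1) / 6`. -/
noncomputable def muP (n : ℕ) : ℝ := Real.pi * Real.sqrt (24 * (n : ℝ) - 1) / 6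

section
open PowerSeries PowerSeries.WithPiTopology Finset

/-- The generating function of the partitions all of whose parts equal `i + 1`. -/
noncomputable def partFactor (i : ℕ) : PowerSeries ℕ :=
  PowerSeries.mk fun j => if (i + 1) ∣ j then 1 else 0

/-- The generating function of the partitions all of whose parts are at most `N`. -/
noncomputable def boundedPartSeries (N : ℕ) : PowerSeries ℕ := ∏ i ∈ Finset.range N, partFactor i

lemma boundedPartSeries_succ (N : ℕ) :
    boundedPartSeries (N + 1) = boundedPartSeries N * partFactor N := by
  simp [boundedPartSeries, Finset.prod_range_succ]

section
local instance : TopologicalSpace ℕ := ⊥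
local instance : DiscreteTopology ℕ := ⟨rfl⟩

lemma hasSum_partFactor (i : ℕ) :
    HasSum (fun j : ℕ => (X : ℕ⟦X⟧) ^ ((i + 1) * j)) (partFactor i) := by
  rw [hasSum_iff_hasSum_coeff]
  intro d
  simp only [partFactor, coeff_mk, coeff_X_pow]
  by_cases h : (i + 1) ∣ d
  · obtain ⟨k, rfl⟩ := h
    have := hasSum_ite_eq k (1 : ℕ)
    simpa [eq_comm] using this
  · have e : (fun j : ℕ => if d = (i + 1) * j then 1 else 0) = fun _ => (0 : ℕ) := by
      funext j
      rw [if_neg]; rintro rfl; exact h ⟨_, rfl⟩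
    rw [e, if_neg h]
    exact hasSum_zero

lemma hasProd_partFactor : HasProd partFactor (PowerSeries.mk partitionFn) := by
  have h := Nat.Partition.hasProd_powerSeriesMk_card_restricted ℕ (fun _ => True)
  convert h using 2 with i n
  · simp [(hasSum_partFactor i).tsum_eq]
  · ext n
    simp [partitionFn, Nat.Partition.restricted]

lemma eventually_coeff_boundedPartSeries (n : ℕ) :
    ∀ᶠ N in Filter.atTop, coeff n (boundedPartSeries N) = partitionFn n := by
  have h := hasProd_partFactor.tendsto_prod_nat
  rw [tendsto_iff_coeff_tendsto] at h
  have := h n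
  rw [nhds_discrete, Filter.tendsto_pure] at this
  simpa [boundedPartSeries] using this
end

lemma coeff_boundedPartSeries_mono (n : ℕ) : Monotone fun N => coeff n (boundedPartSeries N) := by
  refine monotone_nat_of_le_succ fun N => ?_
  rw [boundedPartSeries_succ, coeff_mul]
  have : (n, 0) ∈ antidiagonal n := by simp
  refine le_trans ?_ (Finset.single_le_sum (fun _ _ => Nat.zero_le _) this)
  simp [partFactor]

lemma coeff_boundedPartSeries_le (N n : ℕ) : coeff n (boundedPartSeries N) ≤ partitionFn n := by
  obtain ⟨M, hM⟩ := Filter.eventually_atTop.1 (eventually_coeff_boundedPartSeries n)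
  rw [← hM (max M N) (le_max_left _ _)]
  exact coeff_boundedPartSeries_mono n (le_max_right _ _)

lemma hasSum_partFactor_eval {q : ℂ} (hq : ‖q‖ < 1) (i : ℕ) :
    HasSum (fun n => ((coeff n (partFactor i) : ℕ) : ℂ) * q ^ n) (1 - q ^ (i + 1))⁻¹ := by
  have hq' : ‖q ^ (i + 1)‖ < 1 := by
    rw [norm_pow]; exact pow_lt_one₀ (norm_nonneg _) hq (by omega)
  have h := hasSum_geometric_of_norm_lt_one hq'
  have hinj : Function.Injective (fun k : ℕ => (i + 1) * k) := fun a b hab => by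
    simpa using hab
  rw [← hinj.hasSum_iff]
  · have e : (fun n => ((coeff n (partFactor i) : ℕ) : ℂ) * q ^ n) ∘ (fun k : ℕ => (i + 1) * k) =
        fun k => (q ^ (i + 1)) ^ k := by
      funext k
      simp [partFactor, pow_mul]
    rw [e]
    exact h
  · intro n hn
    have : ¬ (i + 1) ∣ n := by rintro ⟨k, rfl⟩; exact hn ⟨k, rfl⟩
    simp [partFactor, this]

lemma hasSum_boundedPartSeries_eval {q : ℂ} (hq : ‖q‖ < 1) (N : ℕ) :
    Summable (fun n => ‖((coeff n (boundedPartSeries N) : ℕ) : ℂ) * q ^ n‖) ∧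
    HasSum (fun n => ((coeff n (boundedPartSeries N) : ℕ) : ℂ) * q ^ n)
      (∏ i ∈ range N, (1 - q ^ (i + 1)))⁻¹ := by
  induction N with
  | zero =>
    have : ∀ n ∉ ({0} : Finset ℕ), ((coeff n (boundedPartSeries 0) : ℕ) : ℂ) * q ^ n = 0 := by
      intro n hn
      simp only [Finset.mem_singleton] at hn
      simp [boundedPartSeries, coeff_one, hn]
    have h := hasSum_sum_of_ne_finset_zero (L := .unconditional ℕ) this
    refine ⟨h.summable.norm, ?_⟩
    simpa [boundedPartSeries] using h
  | succ N ih =>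
    obtain ⟨ih1, ih2⟩ := ih
    have h2 := hasSum_partFactor_eval hq N
    have h1 : Summable (fun n => ‖((coeff n (partFactor N) : ℕ) : ℂ) * q ^ n‖) := h2.summable.norm
    have key : ∀ n, ∑ kl ∈ antidiagonal n, (((coeff kl.1 (boundedPartSeries N) : ℕ) : ℂ) * q ^ kl.1) *
        (((coeff kl.2 (partFactor N) : ℕ) : ℂ) * q ^ kl.2) =
        ((coeff n (boundedPartSeries (N + 1)) : ℕ) : ℂ) * q ^ n := by
      intro n
      rw [boundedPartSeries_succ, coeff_mul]
      push_cast
      rw [Finset.sum_mul]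
      refine Finset.sum_congr rfl fun kl hkl => ?_
      rw [← mem_antidiagonal.1 hkl, pow_add]; ring
    have s := summable_norm_sum_mul_antidiagonal_of_summable_norm ih1 h1
    have t := tsum_mul_tsum_eq_tsum_sum_antidiagonal_of_summable_norm ih1 h1
    simp only [key] at s t
    refine ⟨s, ?_⟩
    rw [Finset.prod_range_succ, mul_inv, ← ih2.tsum_eq, ← h2.tsum_eq, t]
    exact s.of_norm.hasSum

/-- Euler's product `∏ (1 - q ^ (n + 1))`. -/
noncomputable def eulerProd (q : ℂ) : ℂ := ∏' n : ℕ, (1 - q ^ (n + 1))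

lemma summable_neg_pow_succ {q : ℂ} (hq : ‖q‖ < 1) : Summable fun n : ℕ => ‖-q ^ (n + 1)‖ := by
  simpa using (summable_nat_add_iff 1).mpr (summable_geometric_of_lt_one (norm_nonneg _) hq)

lemma one_sub_pow_ne_zero {q : ℂ} (hq : ‖q‖ < 1) (n : ℕ) : 1 - q ^ (n + 1) ≠ 0 := by
  intro h
  have h1 : ‖q ^ (n + 1)‖ < 1 := by
    rw [norm_pow]; exact pow_lt_one₀ (norm_nonneg _) hq (by omega)
  rw [← sub_eq_zero.1 h] at h1
  simp at h1

lemma eulerProd_ne_zero {q : ℂ} (hq : ‖q‖ < 1) : eulerProd q ≠ 0 := by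
  refine tprod_one_add_ne_zero_of_summable (f := fun n ↦ -q ^ (n + 1)) ?_ ?_
  · exact fun i ↦ by simpa [← sub_eq_add_neg] using one_sub_pow_ne_zero hq i
  · exact summable_neg_pow_succ hq

lemma tendsto_prod_eulerProd {q : ℂ} (hq : ‖q‖ < 1) :
    Filter.Tendsto (fun N => ∏ i ∈ range N, (1 - q ^ (i + 1))) Filter.atTop
      (nhds (eulerProd q)) :=
  (ModularForm.multipliable_one_sub_pow hq).hasProd.tendsto_prod_nat

lemma summable_partitionFn {r : ℝ} (h0 : 0 ≤ r) (h1 : r < 1) :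
    Summable fun n => (partitionFn n : ℝ) * r ^ n := by
  have hr : ‖(r : ℂ)‖ < 1 := by simpa [abs_of_nonneg h0] using h1
  have ht := (tendsto_prod_eulerProd hr).inv₀ (eulerProd_ne_zero hr)
  obtain ⟨C, hC⟩ := ht.norm.bddAbove_range
  refine summable_of_sum_le (c := C) (fun n => by positivity) fun u => ?_
  obtain ⟨N, hN⟩ : ∃ N, ∀ n ∈ u, coeff n (boundedPartSeries N) = partitionFn n := by
    have := (Filter.eventually_all_finset u).2 fun n _ => eventually_coeff_boundedPartSeries n
    exact this.exists
  have hs := (hasSum_boundedPartSeries_eval hr N)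
  calc ∑ n ∈ u, (partitionFn n : ℝ) * r ^ n
      = ∑ n ∈ u, ‖((coeff n (boundedPartSeries N) : ℕ) : ℂ) * (r : ℂ) ^ n‖ := by
        refine Finset.sum_congr rfl fun n hn => ?_
        rw [hN n hn]; simp [abs_of_nonneg h0]
    _ ≤ ∑' n, ‖((coeff n (boundedPartSeries N) : ℕ) : ℂ) * (r : ℂ) ^ n‖ :=
        hs.1.sum_le_tsum _ fun _ _ => norm_nonneg _
    _ = ‖(∏ i ∈ range N, (1 - (r : ℂ) ^ (i + 1)))⁻¹‖ := by
        have e : ∀ n, ((coeff n (boundedPartSeries N) : ℕ) : ℂ) * (r : ℂ) ^ n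
          = ((((coeff n (boundedPartSeries N) : ℕ) : ℝ) * r ^ n : ℝ) : ℂ) := by intro n; push_cast; rfl
        rw [← hs.2.tsum_eq]
        simp only [e]
        rw [← Complex.ofReal_tsum]
        simp only [Complex.norm_real, Real.norm_eq_abs]
        rw [abs_of_nonneg (tsum_nonneg fun n => by positivity)]
        exact tsum_congr fun n => abs_of_nonneg (by positivity)
    _ ≤ C := hC ⟨N, rfl⟩

theorem hasSum_partitionFn {q : ℂ} (hq : ‖q‖ < 1) :
    HasSum (fun n => (partitionFn n : ℂ) * q ^ n) (eulerProd q)⁻¹ := by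
  have hb := summable_partitionFn (norm_nonneg q) hq
  have hsum : Summable fun n => (partitionFn n : ℂ) * q ^ n :=
    Summable.of_norm (by simpa using hb)
  have h1 : Filter.Tendsto (fun N => ∑' n, ((coeff n (boundedPartSeries N) : ℕ) : ℂ) * q ^ n)
      Filter.atTop (nhds (∑' n, (partitionFn n : ℂ) * q ^ n)) := by
    refine tendsto_tsum_of_dominated_convergence hb (fun n => ?_)
      (Filter.Eventually.of_forall fun N n => ?_)
    · refine tendsto_const_nhds.congr' ?_
      filter_upwards [eventually_coeff_boundedPartSeries n] with N hN
      rw [hN]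
    · rw [norm_mul, norm_pow, Complex.norm_natCast]
      gcongr
      exact coeff_boundedPartSeries_le N n
  have h2 := (tendsto_prod_eulerProd hq).inv₀ (eulerProd_ne_zero hq)
  have h3 := h1.congr fun N => (hasSum_boundedPartSeries_eval hq N).2.tsum_eq
  rw [← tendsto_nhds_unique h3 h2]
  exact hsum.hasSum

lemma partitionSeries_mul_pentagonalSeries :
    (PowerSeries.mk fun n => (partitionFn n : ℤ)) * pentagonalSeries ℤ = 1 := by
  have h := Nat.Partition.hasProd_powerSeriesMk_card_restricted ℤ (fun _ => True)
  have h2 := hasProd_one_sub_X_pow ℤ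
  have h3 := h.mul h2
  have e : (PowerSeries.mk fun n ↦ (#(Nat.Partition.restricted n (fun _ => True)) : ℤ)) =
      PowerSeries.mk fun n => (partitionFn n : ℤ) := by
    ext n; simp [partitionFn, Nat.Partition.restricted]
  rw [e] at h3
  refine h3.unique ?_
  have e2 : (fun b : ℕ => (if True then ∑' j : ℕ, (X : ℤ⟦X⟧) ^ ((b + 1) * j) else 1) *
      (1 - X ^ (b + 1))) = fun _ => 1 := by
    funext i
    simp_rw [if_pos trivial, pow_mul]
    exact tsum_pow_mul_one_sub_of_constantCoeff_eq_zero (by simp)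
  rw [e2]
  exact hasProd_one

end

open Complex in
lemma eta_I_mul_div {z : ℂ} :
    ModularForm.eta ((2 * Real.pi : ℝ)⁻¹ * (I * z)) = exp (-z / 24) * eulerProd (exp (-z)) := by
  have hpi : (Real.pi : ℂ) ≠ 0 := by exact_mod_cast Real.pi_ne_zero
  have h1 : 2 * (Real.pi : ℂ) * I * ((2 * Real.pi : ℝ)⁻¹ * (I * z)) = -z := by
    push_cast
    field_simp
    rw [I_sq]; ring
  rw [ModularForm.eta, eulerProd, Function.Periodic.qParam]
  simp only [ModularForm.eta_q_eq_pow]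
  rw [h1]
  congr 3

open Complex in
/-- The transformation formula of the Dedekind eta function, for `∏ (1 - exp (-n z))⁻¹`. -/
lemma eulerProd_inv_transform {z : ℂ} (hz : 0 < z.re) :
    (eulerProd (exp (-z)))⁻¹ = (√(2 * Real.pi))⁻¹ * exp (log z / 2) *
      exp (Real.pi ^ 2 / (6 * z) - z / 24) * (eulerProd (exp (-(4 * Real.pi ^ 2 / z))))⁻¹ := by
  have hpi : (Real.pi : ℂ) ≠ 0 := by exact_mod_cast Real.pi_ne_zero
  have hz0 : z ≠ 0 := by rintro rfl; simp at hz
  set c : ℝ := (2 * Real.pi)⁻¹ with hc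
  have hcpos : 0 < c := by positivity
  set τ : ℂ := c * (I * z) with hτ
  have hτim : 0 < τ.im := by simpa [hτ] using mul_pos hcpos hz
  have key := ModularForm.eta_comp_eq_csqrt_I_inv
    (show τ ∈ UpperHalfPlane.upperHalfPlaneSet from hτim)
  have hinv : -1 / τ = c * (I * (4 * Real.pi ^ 2 / z)) := by
    rw [hτ, hc]; push_cast; field_simp; rw [I_sq]; ring
  simp only [Function.comp_apply, Pi.smul_apply, Pi.mul_apply, smul_eq_mul] at key
  rw [hinv, hτ, hc, eta_I_mul_div, eta_I_mul_div, ← hc] at key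
  have harg : (I * z).arg = Real.pi / 2 + z.arg ∧ arg I + arg z ∈ Set.Ioc (-Real.pi) Real.pi := by
    have h1 := abs_arg_lt_pi_div_two_iff.2 (Or.inl hz)
    rw [abs_lt] at h1
    have h2 : arg I + arg z ∈ Set.Ioc (-Real.pi) Real.pi := by
      rw [arg_I]; constructor <;> linarith [Real.pi_pos]
    refine ⟨?_, h2⟩
    rw [arg_mul I_ne_zero hz0 h2, arg_I]
  have hlog : log (c * (I * z)) = Real.log c + (log I + log z) := by
    rw [log_ofReal_mul hcpos (mul_ne_zero I_ne_zero hz0), log_mul I_ne_zero hz0 harg.2]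
  have hs1 : sqrt (c * (I * z)) = exp (Real.log c / 2) * sqrt I * exp (log z / 2) := by
    rw [sqrt_eq_exp (by simp [hz0, hcpos.ne']), sqrt_eq_exp I_ne_zero, hlog, ← exp_add, ← exp_add]
    congr 1; ring
  have hs2 : exp ((Real.log c : ℂ) / 2) = ((√(2 * Real.pi))⁻¹ : ℝ) := by
    rw [show ((Real.log c : ℂ) / 2) = ((Real.log c / 2 : ℝ) : ℂ) by push_cast; ring, ← ofReal_exp]
    congr 1
    rw [← Real.sqrt_inv, ← hc, Real.sqrt_eq_rpow, Real.rpow_def_of_pos hcpos]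
    congr 1; ring
  have hI : sqrt I ≠ 0 := by rw [sqrt_eq_exp I_ne_zero]; exact exp_ne_zero _
  rw [hs1, hs2] at key
  have hq1 : ‖exp (-z)‖ < 1 := by rw [norm_exp]; simpa using hz
  have hq2 : ‖exp (-(4 * Real.pi ^ 2 / z))‖ < 1 := by
    rw [norm_exp, Real.exp_lt_one_iff, neg_re, neg_lt_zero]
    have : (4 * (Real.pi : ℂ) ^ 2 / z) = ((4 * Real.pi ^ 2 : ℝ) : ℂ) * z⁻¹ := by
      push_cast; ring
    rw [this, re_ofReal_mul, inv_re]
    have := normSq_pos.2 hz0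
    positivity
  have e1 := eulerProd_ne_zero hq1
  have e2 := eulerProd_ne_zero hq2
  rw [show (Real.pi : ℂ) ^ 2 / (6 * z) - z / 24 = -(-(4 * Real.pi ^ 2 / z) / 24) + -z / 24 by
    field_simp; ring, exp_add, exp_neg (_ / 24)]
  have e3 := exp_ne_zero (-(4 * (Real.pi : ℂ) ^ 2 / z) / 24)
  generalize exp (-(4 * (Real.pi : ℂ) ^ 2 / z) / 24) = a at *
  generalize eulerProd (exp (-(4 * (Real.pi : ℂ) ^ 2 / z))) = b at *
  generalize exp (-z / 24) = d at *
  generalize eulerProd (exp (-z)) = e at *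
  push_cast at key ⊢
  rw [← mul_assoc, mul_comm (_)⁻¹ (_ * I.sqrt * _), mul_right_comm _ I.sqrt,
    mul_assoc _ I.sqrt, mul_inv_cancel₀ hI, mul_one] at key
  generalize ((√(2 * Real.pi) : ℝ) : ℂ)⁻¹ * exp (log z / 2) = w at *
  have : (a * b) * (e⁻¹ * a⁻¹ * b⁻¹) = w * (d * e) * (e⁻¹ * a⁻¹ * b⁻¹) := by rw [key]
  field_simp at this ⊢
  exact this

open Complex in
lemma norm_exp_neg_add_mul_I (a θ : ℝ) : ‖exp (-((a : ℂ) + θ * I))‖ = Real.exp (-a) := by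
  rw [norm_exp]; simp

open Complex in
/-- Cauchy's coefficient formula for the partition function. -/
lemma partitionFn_eq_integral {a : ℝ} (ha : 0 < a) (n : ℕ) :
    (2 * Real.pi : ℂ) * partitionFn n = ∫ θ in -Real.pi..Real.pi,
      (eulerProd (exp (-((a : ℂ) + θ * I))))⁻¹ * exp (n * ((a : ℂ) + θ * I)) := by
  have hq (θ : ℝ) : ‖exp (-((a : ℂ) + θ * I))‖ < 1 := by
    rw [norm_exp_neg_add_mul_I]; simpa using ha
  set F : ℕ → ℝ → ℂ := fun k θ =>
    (partitionFn k : ℂ) * exp (-((a : ℂ) + θ * I)) ^ k * exp (n * ((a : ℂ) + θ * I)) with hF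
  have hFc (k : ℕ) : Continuous (F k) := by simp only [hF]; fun_prop
  have hFn (k : ℕ) (θ : ℝ) : ‖F k θ‖ = Real.exp (n * a) * (partitionFn k * Real.exp (-a) ^ k) := by
    simp only [hF, norm_mul, norm_pow, norm_natCast, norm_exp]
    simp; ring
  have hs := (summable_partitionFn (Real.exp_pos (-a)).le (by simpa using ha)).mul_left
    (Real.exp (n * a))
  have hsum := intervalIntegral.hasSum_integral_of_dominated_convergence (μ := MeasureTheory.volume)
    (a := -Real.pi) (b := Real.pi) (F := F)
    (f := fun θ : ℝ => (eulerProd (exp (-((a : ℂ) + θ * I))))⁻¹ * exp (n * ((a : ℂ) + θ * I)))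
    (fun k _ => Real.exp (n * a) * (partitionFn k * Real.exp (-a) ^ k))
    (fun k => (hFc k).aestronglyMeasurable)
    (fun k => Filter.Eventually.of_forall fun θ _ => (hFn k θ).le)
    (Filter.Eventually.of_forall fun _ _ => hs)
    intervalIntegrable_const
    (Filter.Eventually.of_forall fun θ _ => (hasSum_partitionFn (hq θ)).mul_right _)
  rw [← hsum.tsum_eq, tsum_eq_single n]
  · have : ∀ θ : ℝ, F n θ = partitionFn n := fun θ => by
      simp only [hF]
      rw [mul_assoc, ← exp_nat_mul, ← exp_add, mul_neg, neg_add_cancel, exp_zero, mul_one]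
    simp only [this, intervalIntegral.integral_const]
    rw [Complex.real_smul]
    push_cast; ring
  · intro k hk
    have hnk : ((n : ℂ) - k) * I ≠ 0 := by
      refine mul_ne_zero (sub_ne_zero.2 ?_) I_ne_zero
      exact_mod_cast hk.symm
    have e : ∀ θ : ℝ, F k θ = partitionFn k * exp ((n - k) * a) * exp ((((n : ℂ) - k) * I) * θ) := by
      intro θ
      simp only [hF]
      rw [mul_assoc, mul_assoc, ← exp_nat_mul, ← exp_add, ← exp_add]
      congr 2; ring
    simp only [e]
    rw [intervalIntegral.integral_const_mul, integral_exp_mul_complex hnk]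
    have : exp ((n - k : ℂ) * I * Real.pi) = exp ((n - k : ℂ) * I * (-Real.pi : ℝ)) := by
      rw [exp_eq_exp_iff_exists_int]
      exact ⟨n - k, by push_cast; ring⟩
    rw [this]; simp

open Complex in
lemma norm_one_sub_inv_le {w : ℂ} (hw : ‖w‖ < 1) :
    ‖(1 - w)⁻¹‖ ≤ (1 - ‖w‖)⁻¹ * Real.exp (w.re - ‖w‖) := by
  have h1 := hasSum_taylorSeries_neg_log hw
  have h2 := Real.hasSum_pow_div_log_of_abs_lt_one (x := ‖w‖) (by simpa using hw)
  have h1' := (hasSum_nat_add_iff' 1).2 (hasSum_re h1)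
  simp at h1'
  have hle : ∀ m : ℕ, (w ^ (m + 1) / ((m : ℂ) + 1)).re ≤ ‖w‖ ^ (m + 1) / ((m : ℝ) + 1) := by
    intro m
    refine (re_le_norm _).trans (le_of_eq ?_)
    rw [norm_div, norm_pow]
    congr 1
    exact_mod_cast norm_natCast (m + 1)
  have h3 := (hasSum_nat_add_iff' 1).2 h2
  have h4 := (hasSum_nat_add_iff' 1).2 h1'
  simp only [Finset.range_one, Finset.sum_singleton] at h3 h4
  have h5 := hasSum_le (fun m => hle (m + 1)) (by simpa using h4) (by simpa using h3)
  have hp : 0 < 1 - ‖w‖ := by linarith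
  have hne : 1 - w ≠ 0 := by
    intro h; rw [← sub_eq_zero.1 h] at hw; simp at hw
  have hn : 0 < ‖1 - w‖ := norm_pos_iff.2 hne
  rw [norm_inv, ← Real.exp_log (inv_pos.2 hn), ← Real.exp_log (inv_pos.2 hp), ← Real.exp_add,
    Real.exp_le_exp, Real.log_inv, Real.log_inv]
  simp [log_re] at h5
  linarith

/-- The generating function is dominated by its value at the modulus, with an exponential gain. -/
lemma norm_eulerProd_inv_le {q : ℂ} (hq : ‖q‖ < 1) :
    ‖(eulerProd q)⁻¹‖ ≤ ‖(eulerProd ‖q‖)⁻¹‖ * Real.exp ((q / (1 - q)).re - ‖q‖ / (1 - ‖q‖)) := by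
  have hr : ‖((‖q‖ : ℝ) : ℂ)‖ < 1 := by simpa using hq
  have t1 := ((tendsto_prod_eulerProd hq).inv₀ (eulerProd_ne_zero hq)).norm
  have t2 := ((tendsto_prod_eulerProd hr).inv₀ (eulerProd_ne_zero hr)).norm
  have g1 : HasSum (fun n : ℕ => (q ^ (n + 1)).re) (q / (1 - q)).re := by
    refine Complex.hasSum_re ?_
    simpa [pow_succ', div_eq_mul_inv] using (hasSum_geometric_of_norm_lt_one hq).mul_left q
  have g2 : HasSum (fun n : ℕ => ‖q‖ ^ (n + 1)) (‖q‖ / (1 - ‖q‖)) := by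
    simpa [pow_succ', div_eq_mul_inv] using
      (hasSum_geometric_of_lt_one (norm_nonneg q) hq).mul_left ‖q‖
  have t3 := (Real.continuous_exp.tendsto _).comp (g1.sub g2).tendsto_sum_nat
  refine le_of_tendsto_of_tendsto' t1 (t2.mul t3) fun N => ?_
  simp only [Function.comp_apply, Real.exp_sum, norm_inv, norm_prod, ← Finset.prod_inv_distrib,
    ← Finset.prod_mul_distrib]
  refine Finset.prod_le_prod (fun i _ => by positivity) fun i _ => ?_
  have hw : ‖q ^ (i + 1)‖ < 1 := by
    rw [norm_pow]; exact pow_lt_one₀ (norm_nonneg _) hq (by omega)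
  have := norm_one_sub_inv_le hw
  rw [norm_inv, norm_pow] at this
  rw [norm_pow] at hw
  have e : ‖1 - ((‖q‖ : ℝ) : ℂ) ^ (i + 1)‖ = 1 - ‖q‖ ^ (i + 1) := by
    rw [← Complex.ofReal_pow, ← Complex.ofReal_one, ← Complex.ofReal_sub, Complex.norm_real,
      Real.norm_of_nonneg (by linarith)]
  rw [e]; exact this

lemma partitionFn_succ_le (n : ℕ) : partitionFn (n + 1) ≤ 2 ^ n := by
  have := Fintype.card_le_of_surjective _ (Nat.Partition.ofComposition_surj (n := n + 1))
  rwa [composition_card] at this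

lemma partitionFn_zero : partitionFn 0 = 1 := by
  simp [partitionFn]

lemma norm_eulerProd_inv_sub_one_le {w : ℂ} (hw : ‖w‖ ≤ 1 / 4) :
    ‖(eulerProd w)⁻¹ - 1‖ ≤ 2 * ‖w‖ := by
  have h := (hasSum_nat_add_iff' 1).2 (hasSum_partitionFn (q := w) (by linarith))
  simp only [Finset.range_one, Finset.sum_singleton, partitionFn_zero] at h
  have g := (hasSum_geometric_of_lt_one (r := 2 * ‖w‖) (by positivity) (by linarith)).mul_left ‖w‖
  have := h.norm_le_of_bounded g fun n => by
    rw [norm_mul, norm_pow, Complex.norm_natCast, mul_pow, pow_succ]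
    have : (partitionFn (n + 1) : ℝ) ≤ 2 ^ n := by exact_mod_cast partitionFn_succ_le n
    nlinarith [mul_le_mul_of_nonneg_right this (show 0 ≤ ‖w‖ ^ n * ‖w‖ by positivity)]
  simp only [Nat.cast_one, pow_zero, mul_one] at this
  refine this.trans ?_
  rw [← div_eq_mul_inv, div_le_iff₀ (by linarith)]
  nlinarith [norm_nonneg w]

/-- The integrand of the main term in the circle method for the partition function. -/
noncomputable def circleKernel (N : ℝ) (z : ℂ) : ℂ :=
  (√(2 * Real.pi))⁻¹ * Complex.exp (Complex.log z / 2) *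
    Complex.exp (Real.pi ^ 2 / (6 * z) + N * z)

open Complex in
lemma eulerProd_inv_mul_exp {z : ℂ} (hz : 0 < z.re) (t : ℝ) :
    (eulerProd (exp (-z)))⁻¹ * exp (t * z) =
      circleKernel (t - 1 / 24) z * (eulerProd (exp (-(4 * Real.pi ^ 2 / z))))⁻¹ := by
  rw [eulerProd_inv_transform hz, circleKernel,
    show (Real.pi : ℂ) ^ 2 / (6 * z) + ((t - 1 / 24 : ℝ) : ℂ) * z =
      (Real.pi ^ 2 / (6 * z) - z / 24) + t * z by push_cast; ring, exp_add _ ((t : ℂ) * z)]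
  ring

open Complex in
lemma norm_circleKernel (N : ℝ) {z : ℂ} (hz : z ≠ 0) :
    ‖circleKernel N z‖ =
      √(‖z‖ / (2 * Real.pi)) * Real.exp (Real.pi ^ 2 / 6 * (z⁻¹).re + N * z.re) := by
  have h1 : ‖exp (log z / 2)‖ = √‖z‖ := by
    rw [norm_exp, Real.sqrt_eq_rpow, Real.rpow_def_of_pos (norm_pos_iff.2 hz)]
    have : (log z / 2).re = (log z).re / 2 := by
      rw [show log z / 2 = log z / ((2 : ℝ) : ℂ) by norm_num, div_ofReal_re]
    rw [this, log_re]; ring_nf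
  have h2 : (Real.pi ^ 2 / (6 * z) + N * z).re = Real.pi ^ 2 / 6 * (z⁻¹).re + N * z.re := by
    rw [show (Real.pi : ℂ) ^ 2 / (6 * z) + N * z = ((Real.pi ^ 2 / 6 : ℝ) : ℂ) * z⁻¹ + N * z by
      push_cast; ring, add_re, re_ofReal_mul, re_ofReal_mul]
  rw [circleKernel, norm_mul, norm_mul, h1, norm_exp, h2, norm_real, norm_inv,
    Real.norm_of_nonneg (Real.sqrt_nonneg _), Real.sqrt_div (norm_nonneg z)]
  ring

open Complex in
lemma inv_re_add_mul_I (a θ : ℝ) : (((a : ℂ) + θ * I)⁻¹).re = a / (a ^ 2 + θ ^ 2) := by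
  rw [inv_re, normSq_add_mul_I]; simp

open Complex in
lemma norm_exp_neg_inv (z : ℂ) :
    ‖exp (-(4 * Real.pi ^ 2 / z))‖ = Real.exp (-(4 * Real.pi ^ 2 * (z⁻¹).re)) := by
  rw [norm_exp, show (4 * (Real.pi : ℂ) ^ 2 / z) = ((4 * Real.pi ^ 2 : ℝ) : ℂ) * z⁻¹ by
    push_cast; ring, neg_re, re_ofReal_mul]

lemma exp_neg_le_quarter {y : ℝ} (hy : 3 ≤ y) : Real.exp (-y) ≤ 1 / 4 := by
  rw [Real.exp_neg, one_div]
  exact inv_anti₀ (by norm_num) (by linarith [Real.add_one_le_exp y])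

open Complex in
lemma norm_exp_sub_one_ge {a θ : ℝ} (ha : 0 ≤ a) (hθ : |θ| ≤ Real.pi) :
    2 / Real.pi * |θ| ≤ ‖exp ((a : ℂ) + θ * I) - 1‖ := by
  have h1 := Real.cos_le_one_sub_mul_cos_sq hθ
  refine (sq_le_sq₀ (by positivity) (norm_nonneg _)).1 ?_
  rw [← normSq_eq_norm_sq, normSq_apply, exp_add, exp_mul_I, ← ofReal_exp, ← ofReal_cos,
    ← ofReal_sin, mul_pow, sq_abs]
  simp only [sub_re, sub_im, add_re, add_im, ofReal_re, ofReal_im,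
    mul_re, mul_im, I_re, I_im, one_re, one_im]
  have h2 := Real.sin_sq_add_cos_sq θ
  have h3 : 1 ≤ Real.exp a := Real.one_le_exp ha
  have h4 : 0 ≤ (Real.exp a - 1) * (1 - Real.cos θ) :=
    mul_nonneg (by linarith) (by linarith [Real.cos_le_one θ])
  have e : (2 / Real.pi) ^ 2 * θ ^ 2 = 2 * (2 / Real.pi ^ 2 * θ ^ 2) := by ring
  rw [e]
  nlinarith [sq_nonneg (Real.exp a - 1)]

open Complex in
lemma norm_eulerProd_inv_exp_neg_mul_exp_le {a : ℝ} (ha : 0 < a) (ha1 : a ≤ 1) (t : ℝ) :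
    ‖(eulerProd (exp (-(a : ℂ))))⁻¹‖ * Real.exp (t * a) ≤
      3 / 2 * √(a / (2 * Real.pi)) * Real.exp (Real.pi ^ 2 / (6 * a) + (t - 1 / 24) * a) := by
  have hpi := Real.pi_gt_three
  have h5 := eulerProd_inv_mul_exp (z := a) (by simpa using ha) t
  have ha0 : (a : ℂ) ≠ 0 := by exact_mod_cast ha.ne'
  have hw : ‖exp (-(4 * Real.pi ^ 2 / (a : ℂ)))‖ ≤ 1 / 4 := by
    rw [norm_exp_neg_inv]
    refine exp_neg_le_quarter ?_
    rw [← ofReal_inv, ofReal_re, ← div_eq_mul_inv, le_div_iff₀ ha]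
    nlinarith
  have h6 := norm_eulerProd_inv_sub_one_le hw
  have h7 : ‖(eulerProd (exp (-(4 * Real.pi ^ 2 / (a : ℂ)))))⁻¹‖ ≤ 3 / 2 := by
    have := norm_sub_norm_le (eulerProd (exp (-(4 * Real.pi ^ 2 / (a : ℂ)))))⁻¹ 1
    rw [norm_one] at this
    linarith
  have h8 := congrArg norm h5
  rw [norm_mul, norm_mul, norm_circleKernel _ ha0, norm_exp, ← ofReal_inv, ofReal_re, ofReal_re,
    norm_real, Real.norm_of_nonneg ha.le, ← ofReal_mul, ofReal_re] at h8
  rw [h8, mul_comm _ ‖_‖, show Real.pi ^ 2 / 6 * a⁻¹ = Real.pi ^ 2 / (6 * a) by field_simp,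
    mul_assoc (3 / 2 : ℝ)]
  gcongr

open Complex in
/-- The bound on the minor arc. -/
lemma norm_eulerProd_inv_mul_exp_le_of_ge {a θ : ℝ} (ha : 0 < a) (ha1 : a ≤ 1)
    (hθ : 5 * Real.pi * a ≤ |θ|) (hθ' : |θ| ≤ Real.pi) (t : ℝ) :
    ‖(eulerProd (exp (-((a : ℂ) + θ * I))))⁻¹ * exp (t * ((a : ℂ) + θ * I))‖ ≤
      3 / 2 * √(a / (2 * Real.pi)) * Real.exp (Real.pi ^ 2 / (6 * a) + (t - 1 / 24) * a) *
        Real.exp (1 - 9 / (10 * a)) := by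
  have hpi := Real.pi_gt_three
  have hq : ‖exp (-((a : ℂ) + θ * I))‖ < 1 := by
    rw [norm_exp_neg_add_mul_I]; simpa using ha
  have h1 := norm_eulerProd_inv_le hq
  rw [norm_exp_neg_add_mul_I, ofReal_exp, ofReal_neg] at h1
  have h2 : exp (-((a : ℂ) + θ * I)) / (1 - exp (-((a : ℂ) + θ * I))) =
      (exp ((a : ℂ) + θ * I) - 1)⁻¹ := by
    rw [exp_neg]
    have := exp_ne_zero ((a : ℂ) + θ * I)
    rw [inv_eq_one_div, div_div, mul_sub, mul_one, mul_one_div_cancel this, one_div]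
  have h3 : (exp (-((a : ℂ) + θ * I)) / (1 - exp (-((a : ℂ) + θ * I)))).re ≤ 1 / (10 * a) := by
    rw [h2]
    refine (re_le_norm _).trans ?_
    rw [norm_inv, ← one_div]
    refine one_div_le_one_div_of_le (by positivity) (le_trans ?_ (norm_exp_sub_one_ge ha.le hθ'))
    calc 10 * a = 2 / Real.pi * (5 * Real.pi * a) := by field_simp; ring
      _ ≤ _ := by gcongr
  have h4 : 1 / a - 1 ≤ Real.exp (-a) / (1 - Real.exp (-a)) := by
    have e1 : Real.exp (-a) < 1 := by simpa using ha
    have e2 := Real.add_one_le_exp (-a)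
    rw [le_div_iff₀ (by linarith), div_sub_one ha.ne', div_mul_eq_mul_div, div_le_iff₀ ha]
    nlinarith
  rw [norm_mul, norm_exp]
  have h9 : ((t : ℂ) * ((a : ℂ) + θ * I)).re = t * a := by simp
  rw [h9]
  calc ‖(eulerProd (exp (-((a : ℂ) + θ * I))))⁻¹‖ * Real.exp (t * a)
      ≤ (‖(eulerProd (exp (-(a : ℂ))))⁻¹‖ * Real.exp (1 - 9 / (10 * a))) * Real.exp (t * a) := by
        gcongr
        refine h1.trans ?_
        refine mul_le_mul_of_nonneg_left (Real.exp_le_exp.2 ?_) (norm_nonneg _)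
        have : 1 / a - 1 / (10 * a) = 9 / (10 * a) := by field_simp; norm_num
        linarith
    _ = (‖(eulerProd (exp (-(a : ℂ))))⁻¹‖ * Real.exp (t * a)) * Real.exp (1 - 9 / (10 * a)) := by
        ring
    _ ≤ _ := by
        exact mul_le_mul_of_nonneg_right (norm_eulerProd_inv_exp_neg_mul_exp_le ha ha1 t)
          (Real.exp_pos _).le

open Complex in
lemma norm_sub_circleKernel_le {a θ : ℝ} (ha : 0 < a) (ha1 : a ≤ 1 / 50)
    (hθ : |θ| ≤ 5 * Real.pi * a) (t : ℝ) :
    ‖(eulerProd (exp (-((a : ℂ) + θ * I))))⁻¹ * exp (t * ((a : ℂ) + θ * I)) -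
        circleKernel (t - 1 / 24) ((a : ℂ) + θ * I)‖ ≤
      2 * √(‖(a : ℂ) + θ * I‖ / (2 * Real.pi)) * Real.exp ((t - 1 / 24) * a) := by
  have hpi := Real.pi_gt_three
  have hre : ((a : ℂ) + θ * I).re = a := by simp
  have hz0 : (a : ℂ) + θ * I ≠ 0 := by
    intro h; rw [h] at hre; simp at hre; linarith
  rw [eulerProd_inv_mul_exp (by rwa [hre]) t]
  have hθ2 : θ ^ 2 ≤ (5 * Real.pi * a) ^ 2 := by
    rw [← sq_abs]; gcongr
  have hu : 0 ≤ a / (a ^ 2 + θ ^ 2) := by positivity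
  have hw : ‖exp (-(4 * Real.pi ^ 2 / ((a : ℂ) + θ * I)))‖ ≤ 1 / 4 := by
    rw [norm_exp_neg_inv]
    refine exp_neg_le_quarter ?_
    rw [inv_re_add_mul_I, ← mul_div_assoc, le_div_iff₀ (by positivity)]
    have e1 : a ^ 2 ≤ a * (1 / 50) := by rw [sq]; gcongr
    have e2 : 3 * (a ^ 2 + θ ^ 2) ≤ 3 * (a ^ 2 * (1 + 25 * Real.pi ^ 2)) := by
      linarith
    have e3 : a ^ 2 * (1 + 25 * Real.pi ^ 2) ≤ a * (1 / 50) * (1 + 25 * Real.pi ^ 2) := by gcongr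
    have e4 : a * 9 ≤ a * Real.pi ^ 2 := by gcongr; nlinarith
    linarith
  have h6 := norm_eulerProd_inv_sub_one_le hw
  rw [show ∀ u v : ℂ, u * v - u = u * (v - 1) by intros; ring, norm_mul, norm_circleKernel _ hz0, hre]
  rw [norm_exp_neg_inv] at h6
  calc _ ≤ √(‖(a : ℂ) + θ * I‖ / (2 * Real.pi)) *
        Real.exp (Real.pi ^ 2 / 6 * (((a : ℂ) + θ * I)⁻¹).re + (t - 1 / 24) * a) *
        (2 * Real.exp (-(4 * Real.pi ^ 2 * (((a : ℂ) + θ * I)⁻¹).re))) := by gcongr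
    _ = 2 * √(‖(a : ℂ) + θ * I‖ / (2 * Real.pi)) *
        Real.exp ((Real.pi ^ 2 / 6 * (((a : ℂ) + θ * I)⁻¹).re + (t - 1 / 24) * a) +
        (-(4 * Real.pi ^ 2 * (((a : ℂ) + θ * I)⁻¹).re))) := by rw [Real.exp_add _ (-_)]; ring
    _ ≤ _ := by
        gcongr
        rw [inv_re_add_mul_I]
        nlinarith [mul_nonneg (sq_nonneg Real.pi) hu]

section
variable {μ : ℝ}

lemma sqrt_div_two_pi_le {b c : ℝ} (hb : 0 ≤ c) (h : b ≤ 6 * c ^ 2) : √(b / (2 * Real.pi)) ≤ c := by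
  have hpi := Real.pi_gt_three
  rw [Real.sqrt_le_left hb, div_le_iff₀ (by positivity)]
  nlinarith [mul_nonneg (sq_nonneg c) (by linarith : 0 ≤ Real.pi - 3)]

open Complex in
lemma norm_add_mul_I_le {a θ : ℝ} (ha : 0 < a) (ha1 : a ≤ 1 / 50) (hθ : |θ| ≤ 5 * Real.pi * a) :
    ‖(a : ℂ) + θ * I‖ ≤ 6 * (1 / 4) ^ 2 := by
  have hpi := Real.pi_lt_d2
  calc _ ≤ ‖(a : ℂ)‖ + ‖(θ : ℂ) * I‖ := norm_add_le _ _
    _ = a + |θ| := by simp [abs_of_pos ha]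
    _ ≤ a + 5 * Real.pi * a := by gcongr
    _ ≤ _ := by nlinarith

lemma pi_sq_lt : Real.pi ^ 2 < 9.87 := by
  nlinarith [Real.pi_lt_d4, Real.pi_pos]

lemma pi_sq_gt : 9.869 < Real.pi ^ 2 := by
  nlinarith [Real.pi_gt_d4, Real.pi_pos]

open Complex in
lemma norm_sub_circleKernel_le_exp (hμ : 128 ≤ μ) {a t θ : ℝ} (ha : a = 2 * Real.pi ^ 2 / (9 * μ))
    (ht : t - 1 / 24 = 3 * μ ^ 2 / (2 * Real.pi ^ 2)) (hθ : |θ| ≤ 5 * Real.pi * a) :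
    ‖(eulerProd (exp (-((a : ℂ) + θ * I))))⁻¹ * exp (t * ((a : ℂ) + θ * I)) -
        circleKernel (t - 1 / 24) ((a : ℂ) + θ * I)‖ ≤ 1 / 2 * Real.exp (2 * μ / 3) := by
  have hpi := pi_sq_lt
  have ha0 : 0 < a := by rw [ha]; have := Real.pi_pos; positivity
  have ha1 : a ≤ 1 / 50 := by
    rw [ha, div_le_iff₀ (by positivity)]; linarith
  refine (norm_sub_circleKernel_le ha0 ha1 hθ t).trans ?_
  have h1 : (t - 1 / 24) * a = μ / 3 := by
    rw [ht, ha]; field_simp; norm_num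
  have h2 := sqrt_div_two_pi_le (by norm_num) (norm_add_mul_I_le ha0 ha1 hθ)
  calc _ ≤ 2 * (1 / 4) * Real.exp (2 * μ / 3) := by
        gcongr; rw [h1]; linarith
    _ = _ := by ring

open Complex in
lemma norm_circleIntegrand_le_exp (hμ : 128 ≤ μ) {a t θ : ℝ} (ha : a = 2 * Real.pi ^ 2 / (9 * μ))
    (ht : t - 1 / 24 = 3 * μ ^ 2 / (2 * Real.pi ^ 2))
    (hθ : (Real.pi ^ 2 / (3 * μ)) ^ 2 ≤ a ^ 2 + θ ^ 2)
    (hθ' : |θ| ≤ Real.pi) :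
    ‖(eulerProd (exp (-((a : ℂ) + θ * I))))⁻¹ * exp (t * ((a : ℂ) + θ * I))‖ ≤
      Real.exp (27 * μ / 40) := by
  have hpi := pi_sq_lt
  have hpi' := Real.pi_pos
  have ha0 : 0 < a := by rw [ha]; positivity
  have ha1 : a ≤ 1 / 50 := by
    rw [ha, div_le_iff₀ (by positivity)]; linarith
  have h1 : (t - 1 / 24) * a = μ / 3 := by
    rw [ht, ha]; field_simp; norm_num
  rcases le_total |θ| (5 * Real.pi * a) with h | h
  · have e1 := norm_sub_circleKernel_le_exp hμ ha ht h
    have e2 := sqrt_div_two_pi_le (by norm_num) (norm_add_mul_I_le ha0 ha1 h)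
    have hre : ((a : ℂ) + θ * I).re = a := by simp
    have hz0 : (a : ℂ) + θ * I ≠ 0 := by
      intro h; rw [h] at hre; simp at hre; linarith
    have e3 := norm_circleKernel (t - 1 / 24) hz0
    rw [inv_re_add_mul_I, hre, h1] at e3
    have e4 : Real.pi ^ 2 / 6 * (a / (a ^ 2 + θ ^ 2)) ≤ μ / 3 := by
      calc Real.pi ^ 2 / 6 * (a / (a ^ 2 + θ ^ 2))
          ≤ Real.pi ^ 2 / 6 * (a / (Real.pi ^ 2 / (3 * μ)) ^ 2) := by gcongr
        _ = μ / 3 := by rw [ha]; field_simp; norm_num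
    have e5 : ‖circleKernel (t - 1 / 24) ((a : ℂ) + θ * I)‖ ≤ 1 / 4 * Real.exp (2 * μ / 3) := by
      rw [e3]; gcongr; linarith
    calc _ ≤ _ + _ := norm_le_norm_sub_add _ (circleKernel (t - 1 / 24) ((a : ℂ) + θ * I))
      _ ≤ 1 / 2 * Real.exp (2 * μ / 3) + 1 / 4 * Real.exp (2 * μ / 3) := add_le_add e1 e5
      _ ≤ 1 * Real.exp (2 * μ / 3) := by nlinarith [Real.exp_pos (2 * μ / 3)]
      _ ≤ _ := by rw [one_mul, Real.exp_le_exp]; linarith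
  · refine (norm_eulerProd_inv_mul_exp_le_of_ge ha0 (by linarith) h hθ' t).trans ?_
    have e2 := sqrt_div_two_pi_le (b := a) (c := 1 / 10) (by norm_num) (by linarith)
    have e3 : Real.pi ^ 2 / (6 * a) = 3 / 4 * μ := by rw [ha]; field_simp; norm_num
    have e4 : 9 / (10 * a) = 81 / 20 * (μ / Real.pi ^ 2) := by rw [ha]; field_simp; norm_num
    have e5 : μ / 9.87 ≤ μ / Real.pi ^ 2 := by gcongr
    rw [h1, e3, e4, mul_assoc, ← Real.exp_add]
    have e6 : Real.exp 1 ≤ 3 := Real.exp_one_lt_three.le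
    calc 3 / 2 * √(a / (2 * Real.pi)) * Real.exp (3 / 4 * μ + μ / 3 + (1 - 81 / 20 * (μ / Real.pi ^ 2)))
        ≤ 3 / 2 * (1 / 10) * Real.exp (1 + 27 * μ / 40) := by
          refine mul_le_mul (by gcongr) (Real.exp_le_exp.2 ?_) (Real.exp_pos _).le (by norm_num)
          norm_num at e5
          linarith
      _ = 3 / 2 * (1 / 10) * Real.exp 1 * Real.exp (27 * μ / 40) := by rw [Real.exp_add]; ring
      _ ≤ 3 / 2 * (1 / 10) * 3 * Real.exp (27 * μ / 40) := by gcongr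
      _ ≤ _ := by nlinarith [Real.exp_pos (27 * μ / 40)]

open Complex in
lemma continuous_eulerProd_inv_mul_exp {a : ℝ} (ha : 0 < a) (n : ℕ) :
    Continuous fun θ : ℝ =>
      (eulerProd (exp (-((a : ℂ) + θ * I))))⁻¹ * exp (n * ((a : ℂ) + θ * I)) := by
  have hq (θ : ℝ) : ‖exp (-((a : ℂ) + θ * I))‖ < 1 := by
    rw [norm_exp_neg_add_mul_I]; simpa using ha
  refine Continuous.mul ?_ (by fun_prop)
  have : (fun θ : ℝ => (eulerProd (exp (-((a : ℂ) + θ * I))))⁻¹) =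
      fun θ : ℝ => ∑' k, (partitionFn k : ℂ) * exp (-((a : ℂ) + θ * I)) ^ k :=
    funext fun θ => (hasSum_partitionFn (hq θ)).tsum_eq.symm
  rw [this]
  refine continuous_tsum (fun k => by fun_prop)
    (summable_partitionFn (Real.exp_pos (-a)).le (by simpa using ha)) fun k θ => le_of_eq ?_
  rw [norm_mul, norm_pow, norm_exp_neg_add_mul_I, norm_natCast]

open Complex in
lemma continuous_circleKernel {a : ℝ} (ha : 0 < a) (N : ℝ) :
    Continuous fun θ : ℝ => circleKernel N ((a : ℂ) + θ * I) := by
  have hre (θ : ℝ) : ((a : ℂ) + θ * I).re = a := by simp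
  have hz0 (θ : ℝ) : 6 * ((a : ℂ) + θ * I) ≠ 0 := by
    intro h
    have := congrArg Complex.re (by simpa using h : (a : ℂ) + θ * I = 0)
    rw [hre] at this; simp at this; linarith
  unfold circleKernel
  refine Continuous.mul (Continuous.mul (by fun_prop) ?_) ?_
  · refine Continuous.cexp (Continuous.div_const (Continuous.clog (by fun_prop) fun θ => Or.inl ?_) _)
    rw [hre]; exact ha
  · exact Continuous.cexp
      (Continuous.add (Continuous.div continuous_const (by fun_prop) hz0) (by fun_prop))

open Complex in
lemma norm_partitionFn_sub_integral_le (hμ : 128 ≤ μ) {n : ℕ} {a θ₀ : ℝ}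
    (ha : a = 2 * Real.pi ^ 2 / (9 * μ)) (hn : (n : ℝ) - 1 / 24 = 3 * μ ^ 2 / (2 * Real.pi ^ 2))
    (hθ₀ : 0 ≤ θ₀) (hθ₀' : θ₀ ^ 2 = (Real.pi ^ 2 / (3 * μ)) ^ 2 - a ^ 2) :
    ‖(2 * Real.pi : ℂ) * partitionFn n -
      ∫ θ in (-θ₀)..θ₀, circleKernel (n - 1 / 24) ((a : ℂ) + θ * I)‖ ≤
      2 * Real.pi * Real.exp (27 * μ / 40) := by
  have hpi := Real.pi_gt_three
  have hpi2 := pi_sq_lt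
  have ha0 : 0 < a := by rw [ha]; positivity
  have ha1 : a ≤ 1 / 50 := by
    rw [ha, div_le_iff₀ (by positivity)]; linarith
  have hx : Real.pi ^ 2 / (3 * μ) = 3 / 2 * a := by rw [ha]; field_simp; norm_num
  have hθa : θ₀ ≤ 5 * Real.pi * a := by
    rw [hx] at hθ₀'
    refine (sq_le_sq₀ hθ₀ (by positivity)).1 ?_
    have : 3 ^ 2 * a ^ 2 ≤ Real.pi ^ 2 * a ^ 2 := by gcongr
    nlinarith [mul_pos ha0 ha0]
  have hθpi : θ₀ ≤ Real.pi := hθa.trans (by nlinarith)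
  set F : ℝ → ℂ := fun θ =>
    (eulerProd (exp (-((a : ℂ) + θ * I))))⁻¹ * exp (n * ((a : ℂ) + θ * I)) with hF
  set g : ℝ → ℂ := fun θ => circleKernel (n - 1 / 24) ((a : ℂ) + θ * I) with hg
  have hFc : Continuous F := continuous_eulerProd_inv_mul_exp ha0 n
  have hgc : Continuous g := continuous_circleKernel ha0 _
  have hi (u v : ℝ) : IntervalIntegrable F MeasureTheory.volume u v := hFc.intervalIntegrable u v
  have hsplit : (∫ θ in -Real.pi..Real.pi, F θ) - ∫ θ in (-θ₀)..θ₀, g θ =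
      (∫ θ in -Real.pi..(-θ₀), F θ) + (∫ θ in (-θ₀)..θ₀, (F θ - g θ)) + ∫ θ in θ₀..Real.pi, F θ := by
    rw [intervalIntegral.integral_sub (hi _ _) (hgc.intervalIntegrable _ _),
      ← intervalIntegral.integral_add_adjacent_intervals (hi (-Real.pi) θ₀) (hi θ₀ Real.pi),
      ← intervalIntegral.integral_add_adjacent_intervals (hi (-Real.pi) (-θ₀)) (hi (-θ₀) θ₀)]
    ring
  have hout (θ : ℝ) (h : θ₀ ≤ |θ|) (h' : |θ| ≤ Real.pi) : ‖F θ‖ ≤ Real.exp (27 * μ / 40) := by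
    have := norm_circleIntegrand_le_exp hμ ha hn (θ := θ) ?_ h'
    · simpa [hF] using this
    · rw [← sub_le_iff_le_add', ← hθ₀', ← sq_abs θ]; gcongr
  have b1 := intervalIntegral.norm_integral_le_of_norm_le_const (a := -Real.pi) (b := -θ₀) (f := F)
    (C := Real.exp (27 * μ / 40)) fun θ hθ => by
      rw [Set.uIoc_of_le (by linarith)] at hθ
      have : |θ| = -θ := abs_of_nonpos (by linarith [hθ.2])
      exact hout θ (by rw [this]; linarith [hθ.2]) (by rw [this]; linarith [hθ.1])
  have b2 := intervalIntegral.norm_integral_le_of_norm_le_const (a := θ₀) (b := Real.pi) (f := F)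
    (C := Real.exp (27 * μ / 40)) fun θ hθ => by
      rw [Set.uIoc_of_le (by linarith)] at hθ
      have : |θ| = θ := abs_of_nonneg (by linarith [hθ.1])
      exact hout θ (by rw [this]; linarith [hθ.1]) (by rw [this]; linarith [hθ.2])
  have b3 := intervalIntegral.norm_integral_le_of_norm_le_const (a := -θ₀) (b := θ₀)
    (f := fun θ => F θ - g θ) (C := Real.exp (27 * μ / 40)) fun θ hθ => by
      rw [Set.uIoc_of_le (by linarith)] at hθ
      have := norm_sub_circleKernel_le_exp hμ ha hn (θ := θ) (by
        rw [abs_le]; constructor <;> linarith [hθ.1, hθ.2])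
      refine le_trans (by simpa [hF, hg] using this) ?_
      refine (mul_le_of_le_one_left (Real.exp_pos _).le (by norm_num)).trans ?_
      rw [Real.exp_le_exp]; linarith
  rw [partitionFn_eq_integral ha0 n, hsplit]
  rw [abs_of_nonneg (by linarith)] at b1 b2 b3
  calc _ ≤ _ := norm_add₃_le
    _ ≤ _ := add_le_add (add_le_add b1 b3) b2
    _ = _ := by ring
end

open Complex in
lemma differentiableOn_circleKernel (N : ℝ) :
    DifferentiableOn ℂ (circleKernel N) {z | 0 < z.re} := by
  intro z hz
  have hz0 : z ≠ 0 := by rintro rfl; simp at hz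
  refine DifferentiableAt.differentiableWithinAt ?_
  unfold circleKernel
  have h1 : DifferentiableAt ℂ log z := differentiableAt_log (Or.inl hz)
  have h2 : DifferentiableAt ℂ (fun z : ℂ => (Real.pi : ℂ) ^ 2 / (6 * z)) z :=
    DifferentiableAt.div (by fun_prop) (by fun_prop) (by simpa using hz0)
  fun_prop

open Complex in
/-- Moving the central part of the vertical segment to a circular arc. -/
lemma integral_circleKernel_eq_arc (N : ℝ) {x φ : ℝ} (hx : 0 < x) (hφ0 : 0 ≤ φ)
    (hφ : φ ≤ Real.pi) (hcos : Real.cos φ = 2 / 3) :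
    ∫ θ in (-(x * Real.sin φ))..(x * Real.sin φ),
      circleKernel N (((2 * x / 3 : ℝ) : ℂ) + θ * I) =
    ∫ t in (-φ)..φ, circleKernel N (x * exp (t * I)) * (x * exp (t * I)) := by
  have hball : Metric.ball ((2 * x : ℝ) : ℂ) (2 * x) ⊆ {z | 0 < z.re} := by
    intro z hz
    rw [Metric.mem_ball, dist_eq] at hz
    have := (abs_lt.1 ((abs_re_le_norm _).trans_lt hz)).1
    rw [sub_re, ofReal_re] at this
    simp only [Set.mem_ofPred_eq]; linarith
  have hmem {z : ℂ} (h : (z.re - 2 * x) ^ 2 + z.im ^ 2 < 4 * x ^ 2) :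
      z ∈ Metric.ball ((2 * x : ℝ) : ℂ) (2 * x) := by
    rw [Metric.mem_ball, dist_eq, ← sq_lt_sq₀ (norm_nonneg _) (by positivity),
      ← normSq_eq_norm_sq, normSq_apply, sub_re, sub_im, ofReal_re, ofReal_im]
    nlinarith
  obtain ⟨G, hG⟩ := ((differentiableOn_circleKernel N).mono hball).isExactOn_ball
  have hsin : Real.sin φ ^ 2 = 5 / 9 := by
    have := Real.sin_sq_add_cos_sq φ; rw [hcos] at this; linarith
  have hsin0 : 0 ≤ Real.sin φ := Real.sin_nonneg_of_nonneg_of_le_pi hφ0 hφ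
  have hx2 : 0 < x ^ 2 := by positivity
  have hl (θ : ℝ) (hθ : θ ∈ Set.uIcc (-(x * Real.sin φ)) (x * Real.sin φ)) :
      ((2 * x / 3 : ℝ) : ℂ) + θ * I ∈ Metric.ball ((2 * x : ℝ) : ℂ) (2 * x) := by
    rw [Set.uIcc_of_le (by nlinarith), Set.mem_Icc, ← abs_le] at hθ
    have h2 : θ ^ 2 ≤ (x * Real.sin φ) ^ 2 := by rw [← sq_abs]; gcongr
    rw [mul_pow, hsin] at h2
    refine hmem ?_
    simp only [add_re, add_im, ofReal_re, ofReal_im, re_ofReal_mul, im_ofReal_mul, I_re, I_im]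
    nlinarith
  have ha (t : ℝ) (ht : t ∈ Set.uIcc (-φ) φ) :
      (x : ℂ) * exp (t * I) ∈ Metric.ball ((2 * x : ℝ) : ℂ) (2 * x) := by
    rw [Set.uIcc_of_le (by linarith), Set.mem_Icc, ← abs_le] at ht
    have h2 : 2 / 3 ≤ Real.cos t := by
      rw [← hcos, ← Real.cos_abs t]
      exact Real.cos_le_cos_of_nonneg_of_le_pi (abs_nonneg t) hφ ht
    refine hmem ?_
    rw [re_ofReal_mul, im_ofReal_mul, exp_ofReal_mul_I_re, exp_ofReal_mul_I_im]
    have h3 := Real.sin_sq_add_cos_sq t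
    have : (x * Real.cos t - 2 * x) ^ 2 + (x * Real.sin t) ^ 2 = x ^ 2 * (5 - 4 * Real.cos t) := by
      linear_combination x ^ 2 * h3
    rw [this]; nlinarith
  have d1 (θ : ℝ) (hθ : θ ∈ Set.uIcc (-(x * Real.sin φ)) (x * Real.sin φ)) :
      HasDerivAt (fun θ : ℝ => G (((2 * x / 3 : ℝ) : ℂ) + θ * I))
        (circleKernel N (((2 * x / 3 : ℝ) : ℂ) + θ * I) * I) θ := by
    have e : HasDerivAt (fun θ : ℝ => ((2 * x / 3 : ℝ) : ℂ) + θ * I) I θ := by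
      simpa using ((hasDerivAt_id θ).ofReal_comp.mul_const I).const_add ((2 * x / 3 : ℝ) : ℂ)
    exact (hG _ (hl θ hθ)).comp θ e
  have d2 (t : ℝ) (ht : t ∈ Set.uIcc (-φ) φ) :
      HasDerivAt (fun t : ℝ => G (x * exp (t * I)))
        (circleKernel N (x * exp (t * I)) * (x * exp (t * I)) * I) t := by
    have e : HasDerivAt (fun t : ℝ => (x : ℂ) * exp (t * I)) (x * (exp (t * I) * I)) t := by
      have := ((hasDerivAt_id t).ofReal_comp.mul_const I).cexp.const_mul (x : ℂ)
      simpa using this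
    have := (hG _ (ha t ht)).comp t e
    rwa [show ∀ c : ℂ, c * (x * (exp (t * I) * I)) = c * (x * exp (t * I)) * I by intro c; ring]
      at this
  have cG : ContinuousOn (circleKernel N) (Metric.ball ((2 * x : ℝ) : ℂ) (2 * x)) :=
    ((differentiableOn_circleKernel N).mono hball).continuousOn
  have i1 : IntervalIntegrable (fun θ : ℝ => circleKernel N (((2 * x / 3 : ℝ) : ℂ) + θ * I) * I)
      MeasureTheory.volume (-(x * Real.sin φ)) (x * Real.sin φ) := by
    refine ContinuousOn.intervalIntegrable (ContinuousOn.mul ?_ continuousOn_const)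
    exact cG.comp (Continuous.continuousOn (by fun_prop)) hl
  have i2 : IntervalIntegrable (fun t : ℝ => circleKernel N (x * exp (t * I)) * (x * exp (t * I)) * I)
      MeasureTheory.volume (-φ) φ := by
    refine ContinuousOn.intervalIntegrable
      (ContinuousOn.mul (ContinuousOn.mul ?_ (by fun_prop)) continuousOn_const)
    exact cG.comp (Continuous.continuousOn (by fun_prop)) ha
  have f1 := intervalIntegral.integral_eq_sub_of_hasDerivAt d1 i1
  have f2 := intervalIntegral.integral_eq_sub_of_hasDerivAt d2 i2
  rw [intervalIntegral.integral_mul_const] at f1 f2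
  refine mul_right_cancel₀ I_ne_zero (f1.trans (Eq.trans ?_ f2.symm))
  have e1 : ((2 * x / 3 : ℝ) : ℂ) + ((x * Real.sin φ : ℝ) : ℂ) * I = x * exp (φ * I) := by
    rw [exp_mul_I, ← ofReal_cos, ← ofReal_sin, hcos]; push_cast; ring
  have e2 : ((2 * x / 3 : ℝ) : ℂ) + ((-(x * Real.sin φ) : ℝ) : ℂ) * I =
      x * exp ((-φ : ℝ) * I) := by
    rw [exp_mul_I, ← ofReal_cos, ← ofReal_sin, Real.cos_neg, Real.sin_neg, hcos]; push_cast; ring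
  rw [e1, e2]

open Complex in
lemma circleKernel_arc {N x μ t : ℝ} (hx : 0 < x) (h1 : N * x = μ / 2)
    (h2 : Real.pi ^ 2 / (6 * x) = μ / 2) (ht : t ∈ Set.Ioc (-Real.pi) Real.pi) :
    (circleKernel N (x * exp (t * I)) * (x * exp (t * I))).re =
      x * √(x / (2 * Real.pi)) * (Real.cos (3 * t / 2) * Real.exp (μ * Real.cos t)) := by
  have e1 : exp (log (x * exp (t * I)) / 2) = (√x : ℝ) * exp (t / 2 * I) := by
    rw [log_ofReal_mul hx (exp_ne_zero _), log_exp (by simpa using ht.1) (by simpa using ht.2),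
      add_div, exp_add, Real.sqrt_eq_rpow, Real.rpow_def_of_pos hx]
    push_cast
    ring_nf
  have e2 : (Real.pi : ℂ) ^ 2 / (6 * (x * exp (t * I))) + N * (x * exp (t * I)) =
      ((μ * Real.cos t : ℝ) : ℂ) := by
    have h1' : (N : ℂ) * x = μ / 2 := by exact_mod_cast h1
    have h2' : (Real.pi : ℂ) ^ 2 / (6 * x) = μ / 2 := by exact_mod_cast h2
    rw [← mul_assoc, ← mul_assoc, h1', ← div_div, h2', div_eq_mul_inv _ (exp _), ← exp_neg]
    push_cast
    rw [Complex.cos]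
    ring_nf
  rw [circleKernel, e1, e2, ← ofReal_exp, Real.sqrt_div hx.le]
  have e3 : ((((√(2 * Real.pi))⁻¹ : ℝ) : ℂ) * ((√x : ℝ) * exp (t / 2 * I)) * (Real.exp (μ * Real.cos t) : ℝ) *
      (x * exp (t * I))) = ((((√(2 * Real.pi))⁻¹ * √x * Real.exp (μ * Real.cos t) * x : ℝ)) : ℂ) *
      exp ((3 * t / 2 : ℝ) * I) := by
    rw [show ((3 * t / 2 : ℝ) : ℂ) * I = t / 2 * I + t * I by push_cast; ring, exp_add]
    push_cast; ring
  rw [e3, re_ofReal_mul, exp_ofReal_mul_I_re]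
  ring

lemma integral_cos_mul_exp_cos (μ φ : ℝ) :
    ∫ t in (-φ)..φ, Real.cos (3 * t / 2) * Real.exp (μ * Real.cos t) =
      Real.exp μ * ∫ v in (-(2 * Real.sin (φ / 2)))..(2 * Real.sin (φ / 2)),
        (1 - v ^ 2) * Real.exp (-(μ / 2) * v ^ 2) := by
  have h := intervalIntegral.integral_comp_mul_deriv (a := -φ) (b := φ)
    (f := fun t => 2 * Real.sin (t / 2)) (f' := fun t => Real.cos (t / 2))
    (g := fun v => (1 - v ^ 2) * Real.exp (-(μ / 2) * v ^ 2))
    (fun t _ => by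
      simpa [mul_div_assoc, mul_comm] using (((hasDerivAt_id t).div_const 2).sin).const_mul 2)
          (by fun_prop) (by fun_prop)
  rw [show (2 * Real.sin (-φ / 2)) = -(2 * Real.sin (φ / 2)) by rw [neg_div, Real.sin_neg]; ring] at h
  rw [← h, ← intervalIntegral.integral_const_mul]
  refine intervalIntegral.integral_congr fun t _ => ?_
  simp only [Function.comp_apply]
  obtain ⟨s, rfl⟩ : ∃ s, t = 2 * s := ⟨t / 2, by ring⟩
  have := Real.sin_sq_add_cos_sq s
  have e1 : Real.cos (3 * (2 * s) / 2) = (1 - (2 * Real.sin s) ^ 2) * Real.cos s := by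
    rw [show 3 * (2 * s) / 2 = 3 * s by ring, Real.cos_three_mul]
    linear_combination (4 * Real.cos s) * this
  have e2 : μ * Real.cos (2 * s) = μ + -(μ / 2) * (2 * Real.sin s) ^ 2 := by
    rw [Real.cos_two_mul]
    linear_combination (2 * μ) * this
  rw [e1, e2, Real.exp_add, show 2 * s / 2 = s by ring]
  ring

open MeasureTheory in
lemma abs_integral_gaussian_sub_le {b v : ℝ} (hb : 1 / 2 ≤ b) (hv : 0 ≤ v) :
    |(∫ t in (-v)..v, Real.exp (-b * t ^ 2)) - √(Real.pi / b)| ≤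
      √(2 * Real.pi) * Real.exp (-(b - 1 / 2) * v ^ 2) := by
  have hb0 : 0 < b := by linarith
  have hi := integrable_exp_neg_mul_sq hb0
  have hi2 := integrable_exp_neg_mul_sq (b := 1 / 2) (by norm_num)
  rw [intervalIntegral.integral_of_le (by linarith), ← integral_gaussian,
    ← integral_add_compl measurableSet_Ioc hi, sub_add_cancel_left, abs_neg,
    abs_of_nonneg (integral_nonneg fun t => (Real.exp_pos _).le)]
  have h2 := integral_gaussian (1 / 2)
  rw [show Real.pi / (1 / 2) = 2 * Real.pi by ring] at h2
  rw [← h2, mul_comm, ← integral_const_mul]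
  calc _ ≤ ∫ t in (Set.Ioc (-v) v)ᶜ, Real.exp (-(b - 1 / 2) * v ^ 2) * Real.exp (-(1 / 2) * t ^ 2) := by
        refine setIntegral_mono_on hi.integrableOn (hi2.const_mul _).integrableOn
          measurableSet_Ioc.compl fun t ht => ?_
        have : v ^ 2 ≤ t ^ 2 := by
          rw [Set.mem_compl_iff, Set.mem_Ioc, not_and_or, not_lt, not_le] at ht
          rcases ht with h | h <;> nlinarith
        rw [← Real.exp_add, Real.exp_le_exp]
        nlinarith
    _ ≤ _ := setIntegral_le_integral (hi2.const_mul _)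
        (Filter.Eventually.of_forall fun t => by positivity)

lemma integral_one_sub_sq_mul_gaussian {μ : ℝ} (hμ : μ ≠ 0) (v : ℝ) :
    ∫ t in (-v)..v, (1 - t ^ 2) * Real.exp (-(μ / 2) * t ^ 2) =
      (1 - 1 / μ) * (∫ t in (-v)..v, Real.exp (-(μ / 2) * t ^ 2)) +
        2 * v / μ * Real.exp (-(μ / 2) * v ^ 2) := by
  have h := intervalIntegral.integral_eq_sub_of_hasDerivAt (a := -v) (b := v)
    (f := fun t => t * Real.exp (-(μ / 2) * t ^ 2))
    (f' := fun t => (1 - μ * t ^ 2) * Real.exp (-(μ / 2) * t ^ 2))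
    (fun t _ => by
      have := (hasDerivAt_id t).mul (((hasDerivAt_pow 2 t).const_mul (-(μ / 2))).exp)
      refine this.congr_deriv ?_
      simp only [id_eq, Nat.cast_ofNat, Nat.add_one_sub_one, pow_one]
      ring) (Continuous.intervalIntegrable (by fun_prop) _ _)
  have e : ∀ t : ℝ, (1 - t ^ 2) * Real.exp (-(μ / 2) * t ^ 2) =
      (1 - 1 / μ) * Real.exp (-(μ / 2) * t ^ 2) +
        1 / μ * ((1 - μ * t ^ 2) * Real.exp (-(μ / 2) * t ^ 2)) := by
    intro t; field_simp; ring
  simp only [e]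
  rw [intervalIntegral.integral_add (Continuous.intervalIntegrable (by fun_prop) _ _)
    (Continuous.intervalIntegrable (by fun_prop) _ _), intervalIntegral.integral_const_mul,
    intervalIntegral.integral_const_mul, h, neg_sq]
  ring

lemma abs_integral_one_sub_sq_mul_gaussian_sub_le {μ v : ℝ} (hμ : 2 ≤ μ) (hv0 : 0 ≤ v)
    (hv2 : v ^ 2 = 2 / 3) :
    |(∫ t in (-v)..v, (1 - t ^ 2) * Real.exp (-(μ / 2) * t ^ 2)) -
      (1 - 1 / μ) * √(Real.pi / (μ / 2))| ≤ 10 * Real.exp (-(μ / 3)) := by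
  have hpi := Real.pi_gt_three
  have hμ0 : 0 < μ := by linarith
  rw [integral_one_sub_sq_mul_gaussian hμ0.ne', hv2]
  have hg := abs_integral_gaussian_sub_le (b := μ / 2) (by linarith) hv0
  rw [hv2] at hg
  set H : ℝ := ∫ t in (-v)..v, Real.exp (-(μ / 2) * t ^ 2)
  have hv1 : v ≤ 1 := by nlinarith
  have hm : 0 ≤ 1 - 1 / μ ∧ 1 - 1 / μ ≤ 1 := by
    have h3 : 1 / μ ≤ 1 := by rw [div_le_one hμ0]; linarith
    have h4 : 0 ≤ 1 / μ := by positivity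
    constructor <;> linarith
  have hs : √(2 * Real.pi) ≤ 3 := by
    rw [Real.sqrt_le_left (by norm_num)]; nlinarith [Real.pi_lt_d2]
  have he : Real.exp (1 / 3) ≤ 3 :=
    (Real.exp_le_exp.2 (by norm_num)).trans Real.exp_one_lt_three.le
  have hg' : |H - √(Real.pi / (μ / 2))| ≤ 9 * Real.exp (-(μ / 2) * (2 / 3)) := by
    refine hg.trans ?_
    rw [show -(μ / 2 - 1 / 2) * (2 / 3) = 1 / 3 + -(μ / 2) * (2 / 3) by ring, Real.exp_add]
    calc _ ≤ 3 * (3 * Real.exp (-(μ / 2) * (2 / 3))) := by gcongr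
      _ = _ := by ring
  have hb : |(1 - 1 / μ) * (H - √(Real.pi / (μ / 2))) + 2 * v / μ * Real.exp (-(μ / 2) * (2 / 3))| ≤
      10 * Real.exp (-(μ / 2) * (2 / 3)) := by
    refine (abs_add_le _ _).trans ?_
    rw [abs_mul, abs_of_nonneg hm.1, abs_of_nonneg (a := 2 * v / μ * _) (by positivity)]
    have h5 : 2 * v / μ ≤ 1 := by rw [div_le_one hμ0]; linarith
    calc _ ≤ 1 * (9 * Real.exp (-(μ / 2) * (2 / 3))) + 1 * Real.exp (-(μ / 2) * (2 / 3)) :=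
          add_le_add (mul_le_mul hm.2 hg' (abs_nonneg _) zero_le_one) (by gcongr)
      _ = _ := by ring
  rw [add_sub_right_comm, ← mul_sub]
  refine hb.trans (le_of_eq ?_)
  ring_nf

/-- Rademacher's formula with the first Kloosterman term only and an exponentially smaller error. -/
lemma abs_partitionFn_sub_le {μ : ℝ} (hμ : 128 ≤ μ) {n : ℕ}
    (hn : (n : ℝ) - 1 / 24 = 3 * μ ^ 2 / (2 * Real.pi ^ 2)) :
    |partitionFn n - Real.sqrt 12 * Real.pi ^ 2 / (36 * μ ^ 2) * (1 - 1 / μ) * Real.exp μ| ≤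
      2 * Real.exp (27 * μ / 40) := by
  have hpi := Real.pi_gt_three
  have hpi2 := pi_sq_lt
  have hμ0 : 0 < μ := by linarith
  set x : ℝ := Real.pi ^ 2 / (3 * μ) with hx
  have hx0 : 0 < x := by positivity
  have hx1 : x ≤ 3 / 100 := by rw [hx, div_le_iff₀ (by positivity)]; linarith
  set N : ℝ := n - 1 / 24 with hN
  have h1 : N * x = μ / 2 := by rw [hn, hx]; field_simp
  have h2 : Real.pi ^ 2 / (6 * x) = μ / 2 := by rw [hx]; field_simp; norm_num
  set φ : ℝ := Real.arccos (2 / 3) with hφ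
  have hφ0 : 0 ≤ φ := Real.arccos_nonneg _
  have hcos : Real.cos φ = 2 / 3 := Real.cos_arccos (by norm_num) (by norm_num)
  have hφpi : φ < Real.pi := by
    refine lt_of_le_of_ne (Real.arccos_le_pi _) fun h => ?_
    rw [h, Real.cos_pi] at hcos; norm_num at hcos
  have hsin : Real.sin φ ^ 2 = 5 / 9 := by
    have := Real.sin_sq_add_cos_sq φ; rw [hcos] at this; linarith
  have hsin0 : 0 ≤ Real.sin φ := Real.sin_nonneg_of_nonneg_of_le_pi hφ0 hφpi.le
  have key := norm_partitionFn_sub_integral_le hμ (n := n) (a := 2 * x / 3) (θ₀ := x * Real.sin φ)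
    (by rw [hx]; ring) hn (by positivity) (by rw [mul_pow, hsin, ← hx]; ring)
  rw [integral_circleKernel_eq_arc N hx0 hφ0 hφpi.le hcos] at key
  set v : ℝ := 2 * Real.sin (φ / 2) with hv
  have hv0 : 0 ≤ v := by
    have := Real.sin_nonneg_of_nonneg_of_le_pi (x := φ / 2) (by linarith) (by linarith)
    positivity
  have hv2 : v ^ 2 = 2 / 3 := by
    have := Real.cos_two_mul (φ / 2)
    rw [show 2 * (φ / 2) = φ by ring, hcos] at this
    have := Real.sin_sq_add_cos_sq (φ / 2)
    rw [hv]; linarith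
  set S : ℝ := x * √(x / (2 * Real.pi)) with hS
  set H : ℝ := ∫ t in (-v)..v, (1 - t ^ 2) * Real.exp (-(μ / 2) * t ^ 2) with hH
  have h_arc : (∫ t in (-φ)..φ, circleKernel N (x * Complex.exp (t * Complex.I)) *
      (x * Complex.exp (t * Complex.I))).re =
      S * (Real.exp μ * H) := by
    have hcont : IntervalIntegrable (fun t : ℝ => circleKernel N (x * Complex.exp (t * Complex.I)) *
        (x * Complex.exp (t * Complex.I))) MeasureTheory.volume (-φ) φ := by
      refine ContinuousOn.intervalIntegrable (ContinuousOn.mul ?_ (by fun_prop))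
      refine (differentiableOn_circleKernel N).continuousOn.comp
        (Continuous.continuousOn (by fun_prop)) fun t ht => ?_
      rw [Set.uIcc_of_le (by linarith), Set.mem_Icc, ← abs_le] at ht
      have h2 : 2 / 3 ≤ Real.cos t := by
        rw [← hcos, ← Real.cos_abs t]
        exact Real.cos_le_cos_of_nonneg_of_le_pi (abs_nonneg t) hφpi.le ht
      simp only [Set.mem_ofPred_eq]
      rw [Complex.re_ofReal_mul, Complex.exp_ofReal_mul_I_re]
      exact mul_pos hx0 (by linarith)
    have := Complex.reCLM.intervalIntegral_comp_comm hcont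
    simp only [Complex.reCLM_apply] at this
    rw [← this, ← integral_cos_mul_exp_cos,
      ← intervalIntegral.integral_const_mul]
    refine intervalIntegral.integral_congr fun t ht => ?_
    rw [Set.uIcc_of_le (by linarith)] at ht
    exact circleKernel_arc hx0 h1 h2 ⟨by linarith [ht.1], by linarith [ht.2]⟩
  have hre := (Complex.abs_re_le_norm _).trans key
  rw [Complex.sub_re, h_arc] at hre
  have hp : ((2 * Real.pi : ℂ) * partitionFn n).re = 2 * Real.pi * partitionFn n := by
    rw [show (2 * Real.pi : ℂ) * partitionFn n = ((2 * Real.pi * partitionFn n : ℝ) : ℂ) by push_cast; rfl,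
      Complex.ofReal_re]
  rw [hp] at hre
  have hmain : S * (Real.exp μ * ((1 - 1 / μ) * √(Real.pi / (μ / 2)))) =
      2 * Real.pi * (Real.sqrt 12 * Real.pi ^ 2 / (36 * μ ^ 2) * (1 - 1 / μ) * Real.exp μ) := by
    have e0 : √(x / (2 * Real.pi)) * √(Real.pi / (μ / 2)) = Real.pi * √12 / (6 * μ) := by
      rw [← Real.sqrt_mul (by positivity),
        show x / (2 * Real.pi) * (Real.pi / (μ / 2)) = 12 * (Real.pi / (6 * μ)) ^ 2 by
          rw [hx]; field_simp; norm_num,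
        Real.sqrt_mul (by norm_num), Real.sqrt_sq (by positivity)]
      ring
    calc _ = x * (√(x / (2 * Real.pi)) * √(Real.pi / (μ / 2))) * (1 - 1 / μ) * Real.exp μ := by
          rw [hS]; ring
      _ = _ := by rw [e0, hx]; ring
  have hSle : S ≤ 1 / 10 := by
    have := sqrt_div_two_pi_le (b := x) (c := 1) (by norm_num) (by linarith)
    calc S ≤ 3 / 100 * 1 := by rw [hS]; gcongr
      _ ≤ _ := by norm_num
  have hS0 : 0 ≤ S := by positivity
  have herr : |S * (Real.exp μ * H) -
      S * (Real.exp μ * ((1 - 1 / μ) * √(Real.pi / (μ / 2))))| ≤ Real.exp (27 * μ / 40) := by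
    rw [← mul_sub, ← mul_sub, abs_mul S, abs_mul (Real.exp μ), abs_of_nonneg hS0, Real.abs_exp]
    have := abs_integral_one_sub_sq_mul_gaussian_sub_le (μ := μ) (by linarith) hv0 hv2
    calc _ ≤ 1 / 10 * (Real.exp μ * (10 * Real.exp (-(μ / 3)))) := by gcongr
      _ = Real.exp (μ + -(μ / 3)) := by rw [Real.exp_add]; ring
      _ ≤ _ := by rw [Real.exp_le_exp]; linarith
  rw [hmain] at herr
  have := abs_sub_le (2 * Real.pi * partitionFn n) _ _ |>.trans (add_le_add hre herr)
  rw [← mul_sub, abs_mul, abs_of_pos (by positivity)] at this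
  refine le_of_mul_le_mul_left (this.trans ?_) (by positivity : 0 < 2 * Real.pi)
  nlinarith [Real.exp_pos (27 * μ / 40)]

lemma sub_eq_muP_sq {n : ℕ} (hn : 1 ≤ n) :
    (n : ℝ) - 1 / 24 = 3 * muP n ^ 2 / (2 * Real.pi ^ 2) := by
  have h : (1 : ℝ) ≤ n := by exact_mod_cast hn
  have := Real.pi_ne_zero
  rw [muP, div_pow, mul_pow, Real.sq_sqrt (by linarith)]
  field_simp; ring

lemma four_mul_pow_eight_lt_exp {μ : ℝ} (hμ : 128 ≤ μ) :
    4 * μ ^ 8 < Real.exp (13 * μ / 40) := by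
  have h0 : 0 < μ := by linarith
  have h1 : 178 ≤ Real.exp (26 / 5) := by
    have e1 : (2.718 : ℝ) ≤ Real.exp 1 := by linarith [Real.exp_one_gt_d9]
    have e2 : (1.2 : ℝ) ≤ Real.exp (1 / 5) := by linarith [Real.add_one_le_exp (1 / 5 : ℝ)]
    calc (178 : ℝ) ≤ 2.718 ^ 5 * 1.2 := by norm_num
      _ ≤ Real.exp 1 ^ 5 * Real.exp (1 / 5) := by gcongr
      _ = _ := by rw [← Real.exp_nat_mul, ← Real.exp_add]; norm_num
  have h2 : 1.2 * μ ≤ Real.exp (13 * μ / 320) := by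
    have e1 := Real.add_one_le_exp (13 * μ / 320 - 26 / 5)
    calc 1.2 * μ ≤ 178 * (13 * μ / 320 - 26 / 5 + 1) := by linarith
      _ ≤ Real.exp (26 / 5) * Real.exp (13 * μ / 320 - 26 / 5) :=
        mul_le_mul h1 e1 (by linarith) (Real.exp_pos _).le
      _ = _ := by rw [← Real.exp_add]; ring_nf
  calc 4 * μ ^ 8 < (1.2 * μ) ^ 8 := by
        rw [mul_pow]; gcongr; norm_num
    _ ≤ Real.exp (13 * μ / 320) ^ 8 := by gcongr
    _ = _ := by rw [← Real.exp_nat_mul]; ring_nf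

lemma sqrt_twelve_mul_gt : 18 < √12 * Real.pi ^ 2 := by
  have h1 : 3 ≤ √12 := Real.le_sqrt_of_sq_le (by norm_num)
  have h2 := pi_sq_gt
  nlinarith

lemma le_muP {n : ℕ} (hn : 2500 ≤ n) : 128 ≤ muP n := by
  have h : (2500 : ℝ) ≤ n := by exact_mod_cast hn
  have h1 : 244.9 ≤ Real.sqrt (24 * (n : ℝ) - 1) := Real.le_sqrt_of_sq_le (by linarith)
  have := Real.pi_gt_d4
  rw [muP]
  nlinarith

/-- The bounds for all large `n`, from the circle method. -/
lemma partition_bounds_of_large {n : ℕ} (hn : 2500 ≤ n) :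
    Real.sqrt 12 * Real.pi ^ 2 * Real.exp (muP n) / (36 * (muP n) ^ 8) *
        ((muP n) ^ 6 - (muP n) ^ 5 - 1) < (partitionFn n : ℝ) ∧
    (partitionFn n : ℝ) <
      Real.sqrt 12 * Real.pi ^ 2 * Real.exp (muP n) / (36 * (muP n) ^ 8) *
        ((muP n) ^ 6 - (muP n) ^ 5 + 1) := by
  have hμ := le_muP hn
  have key := abs_partitionFn_sub_le hμ (sub_eq_muP_sq (by omega))
  have hexp := four_mul_pow_eight_lt_exp hμ
  have hK := sqrt_twelve_mul_gt
  generalize muP n = μ at *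
  generalize √12 * Real.pi ^ 2 = K at *
  have hμ0 : 0 < μ := by linarith
  have herr : 2 * Real.exp (27 * μ / 40) < K * Real.exp μ / (36 * μ ^ 8) := by
    rw [lt_div_iff₀ (by positivity)]
    have e : Real.exp μ = Real.exp (27 * μ / 40) * Real.exp (13 * μ / 40) := by
      rw [← Real.exp_add]; ring_nf
    have h1 := Real.exp_pos (27 * μ / 40)
    calc 2 * Real.exp (27 * μ / 40) * (36 * μ ^ 8)
        = 18 * (Real.exp (27 * μ / 40) * (4 * μ ^ 8)) := by ring
      _ < 18 * (Real.exp (27 * μ / 40) * Real.exp (13 * μ / 40)) := by gcongr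
      _ ≤ _ := by rw [e]; gcongr
  have e1 : K * Real.exp μ / (36 * μ ^ 8) * (μ ^ 6 - μ ^ 5 - 1) =
      K / (36 * μ ^ 2) * (1 - 1 / μ) * Real.exp μ - K * Real.exp μ / (36 * μ ^ 8) := by
    field_simp
  have e2 : K * Real.exp μ / (36 * μ ^ 8) * (μ ^ 6 - μ ^ 5 + 1) =
      K / (36 * μ ^ 2) * (1 - 1 / μ) * Real.exp μ + K * Real.exp μ / (36 * μ ^ 8) := by
    field_simp
  rw [e1, e2]
  rw [abs_le] at key
  constructor <;> linarith

lemma sum_mul_pow_div_mod {B : ℕ} (f : ℕ → ℕ) {N n : ℕ} (hn : n < N) (hf : ∀ k < N, f k < B) :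
    (∑ k ∈ Finset.range N, f k * B ^ k) / B ^ n % B = f n := by
  induction n generalizing N f with
  | zero =>
    obtain ⟨N, rfl⟩ := Nat.exists_eq_succ_of_ne_zero hn.ne'
    have : ∑ k ∈ Finset.range N, f (k + 1) * B ^ (k + 1) =
        B * ∑ k ∈ Finset.range N, f (k + 1) * B ^ k := by
      rw [Finset.mul_sum]
      exact Finset.sum_congr rfl fun k _ => by ring
    rw [Finset.sum_range_succ', this, pow_zero, Nat.div_one, mul_one, Nat.mul_add_mod,
      Nat.mod_eq_of_lt (hf 0 hn)]
  | succ n ih =>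
    obtain ⟨N, rfl⟩ := Nat.exists_eq_succ_of_ne_zero (Nat.ne_zero_of_lt hn)
    have : ∑ k ∈ Finset.range N, f (k + 1) * B ^ (k + 1) =
        B * ∑ k ∈ Finset.range N, f (k + 1) * B ^ k := by
      rw [Finset.mul_sum]
      exact Finset.sum_congr rfl fun k _ => by ring
    have hB : 0 < B := (hf 0 (by omega)).pos
    rw [Finset.sum_range_succ', this, pow_succ', ← Nat.div_div_eq_div_mul, pow_zero, mul_one,
      Nat.mul_add_div hB, Nat.div_eq_of_lt (hf 0 (by omega)), add_zero]
    exact ih (fun k => f (k + 1)) (by omega) fun k hk => hf (k + 1) (by omega)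

lemma sum_mul_pow_lt {B : ℕ} (f : ℕ → ℕ) {N : ℕ} (hf : ∀ k < N, f k < B) :
    ∑ k ∈ Finset.range N, f k * B ^ k < B ^ N := by
  induction N with
  | zero => simp
  | succ N ih =>
    rw [Finset.sum_range_succ, pow_succ']
    have h1 := ih fun k hk => hf k (by omega)
    have h2 : (f N + 1) * B ^ N ≤ B * B ^ N := Nat.mul_le_mul_right _ (hf N (by omega))
    linarith

open Complex in
lemma partitionFn_le_exp {a : ℝ} (ha : 0 < a) (ha1 : a ≤ 1) (n : ℕ) :
    (partitionFn n : ℝ) ≤ Real.exp (Real.pi ^ 2 / (6 * a) + n * a) := by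
  have hpi := Real.pi_gt_three
  have hr : Real.exp (-a) < 1 := by simpa using ha
  have hs := summable_partitionFn (Real.exp_pos (-a)).le hr
  have hq : ‖((Real.exp (-a) : ℝ) : ℂ)‖ < 1 := by
    rwa [norm_real, Real.norm_of_nonneg (Real.exp_pos _).le]
  have h1 : ∑' k, (partitionFn k : ℝ) * Real.exp (-a) ^ k =
      ‖(eulerProd (exp (-(a : ℂ))))⁻¹‖ := by
    have := (hasSum_partitionFn hq).tsum_eq
    rw [show exp (-(a : ℂ)) = ((Real.exp (-a) : ℝ) : ℂ) by push_cast; rfl, ← this,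
      ← Real.norm_of_nonneg (tsum_nonneg fun k => by positivity :
        0 ≤ ∑' k, (partitionFn k : ℝ) * Real.exp (-a) ^ k), ← norm_real]
    push_cast
    rfl
  have h2 := hs.le_tsum n fun k _ => by positivity
  have h3 := norm_eulerProd_inv_exp_neg_mul_exp_le ha ha1 n
  have h4 : 3 / 2 * √(a / (2 * Real.pi)) ≤ 1 := by
    have : √(a / (2 * Real.pi)) ≤ 1 / 2 := by
      rw [Real.sqrt_le_left (by norm_num), div_le_iff₀ (by positivity)]
      linarith
    linarith
  rw [h1] at h2
  have h5 : Real.exp (-a) ^ n * Real.exp (n * a) = 1 := by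
    rw [← Real.exp_nat_mul, ← Real.exp_add]; simp
  calc (partitionFn n : ℝ) = partitionFn n * Real.exp (-a) ^ n * Real.exp (n * a) := by
        rw [mul_assoc, h5, mul_one]
    _ ≤ ‖(eulerProd (exp (-(a : ℂ))))⁻¹‖ * Real.exp (n * a) := by gcongr
    _ ≤ 1 * Real.exp (Real.pi ^ 2 / (6 * a) + n * a) := by
        refine h3.trans (mul_le_mul h4 (Real.exp_le_exp.2 ?_) (Real.exp_pos _).le zero_le_one)
        linarith
    _ = _ := one_mul _

open PowerSeries in
lemma pow_dvd_sum_mul_sum_sub_one (N : ℕ) (B : ℤ) :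
    B ^ N ∣ (∑ i ∈ Finset.range N, (partitionFn i : ℤ) * B ^ i) *
      (∑ i ∈ Finset.range N, coeff i (pentagonalSeries ℤ) * B ^ i) - 1 := by
  rcases Nat.eq_zero_or_pos N with rfl | hN
  · simp
  have h : (Polynomial.X : Polynomial ℤ) ^ N ∣
      trunc N (PowerSeries.mk fun n => (partitionFn n : ℤ)) * trunc N (pentagonalSeries ℤ) - 1 := by
    rw [Polynomial.X_pow_dvd_iff]
    intro d hd
    have := coeff_mul_eq_coeff_trunc_mul_trunc (PowerSeries.mk fun n => (partitionFn n : ℤ))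
      (pentagonalSeries ℤ) hd
    rw [partitionSeries_mul_pentagonalSeries, ← Polynomial.coe_one, ← Polynomial.coe_mul,
      Polynomial.coeff_coe, Polynomial.coeff_coe] at this
    rw [Polynomial.coeff_sub, ← this, sub_self]
  have := Polynomial.eval_dvd (x := B) h
  simpa [Polynomial.eval, eval₂_trunc_eq_sum_range] using this

/-- The alternating sum `∑ (-1) ^ (J - k) * B ^ pentagonal k` over `-J ≤ k ≤ J`. -/
def pentagonalSum (B : ℕ) : ℕ → ℕ
  | 0 => 1
  | j + 1 => B ^ ((j + 1) * (3 * j + 2) / 2) + B ^ ((j + 1) * (3 * j + 4) / 2) - pentagonalSum B j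

lemma pentagonalSum_le {B : ℕ} (hB : 0 < B) (j : ℕ) :
    pentagonalSum B j ≤ B ^ ((j + 1) * (3 * j + 2) / 2) + B ^ ((j + 1) * (3 * j + 4) / 2) := by
  cases j with
  | zero =>
    have : 1 ≤ B ^ 1 := Nat.one_le_pow _ _ hB
    simp only [pentagonalSum]
    norm_num
    omega
  | succ j =>
    refine (Nat.sub_le _ _).trans (Nat.add_le_add ?_ ?_) <;>
    exact Nat.pow_le_pow_right hB (Nat.div_le_div_right (Nat.mul_le_mul (by omega) (by omega)))

lemma pentagonal_natCast_add_one (j : ℕ) :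
    pentagonal (j + 1 : ℤ) = (j + 1) * (3 * j + 2) / 2 := by
  have h := two_mul_natCast_pentagonal (j + 1 : ℤ)
  have h2 : 2 * pentagonal (j + 1 : ℤ) = (j + 1) * (3 * j + 2) := by
    zify; rw [h]; ring
  omega

lemma pentagonal_neg_natCast_add_one (j : ℕ) :
    pentagonal (-(j + 1) : ℤ) = (j + 1) * (3 * j + 4) / 2 := by
  have h := two_mul_natCast_pentagonal_neg (j + 1 : ℤ)
  have h2 : 2 * pentagonal (-(j + 1) : ℤ) = (j + 1) * (3 * j + 4) := by
    zify; rw [h]; ring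
  omega

lemma pentagonalSum_eq {B : ℕ} (hB : 0 < B) (J : ℕ) :
    (pentagonalSum B J : ℤ) =
      (-1) ^ J * ∑ k ∈ Finset.Icc (-J : ℤ) J, (Int.negOnePow k : ℤ) * B ^ pentagonal k := by
  induction J with
  | zero => simp [pentagonalSum, pentagonal]
  | succ j ih =>
    have e : Finset.Icc (-(j + 1 : ℕ) : ℤ) (j + 1 : ℕ) =
        insert (j + 1 : ℤ) (insert (-(j + 1) : ℤ) (Finset.Icc (-j : ℤ) j)) := by
      ext x; simp; omega
    have e1 : ((-(j + 1 : ℤ)).negOnePow : ℤ) = -(-1) ^ j := by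
      rw [Int.negOnePow_neg, Int.negOnePow_succ]; simp [Int.negOnePow_def]
    have e2 : (((j + 1 : ℤ)).negOnePow : ℤ) = -(-1) ^ j := by
      rw [Int.negOnePow_succ]; simp [Int.negOnePow_def]
    have e3 : ((-1 : ℤ) ^ j) * (-1) ^ j = 1 := by rw [← mul_pow]; simp
    rw [pentagonalSum, Nat.cast_sub (pentagonalSum_le hB j), ih, e, Finset.sum_insert,
      Finset.sum_insert, pentagonal_natCast_add_one, pentagonal_neg_natCast_add_one, e1, e2]
    · push_cast
      linear_combination (-(B : ℤ) ^ ((j + 1) * (3 * j + 2) / 2) -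
        (B : ℤ) ^ ((j + 1) * (3 * j + 4) / 2)) * e3
    · simp
    · simp; omega

lemma pentagonal_lt_iff (k : ℤ) : pentagonal k < 2501 ↔ k ∈ Finset.Icc (-40 : ℤ) 40 := by
  have h := two_mul_natCast_pentagonal k
  rw [Finset.mem_Icc]
  constructor
  · intro h1
    have : k * (3 * k - 1) ≤ 5000 := by omega
    constructor <;> nlinarith
  · rintro ⟨h1, h2⟩
    have : k * (3 * k - 1) ≤ 5000 := by nlinarith
    omega

open PowerSeries in
lemma sum_coeff_pentagonalSeries {B : ℕ} (hB : 0 < B) :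
    ∑ i ∈ Finset.range 2501, coeff i (pentagonalSeries ℤ) * (B : ℤ) ^ i = pentagonalSum B 40 := by
  rw [pentagonalSum_eq hB]
  have h : (Finset.Icc (-40 : ℤ) 40).image pentagonal ⊆ Finset.range 2501 := by
    intro i hi
    obtain ⟨k, hk, rfl⟩ := Finset.mem_image.1 hi
    exact Finset.mem_range.2 ((pentagonal_lt_iff k).2 hk)
  rw [← Finset.sum_subset h, Finset.sum_image pentagonal_injective.injOn]
  · rw [Even.neg_one_pow (by decide), one_mul]
    exact Finset.sum_congr rfl fun k _ => by rw [coeff_pentagonalSeries_pentagonal]; rfl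
  · intro i hi hi'
    rw [coeff_pentagonalSeries_eq_zero, zero_mul]
    rintro ⟨k, rfl⟩
    exact hi' (Finset.mem_image_of_mem _ ((pentagonal_lt_iff k).1 (Finset.mem_range.1 hi)))

lemma partitionFn_lt {n : ℕ} (hn : n < 2501) : partitionFn n < 2 ^ 256 := by
  have h := partitionFn_le_exp (a := 1 / 40) (by norm_num) (by norm_num) n
  have hpi := pi_sq_lt
  norm_num only [div_eq_mul_inv] at h
  have hn' : (n : ℝ) ≤ 2500 := by exact_mod_cast Nat.le_of_lt_succ hn
  have h1 : Real.exp 129 < 3 ^ 129 := by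
    rw [← mul_one (129 : ℝ), ← Nat.cast_ofNat (n := 129), Real.exp_nat_mul]
    exact pow_lt_pow_left₀ (Real.exp_one_lt_three) (Real.exp_pos _).le (by norm_num)
  have h2 : (partitionFn n : ℝ) < 3 ^ 129 := h.trans_lt
    ((Real.exp_le_exp.2 (by linarith)).trans_lt h1)
  have h3 : partitionFn n < 3 ^ 129 := by exact_mod_cast h2
  exact h3.trans (by norm_num)

/-- An inverse of `pentagonalSum B 40` modulo `B ^ 2501` has the values of the partition function as
its base `B` digits. -/
lemma partitionFn_eq_div_mod {B T n : ℕ} (hB : B = 2 ^ 256) (hn : n < 2501) (hT : T < B ^ 2501)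
    (h : T * pentagonalSum B 40 % B ^ 2501 = 1) :
    partitionFn n = T / B ^ n % B := by
  have hp : ∀ k < 2501, partitionFn k < B := fun k hk => hB ▸ partitionFn_lt hk
  have hB0 : 0 < B := (hp 0 (by norm_num)).pos
  set S := ∑ k ∈ Finset.range 2501, partitionFn k * B ^ k with hS
  have h1 := pow_dvd_sum_mul_sum_sub_one 2501 (B : ℤ)
  rw [sum_coeff_pentagonalSeries hB0] at h1
  have h2 : S * pentagonalSum B 40 ≡ 1 [MOD B ^ 2501] := by
    rw [← Int.natCast_modEq_iff]
    refine (Int.modEq_of_dvd ?_).symm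
    push_cast [hS]
    exact h1
  have h3 : T * pentagonalSum B 40 ≡ 1 [MOD B ^ 2501] := by
    have h4 : 1 < B ^ 2501 := Nat.one_lt_pow (Nat.succ_ne_zero 2500) (by
      rw [hB]; exact Nat.one_lt_two_pow (by norm_num))
    rw [Nat.ModEq, h, Nat.mod_eq_of_lt h4]
  have h5 : T ≡ S [MOD B ^ 2501] := by
    calc T = T * 1 := (mul_one T).symm
      _ ≡ T * (S * pentagonalSum B 40) [MOD B ^ 2501] := (h2.mul_left T).symm
      _ = S * (T * pentagonalSum B 40) := by ring
      _ ≡ S * 1 [MOD B ^ 2501] := h3.mul_left S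
      _ = S := mul_one S
  have h6 : T = S := by
    have h7 := sum_mul_pow_lt partitionFn hp
    rwa [Nat.ModEq, Nat.mod_eq_of_lt hT, Nat.mod_eq_of_lt h7] at h5
  rw [h6, hS, sum_mul_pow_div_mod partitionFn hn hp]

/-- Application of `f` to `n`, in a form that makes the kernel evaluate `n` first. -/
def forceNat {α : Type} (n : ℕ) (f : ℕ → α) : α :=
  Nat.rec (f 0) (fun k _ => f (k + 1)) n

lemma forceNat_eq {α : Type} (n : ℕ) (f : ℕ → α) : forceNat n f = f n := by
  cases n <;> rfl

/-- Fixed point evaluation, rounded down, of `∑ j < k, x ^ j / j! + x ^ k / k! * y`, where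
`x = t / Q` and where `y` and the value are scaled by `S`. -/
def taylorLower (S t Q : ℕ) : ℕ → ℕ → ℕ
  | 0, h => h
  | k + 1, h => taylorLower S t Q k (S + t * h / ((k + 1) * Q))

/-- Fixed point evaluation, rounded up, of `∑ j < k, x ^ j / j! + x ^ k / k! * y`, where
`x = t / Q` and where `y` and the value are scaled by `S`. -/
def taylorUpper (S t Q : ℕ) : ℕ → ℕ → ℕ
  | 0, h => h
  | k + 1, h => taylorUpper S t Q k (S + t * h / ((k + 1) * Q) + 1)

/-- Repeated squaring in fixed point arithmetic with scale `S`, rounded down. -/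
def squareLower (S : ℕ) : ℕ → ℕ → ℕ
  | 0, h => h
  | k + 1, h => forceNat h fun h => squareLower S k (h * h / S)

/-- Repeated squaring in fixed point arithmetic with scale `S`, rounded up. -/
def squareUpper (S : ℕ) : ℕ → ℕ → ℕ
  | 0, h => h
  | k + 1, h => forceNat h fun h => squareUpper S k (h * h / S + 1)

lemma natCast_div_le_mul {S m Q : ℕ} (hS : 0 < S) : ((m / Q : ℕ) : ℝ) / S ≤ m / S / Q := by
  rw [div_right_comm]
  gcongr
  exact Nat.cast_div_le

lemma mul_le_natCast_div_add_one {S m Q : ℕ} (hQ : 0 < Q) (hS : 0 < S) :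
    (m : ℝ) / S / Q ≤ ((m / Q + 1 : ℕ) : ℝ) / S := by
  rw [div_right_comm]
  gcongr
  rw [div_le_iff₀ (by positivity)]
  exact_mod_cast (Nat.lt_div_mul_add hQ).le.trans (by rw [add_mul, one_mul])

lemma taylorLower_le {S t Q : ℕ} (hS : 0 < S) (k h : ℕ) :
    (taylorLower S t Q k h : ℝ) / S ≤
      ∑ j ∈ Finset.range k, ((t : ℝ) / Q) ^ j / j.factorial +
        ((t : ℝ) / Q) ^ k / k.factorial * (h / S) := by
  induction k generalizing h with
  | zero => simp [taylorLower]
  | succ k ih =>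
    refine (ih _).trans ?_
    rw [Finset.sum_range_succ, add_assoc]
    gcongr
    have h1 := natCast_div_le_mul (m := t * h) (Q := (k + 1) * Q) hS
    have hS' : (0 : ℝ) < S := by exact_mod_cast hS
    calc ((t : ℝ) / Q) ^ k / k.factorial * (((S + t * h / ((k + 1) * Q) : ℕ) : ℝ) / S)
        = (t / Q : ℝ) ^ k / k.factorial * (1 + ((t * h / ((k + 1) * Q) : ℕ) : ℝ) / S) := by
          rw [Nat.cast_add, add_div, div_self hS'.ne']
      _ ≤ (t / Q : ℝ) ^ k / k.factorial * (1 + ((t * h : ℕ) : ℝ) / S / ((k + 1) * Q : ℕ)) := by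
          gcongr
      _ = _ := by
          rw [Nat.factorial_succ]
          push_cast
          have : (k.factorial : ℝ) ≠ 0 := by positivity
          rw [show (t * h : ℝ) / S / ((k + 1) * Q) = t / Q * (h / S) / (k + 1) by field_simp]
          generalize (t : ℝ) / Q = x
          field_simp
          ring

lemma le_taylorUpper {S t Q : ℕ} (hS : 0 < S) (hQ : 0 < Q) (k h : ℕ) :
    ∑ j ∈ Finset.range k, ((t : ℝ) / Q) ^ j / j.factorial +
        ((t : ℝ) / Q) ^ k / k.factorial * (h / S) ≤ (taylorUpper S t Q k h : ℝ) / S := by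
  induction k generalizing h with
  | zero => simp [taylorUpper]
  | succ k ih =>
    refine le_trans ?_ (ih _)
    rw [Finset.sum_range_succ, add_assoc]
    gcongr
    have h1 := mul_le_natCast_div_add_one (m := t * h) (Q := (k + 1) * Q) (by positivity) hS
    have hS' : (0 : ℝ) < S := by exact_mod_cast hS
    calc _ = (t / Q : ℝ) ^ k / k.factorial * (1 + ((t * h : ℕ) : ℝ) / S / ((k + 1) * Q : ℕ)) := by
          rw [Nat.factorial_succ]
          push_cast
          have : (k.factorial : ℝ) ≠ 0 := by positivity
          rw [show (t * h : ℝ) / S / ((k + 1) * Q) = t / Q * (h / S) / (k + 1) by field_simp]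
          generalize (t : ℝ) / Q = x
          field_simp
          ring
      _ ≤ (t / Q : ℝ) ^ k / k.factorial * (1 + ((t * h / ((k + 1) * Q) + 1 : ℕ) : ℝ) / S) := by
          gcongr
      _ = _ := by
          rw [add_assoc S, Nat.cast_add S, add_div, div_self hS'.ne']

lemma squareLower_le {S : ℕ} (hS : 0 < S) (k h : ℕ) :
    (squareLower S k h : ℝ) / S ≤ ((h : ℝ) / S) ^ 2 ^ k := by
  induction k generalizing h with
  | zero => simp [squareLower]
  | succ k ih =>
    rw [squareLower, forceNat_eq, pow_succ', pow_mul]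
    refine (ih _).trans (pow_le_pow_left₀ (by positivity) ?_ _)
    refine (natCast_div_le_mul hS).trans_eq ?_
    push_cast
    ring

lemma le_squareUpper {S : ℕ} (hS : 0 < S) (k h : ℕ) :
    ((h : ℝ) / S) ^ 2 ^ k ≤ (squareUpper S k h : ℝ) / S := by
  induction k generalizing h with
  | zero => simp [squareUpper]
  | succ k ih =>
    rw [squareUpper, forceNat_eq, pow_succ', pow_mul]
    refine le_trans (pow_le_pow_left₀ (by positivity) ?_ _) (ih _)
    refine le_trans (le_of_eq ?_) (mul_le_natCast_div_add_one hS hS)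
    push_cast
    ring

/-- A lower bound for `exp (a / S)` in fixed point arithmetic with scale `S`. -/
def expLower (S a : ℕ) : ℕ := squareLower S 12 (taylorLower S a (4096 * S) 11 S)

/-- An upper bound for `exp (a / S)` in fixed point arithmetic with scale `S`. -/
def expUpper (S a : ℕ) : ℕ := squareUpper S 12 (taylorUpper S a (4096 * S) 11 (2 * S))

lemma exp_div_pow {S : ℕ} (a : ℕ) :
    Real.exp ((a : ℝ) / (4096 * S : ℕ)) ^ 2 ^ 12 = Real.exp (a / S) := by
  rw [← Real.exp_nat_mul]
  congr 1
  push_cast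
  ring

lemma expLower_le {S : ℕ} (hS : 0 < S) (a : ℕ) : (expLower S a : ℝ) / S ≤ Real.exp (a / S) := by
  have hS' : (S : ℝ) ≠ 0 := by positivity
  refine (squareLower_le hS _ _).trans ?_
  rw [← exp_div_pow]
  refine pow_le_pow_left₀ (by positivity) ((taylorLower_le hS _ _).trans ?_) _
  rw [div_self hS', mul_one, ← Finset.sum_range_succ (fun j => _ / (j.factorial : ℝ))]
  exact Real.sum_le_exp_of_nonneg (by positivity) _

lemma le_expUpper {S a : ℕ} (hS : 0 < S) (ha : a ≤ 4096 * S) :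
    Real.exp (a / S) ≤ (expUpper S a : ℝ) / S := by
  have hS' : (S : ℝ) ≠ 0 := by positivity
  refine le_trans ?_ (le_squareUpper hS _ _)
  rw [← exp_div_pow]
  refine pow_le_pow_left₀ (Real.exp_pos _).le (le_trans ?_ (le_taylorUpper hS (by positivity) _ _)) _
  have h1 : (a : ℝ) / (4096 * S : ℕ) ≤ 1 := by
    rw [div_le_one (by positivity)]
    exact_mod_cast ha
  refine (Real.exp_bound' (by positivity) h1 (n := 11) (by norm_num)).trans ?_
  push_cast
  rw [mul_div_cancel_right₀ _ hS']
  refine add_le_add le_rfl ?_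
  refine (mul_div_mul_comm _ _ _ _).le.trans ?_
  gcongr
  norm_num

lemma sqrt_twelve_mul_pi_sq_mem :
    (34189312546584338219 : ℝ) / 10 ^ 18 ≤ √12 * Real.pi ^ 2 ∧
      √12 * Real.pi ^ 2 ≤ 34189312546584338239 / 10 ^ 18 := by
  have h1 : 3.46410161513775458705 ≤ √12 := Real.le_sqrt_of_sq_le (by norm_num)
  have h2 : √12 ≤ 3.46410161513775458706 := Real.sqrt_le_iff.2 (by norm_num)
  have h3 := Real.pi_gt_d20
  have h4 := Real.pi_lt_d20
  constructor
  · calc _ ≤ (3.46410161513775458705 : ℝ) * 3.14159265358979323846 ^ 2 := by norm_num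
      _ ≤ _ := by gcongr
  · calc _ ≤ (3.46410161513775458706 : ℝ) * 3.14159265358979323847 ^ 2 := by gcongr
      _ ≤ _ := by norm_num

lemma partition_bounds_of_rat {m A B E F L U p : ℝ} (hA : 2 ≤ A) (hAm : A ≤ m) (hmB : m ≤ B)
    (hE : E ≤ Real.exp m) (hF : Real.exp m ≤ F) (hE0 : 0 ≤ E) (hp : 0 ≤ p)
    (hL : L ≤ √12 * Real.pi ^ 2) (hU : √12 * Real.pi ^ 2 ≤ U)
    (h1 : U * F * (B ^ 5 * (B - 1)) < p * 36 * A ^ 8 + U * F)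
    (h2 : p * 36 * B ^ 8 < L * E * (A ^ 5 * (A - 1) + 1)) :
    √12 * Real.pi ^ 2 * Real.exp m / (36 * m ^ 8) * (m ^ 6 - m ^ 5 - 1) < p ∧
      p < √12 * Real.pi ^ 2 * Real.exp m / (36 * m ^ 8) * (m ^ 6 - m ^ 5 + 1) := by
  have hm : 0 < m := by linarith
  have hexp := Real.exp_pos m
  have hK : 0 < √12 * Real.pi ^ 2 := by positivity
  have hA1 : 0 ≤ A - 1 := by linarith
  have hm1 : 0 ≤ m - 1 := by linarith
  have hm2 : 0 ≤ m ^ 5 * (m - 1) - 1 := by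
    have : 1 * 1 ≤ m ^ 5 * (m - 1) :=
      mul_le_mul (one_le_pow₀ (by linarith)) (by linarith) zero_le_one (by positivity)
    linarith
  constructor
  · rw [div_mul_eq_mul_div, div_lt_iff₀ (by positivity)]
    calc _ = √12 * Real.pi ^ 2 * Real.exp m * (m ^ 5 * (m - 1) - 1) := by ring
      _ ≤ U * F * (B ^ 5 * (B - 1) - 1) := by
        have hU0 : 0 ≤ U := hK.le.trans hU
        have hF0 : 0 ≤ F := hexp.le.trans hF
        have hB0 : 0 ≤ B := by linarith
        gcongr
      _ < p * 36 * A ^ 8 := by linarith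
      _ ≤ p * 36 * m ^ 8 := by gcongr
      _ = _ := by ring
  · rw [div_mul_eq_mul_div, lt_div_iff₀ (by positivity)]
    calc p * (36 * m ^ 8) ≤ p * (36 * B ^ 8) := by gcongr
      _ = p * 36 * B ^ 8 := by ring
      _ < _ := h2
      _ ≤ √12 * Real.pi ^ 2 * Real.exp m * (m ^ 5 * (m - 1) + 1) := by gcongr
      _ = _ := by ring

/-- The Newton iteration for the square root of `X`. -/
def newtonSqrt (X : ℕ) : ℕ → ℕ → ℕ
  | 0, g => g
  | k + 1, g => forceNat g fun g => newtonSqrt X k ((g + X / g) / 2)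

/-- The bounds for `p`, given a rational lower bound `a / S` and upper bound `b / S` for `μ`. -/
def checkBounds (S a b p : ℕ) : Bool :=
  Nat.ble (2 * S) a && Nat.ble b (4096 * S) &&
  (forceNat (34189312546584338239 * expUpper S b) fun u =>
    Nat.blt (u * (b ^ 5 * (b - S) * S)) (p * 36 * a ^ 8 * 10 ^ 18 + u * S ^ 7)) &&
  Nat.blt (p * 36 * b ^ 8 * 10 ^ 18)
    (34189312546584338219 * expLower S a * ((a ^ 5 * (a - S) + S ^ 6) * S))

/-- The bounds for `p` in place of `p(n)`, given an approximate square root `g` of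
`(24 * n - 1) * 10 ^ 40`. -/
def checkSqrt (S X g p : ℕ) : Bool :=
  Nat.ble (g * g) X && Nat.ble X ((g + 2) * (g + 2)) &&
  forceNat (314159265358979323846 * g * S / (6 * 10 ^ 40)) fun a =>
  forceNat (314159265358979323847 * (g + 2) * S / (6 * 10 ^ 40) + 1) fun b =>
  checkBounds S a b p

/-- The bounds for `p` in place of `p(n)`. -/
def checkValue (n p : ℕ) : Bool :=
  forceNat p fun p =>
  forceNat ((24 * n - 1) * 10 ^ 40) fun X =>
  forceNat (newtonSqrt X 7 (180 * 10 ^ 20) - 1) fun g =>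
  checkSqrt (2 ^ 100) X g p

lemma partition_bounds_of_checkBounds {S a b p : ℕ} {m : ℝ} (hS : 0 < S) (ha : (a : ℝ) / S ≤ m)
    (hb : m ≤ (b : ℝ) / S) (h : checkBounds S a b p = true) :
    √12 * Real.pi ^ 2 * Real.exp m / (36 * m ^ 8) * (m ^ 6 - m ^ 5 - 1) < p ∧
      p < √12 * Real.pi ^ 2 * Real.exp m / (36 * m ^ 8) * (m ^ 6 - m ^ 5 + 1) := by
  simp only [checkBounds, forceNat_eq, Bool.and_eq_true, Nat.ble_eq, Nat.blt_eq] at h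
  obtain ⟨⟨⟨h1, h2⟩, h3⟩, h4⟩ := h
  have hS' : (0 : ℝ) < S := by exact_mod_cast hS
  have hab : a ≤ b := by
    have := (div_le_div_iff_of_pos_right hS').1 (ha.trans hb)
    exact_mod_cast this
  rify [show S ≤ b by omega, show S ≤ a by omega] at h1 h3 h4
  refine partition_bounds_of_rat (E := expLower S a / S) (F := expUpper S b / S)
    ?_ ha hb ((expLower_le hS a).trans (Real.exp_le_exp.2 ha))
    ((Real.exp_le_exp.2 hb).trans (le_expUpper hS h2)) (by positivity)
    (by positivity) sqrt_twelve_mul_pi_sq_mem.1 sqrt_twelve_mul_pi_sq_mem.2 ?_ ?_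
  · rwa [le_div_iff₀ hS']
  · rw [← sub_pos] at h3 ⊢
    refine (div_pos h3 (by positivity : (0 : ℝ) < S ^ 8 * 10 ^ 18)).trans_eq ?_
    field_simp
  · rw [← sub_pos] at h4 ⊢
    refine (div_pos h4 (by positivity : (0 : ℝ) < S ^ 8 * 10 ^ 18)).trans_eq ?_
    field_simp

lemma partition_bounds_of_checkValue {n p : ℕ} (hn : 0 < n) (h : checkValue n p = true) :
    √12 * Real.pi ^ 2 * Real.exp (muP n) / (36 * muP n ^ 8) * (muP n ^ 6 - muP n ^ 5 - 1) < p ∧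
      p < √12 * Real.pi ^ 2 * Real.exp (muP n) / (36 * muP n ^ 8) *
        (muP n ^ 6 - muP n ^ 5 + 1) := by
  simp only [checkValue, checkSqrt, forceNat_eq, Bool.and_eq_true, Nat.ble_eq] at h
  generalize newtonSqrt ((24 * n - 1) * 10 ^ 40) 7 (180 * 10 ^ 20) - 1 = g at h
  obtain ⟨⟨h1, h2⟩, h3⟩ := h
  have hX : √(((24 * n - 1) * 10 ^ 40 : ℕ) : ℝ) = √(24 * n - 1) * 10 ^ 20 := by
    rw [Nat.cast_mul, Real.sqrt_mul (by positivity), Nat.cast_sub (by omega)]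
    rw [Nat.cast_pow, Nat.cast_mul]
    simp only [Nat.cast_ofNat, Nat.cast_one]
    rw [show (10 : ℝ) ^ 40 = (10 ^ 20) ^ 2 by rw [← pow_mul], Real.sqrt_sq (by positivity)]
  have h4 : (g : ℝ) ≤ √(24 * n - 1) * 10 ^ 20 := by
    rw [← hX]
    exact Real.le_sqrt_of_sq_le (by rw [sq]; exact_mod_cast h1)
  have h5 : √(24 * n - 1) * 10 ^ 20 ≤ (g + 2 : ℕ) := by
    rw [← hX]
    exact Real.sqrt_le_iff.2 ⟨by positivity, by rw [sq]; exact_mod_cast h2⟩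
  have h6 := Real.pi_gt_d20
  have h7 := Real.pi_lt_d20
  have hS : 0 < 2 ^ 100 := by positivity
  generalize 2 ^ 100 = S at *
  have hS' : (0 : ℝ) < S := by exact_mod_cast hS
  refine partition_bounds_of_checkBounds hS ?_ ?_ h3
  · refine (natCast_div_le_mul hS).trans ?_
    push_cast
    calc _ = (3.14159265358979323846 : ℝ) * (g / 10 ^ 20) / 6 := by field_simp; norm_num; ring
      _ ≤ Real.pi * √(24 * n - 1) / 6 := by
        gcongr
        rwa [div_le_iff₀ (by positivity)]
  · refine le_trans ?_ (mul_le_natCast_div_add_one (by norm_num) hS)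
    push_cast at h5 ⊢
    calc Real.pi * √(24 * n - 1) / 6
        ≤ (3.14159265358979323847 : ℝ) * ((g + 2) / 10 ^ 20) / 6 := by
          gcongr
          rwa [le_div_iff₀ (by positivity)]
      _ = _ := by field_simp; norm_num

/-- The check of the bounds for `2 ^ d` consecutive values, the first of which is the value at `n`,
where the values are the base `2 ^ 256` digits of `T`. -/
def checkRange : ℕ → ℕ → ℕ → Bool
  | 0, n, T => checkValue n (T % 2 ^ 256)
  | d + 1, n, T =>
    forceNat T fun T => forceNat n fun n =>
    checkRange d n (T % (2 ^ 256) ^ 2 ^ d) && checkRange d (n + 2 ^ d) (T / (2 ^ 256) ^ 2 ^ d)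

/-- The Newton iteration for the inverse of `Q` modulo `M`. -/
def newtonInverse (Q M : ℕ) : ℕ → ℕ → ℕ
  | 0, x => x
  | k + 1, x => forceNat x fun x => newtonInverse Q M k (x * (2 + (M - x * Q % M)) % M)

/-- The check of the bounds for `391 ≤ n < 2500`. -/
def checkAll : Bool :=
  forceNat ((2 ^ 256) ^ 2501) fun M =>
  forceNat (pentagonalSum (2 ^ 256) 40) fun Q =>
  forceNat (newtonInverse Q M 12 1) fun T =>
  Nat.blt T M && Nat.beq (T * Q % M) 1 &&
    checkRange 11 391 (T / (2 ^ 256) ^ 391) && checkRange 6 2436 (T / (2 ^ 256) ^ 2436)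

set_option maxRecDepth 100000 in
lemma checkAll_eq_true : checkAll = true := by decide +kernel

lemma checkValue_of_checkRange {d n T i : ℕ} (h : checkRange d n T = true) (hi : i < 2 ^ d) :
    checkValue (n + i) (T / (2 ^ 256) ^ i % 2 ^ 256) = true := by
  induction d generalizing n T i with
  | zero =>
    obtain rfl : i = 0 := by simpa using hi
    simpa only [checkRange, pow_zero, Nat.div_one, add_zero] using h
  | succ d ih =>
    simp only [checkRange, forceNat_eq, Bool.and_eq_true] at h
    generalize 2 ^ 256 = B at *
    obtain ⟨h1, h2⟩ := h
    rcases lt_or_ge i (2 ^ d) with hd | hd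
    · have h3 := ih h1 hd
      obtain ⟨j, hj⟩ := Nat.exists_eq_add_of_lt hd
      rwa [hj, show i + j + 1 = i + (j + 1) by ring, pow_add, Nat.mod_mul_right_div_self,
        pow_succ', Nat.mod_mul_right_mod] at h3
    · have h3 := ih h2 (i := i - 2 ^ d) (by rw [pow_succ] at hi; omega)
      rwa [Nat.div_div_eq_div_mul, ← pow_add, add_assoc, Nat.add_sub_cancel' hd] at h3

lemma checkValue_partitionFn {n : ℕ} (h1 : 391 ≤ n) (h2 : n < 2500) :
    checkValue n (partitionFn n) = true := by
  have h := checkAll_eq_true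
  simp only [checkAll, forceNat_eq, Bool.and_eq_true, Nat.blt_eq, Nat.beq_eq] at h
  generalize hB : 2 ^ 256 = B at h
  generalize newtonInverse (pentagonalSum B 40) (B ^ 2501) 12 1 = T at h
  obtain ⟨⟨⟨hT, hT'⟩, h3⟩, h4⟩ := h
  rw [partitionFn_eq_div_mod hB.symm (by omega) hT hT']
  have key {d m : ℕ} (h : checkRange d m (T / B ^ m) = true) (hm : m ≤ n) (hn : n < m + 2 ^ d) :
      checkValue n (T / B ^ n % B) = true := by
    have := checkValue_of_checkRange h (i := n - m) (by omega)
    rwa [hB, Nat.div_div_eq_div_mul, ← pow_add, Nat.add_sub_cancel' hm] at this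
  rcases lt_or_ge n 2436 with hn | hn
  · exact key h3 h1 (by omega)
  · exact key h4 hn (by omega)

theorem partition_bounds_l (n : ℕ) (hn : 391 ≤ n) :
    Real.sqrt 12 * Real.pi ^ 2 * Real.exp (muP n) / (36 * (muP n) ^ 8) *
        ((muP n) ^ 6 - (muP n) ^ 5 - 1) < (partitionFn n : ℝ) ∧
    (partitionFn n : ℝ) <
      Real.sqrt 12 * Real.pi ^ 2 * Real.exp (muP n) / (36 * (muP n) ^ 8) *
        ((muP n) ^ 6 - (muP n) ^ 5 + 1) := by
  rcases lt_or_ge n 2500 with h | h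
  · exact partition_bounds_of_checkValue (by omega) (checkValue_partitionFn hn h)
  · exact partition_bounds_of_large h
end

section
/- There exists a positive integer N such that for all integers n ≥ N, (π²·e^{\bar{μ}(n)}/(8·\bar{μ}(n)^8))·(\bar{μ}(n)^6 − \bar{μ}(n)^5 − 1) < \bar{p}(n) < (π²·e^{\bar{μ}(n)}/(8·\bar{μ}(n)^8))·(\bar{μ}(n)^6 − \bar{μ}(n)^5 + 1). -/
/-- The overpartition function: `Σ_{λ ⊢ n} 2^{d(λ)}` where `d(λ)` is the number of
distinct part sizes of the partition `λ`. -/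
def overpartitionFn (n : ℕ) : ℕ :=
  ∑ μ : Nat.Partition n, 2 ^ μ.parts.toFinset.card

/-- `μ̄(n) = π √n`. -/
noncomputable def muPbar (n : ℕ) : ℝ := Real.pi * Real.sqrt (n : ℝ)

namespace Overpartition
open Filter Topology Finset

section GeneratingFunction

open PowerSeries
open scoped PowerSeries.WithPiTopology

/-- The power series `(1 + X ^ m) / (1 - X ^ m) = 1 + 2 X ^ m + 2 X ^ (2 m) + ⋯`. -/
noncomputable def factor (m : ℕ) : ℕ⟦X⟧ :=
  PowerSeries.mk fun n ↦ if m ∣ n then (if n = 0 then 1 else 2) else 0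

lemma coeff_genFun_two (n : ℕ) :
    (Nat.Partition.genFun fun _ _ ↦ (2 : ℕ)).coeff n = overpartitionFn n := by
  simp [overpartitionFn, Finsupp.prod]

lemma one_add_tsum_eq_factor (i : ℕ) :
    (1 : ℕ⟦X⟧) + ∑' j : ℕ, C 2 * (X : ℕ⟦X⟧) ^ ((i + 1) * (j + 1)) = factor (i + 1) := by
  have hs := Nat.Partition.summable_genFun_term (fun _ _ ↦ (2 : ℕ)) i
  simp only [PowerSeries.smul_eq_C_mul] at hs
  ext n
  rw [map_add, hs.map_tsum _ (WithPiTopology.continuous_coeff _ _)]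
  simp only [factor, coeff_mk, coeff_C_mul, coeff_X_pow, coeff_one]
  by_cases hd : i + 1 ∣ n
  · obtain ⟨k, rfl⟩ := hd
    rcases k with _ | k
    · simp
    · rw [tsum_eq_single k]
      · simp
      · intro b hb
        have : ¬ ((i + 1) * (k + 1) = (i + 1) * (b + 1)) := by
          intro h
          have := Nat.eq_of_mul_eq_mul_left (Nat.succ_pos i) h
          omega
        simp [this]
  · have h0 : n ≠ 0 := by rintro rfl; simp at hd
    have : ∀ b : ℕ, n ≠ (i + 1) * (b + 1) := fun b h ↦ hd ⟨_, h⟩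
    simp [hd, h0, this]

lemma tendsto_coeff_prod_factor (n : ℕ) :
    Tendsto (fun N ↦ (∏ i ∈ range N, factor (i + 1)).coeff n) atTop (𝓝 (overpartitionFn n)) := by
  have h := (Nat.Partition.hasProd_genFun (fun _ _ ↦ (2 : ℕ))).tendsto_prod_nat
  have h2 := ((WithPiTopology.continuous_coeff ℕ n).tendsto _).comp h
  rw [coeff_genFun_two] at h2
  simp only [PowerSeries.smul_eq_C_mul, one_add_tsum_eq_factor] at h2
  exact h2

lemma coeff_prod_factor_mono (n : ℕ) :
    Monotone fun N ↦ (∏ i ∈ range N, factor (i + 1)).coeff n := by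
  refine monotone_nat_of_le_succ fun N ↦ ?_
  rw [prod_range_succ, coeff_mul]
  have := single_le_sum (s := antidiagonal n) (f := fun p : ℕ × ℕ ↦
    (∏ i ∈ range N, factor (i + 1)).coeff p.1 * (factor (N + 1)).coeff p.2)
    (fun _ _ ↦ Nat.zero_le _) (a := (n, 0)) (by simp)
  simpa [factor] using this

lemma coeff_prod_factor_le (n N : ℕ) :
    (∏ i ∈ range N, factor (i + 1)).coeff n ≤ overpartitionFn n :=
  (coeff_prod_factor_mono n).ge_of_tendsto (tendsto_coeff_prod_factor n) N

variable {𝕜 : Type*} [RCLike 𝕜] {q : 𝕜}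

lemma hasSum_factor (hq : ‖q‖ < 1) {m : ℕ} (hm : 0 < m) :
    Summable (fun n ↦ ‖((factor m).coeff n : 𝕜) * q ^ n‖) ∧
      HasSum (fun n ↦ ((factor m).coeff n : 𝕜) * q ^ n) ((1 + q ^ m) / (1 - q ^ m)) := by
  refine ⟨?_, ?_⟩
  · refine Summable.of_nonneg_of_le (fun _ ↦ norm_nonneg _) (fun n ↦ ?_)
      ((summable_geometric_of_lt_one (norm_nonneg q) hq).mul_left 2)
    rw [norm_mul, norm_pow]
    gcongr
    rw [RCLike.norm_natCast]
    norm_cast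
    simp only [factor, coeff_mk]
    split_ifs <;> simp
  · have hqm : ‖q ^ m‖ < 1 := by
      rw [norm_pow]; exact pow_lt_one₀ (norm_nonneg _) hq hm.ne'
    have hne : 1 - q ^ m ≠ 0 := by
      intro h
      rw [sub_eq_zero] at h
      simp [← h] at hqm
    have hinj : Function.Injective fun j : ℕ ↦ m * j := fun a b h ↦ Nat.eq_of_mul_eq_mul_left hm h
    rw [← hinj.hasSum_iff]
    · have h1 := ((hasSum_geometric_of_norm_lt_one hqm).mul_left 2).sub (hasSum_ite_eq 0 (1 : 𝕜))
      convert! h1 using 1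
      · ext j
        rcases j with _ | j
        · simp [factor]; norm_num
        · simp [factor, hm.ne', pow_mul]
      · field_simp; ring
    · intro n hn
      have : ¬ m ∣ n := fun ⟨k, hk⟩ ↦ hn ⟨k, hk.symm⟩
      simp [factor, this]

lemma hasSum_prod_factor (hq : ‖q‖ < 1) (N : ℕ) :
    Summable (fun n ↦ ‖((∏ i ∈ range N, factor (i + 1)).coeff n : 𝕜) * q ^ n‖) ∧
      HasSum (fun n ↦ ((∏ i ∈ range N, factor (i + 1)).coeff n : 𝕜) * q ^ n)
        (∏ i ∈ range N, (1 + q ^ (i + 1)) / (1 - q ^ (i + 1))) := by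
  induction N with
  | zero =>
    have : (fun n ↦ ((∏ i ∈ range 0, factor (i + 1)).coeff n : 𝕜) * q ^ n) =
        fun n ↦ if n = 0 then 1 else 0 := by
      ext n
      simp only [range_zero, prod_empty, coeff_one]
      split_ifs with h <;> simp [h]
    constructor
    · simp only [funext_iff] at this
      simp_rw [this]
      exact summable_of_ne_finset_zero (s := {0}) (by intro b hb; simp_all)
    · rw [this]
      simpa using hasSum_ite_eq 0 (1 : 𝕜)
  | succ N ih =>
    obtain ⟨s1, h1⟩ := ih
    obtain ⟨s2, h2⟩ := hasSum_factor hq (Nat.succ_pos N)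
    have key : (fun n ↦ ((∏ i ∈ range (N + 1), factor (i + 1)).coeff n : 𝕜) * q ^ n) = fun n ↦
        ∑ p ∈ antidiagonal n, (((∏ i ∈ range N, factor (i + 1)).coeff p.1 : 𝕜) * q ^ p.1) *
          (((factor (N + 1)).coeff p.2 : 𝕜) * q ^ p.2) := by
      ext n
      rw [prod_range_succ, coeff_mul, Nat.cast_sum, sum_mul]
      refine sum_congr rfl fun p hp ↦ ?_
      rw [← mem_antidiagonal.mp hp, pow_add]
      push_cast
      ring
    have s3 := summable_norm_sum_mul_antidiagonal_of_summable_norm s1 s2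
    refine ⟨?_, ?_⟩
    · simp only [funext_iff] at key
      simp_rw [key]
      exact s3
    · rw [key, prod_range_succ, ← h1.tsum_eq, ← h2.tsum_eq,
        tsum_mul_tsum_eq_tsum_sum_antidiagonal_of_summable_norm s1 s2]
      exact s3.of_norm.hasSum

end GeneratingFunction

/-- The finite `q`-Pochhammer product `(q; q)_N`. -/
def qPoch (q : ℂ) (N : ℕ) : ℂ := ∏ i ∈ range N, (1 - q ^ (i + 1))

lemma one_sub_pow_ne_zero {q : ℂ} (hq : ‖q‖ < 1) (i : ℕ) : 1 - q ^ (i + 1) ≠ 0 := by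
  intro h
  have : ‖q ^ (i + 1)‖ < 1 := by
    rw [norm_pow]; exact pow_lt_one₀ (norm_nonneg _) hq (by simp)
  rw [sub_eq_zero] at h
  simp [← h] at this

lemma qPoch_ne_zero {q : ℂ} (hq : ‖q‖ < 1) (N : ℕ) : qPoch q N ≠ 0 :=
  prod_ne_zero_iff.mpr fun i _ ↦ one_sub_pow_ne_zero hq i

lemma exists_tendsto_qPoch {q : ℂ} (hq : ‖q‖ < 1) :
    ∃ L : ℂ, L ≠ 0 ∧ Tendsto (qPoch q) atTop (𝓝 L) := by
  have hs : Summable fun i : ℕ ↦ ‖-q ^ (i + 1)‖ := by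
    simpa using (summable_nat_add_iff 1).mpr (summable_geometric_of_lt_one (norm_nonneg _) hq)
  refine ⟨∏' i : ℕ, (1 + -q ^ (i + 1)), tprod_one_add_ne_zero_of_summable
    (fun i ↦ ?_) hs, ?_⟩
  · simpa [sub_eq_add_neg] using one_sub_pow_ne_zero hq i
  · have := (multipliable_one_add_of_summable hs).hasProd.tendsto_prod_nat
    simp only [← sub_eq_add_neg] at this ⊢
    exact this

lemma prod_div_eq_qPoch {q : ℂ} (hq : ‖q‖ < 1) (N : ℕ) :
    ∏ i ∈ range N, (1 + q ^ (i + 1)) / (1 - q ^ (i + 1)) = qPoch (q ^ 2) N / qPoch q N ^ 2 := by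
  rw [qPoch, qPoch, ← prod_pow, ← prod_div_distrib]
  refine prod_congr rfl fun i _ ↦ ?_
  have := one_sub_pow_ne_zero hq i
  field_simp
  ring

lemma exists_tendsto_prod {q : ℂ} (hq : ‖q‖ < 1) :
    ∃ L : ℂ, Tendsto (fun N ↦ ∏ i ∈ range N, (1 + q ^ (i + 1)) / (1 - q ^ (i + 1)))
      atTop (𝓝 L) := by
  have hq2 : ‖q ^ 2‖ < 1 := by
    rw [norm_pow]; exact pow_lt_one₀ (norm_nonneg _) hq (by simp)
  obtain ⟨L, hL, h1⟩ := exists_tendsto_qPoch hq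
  obtain ⟨M, -, h2⟩ := exists_tendsto_qPoch hq2
  refine ⟨M / L ^ 2, ?_⟩
  simp_rw [prod_div_eq_qPoch hq]
  exact h2.div (h1.pow 2) (pow_ne_zero 2 hL)

lemma summable_overpartition {r : ℝ} (h0 : 0 ≤ r) (h1 : r < 1) :
    Summable fun n ↦ (overpartitionFn n : ℝ) * r ^ n := by
  have hr : ‖r‖ < 1 := by rwa [Real.norm_of_nonneg h0]
  obtain ⟨L, hL⟩ := exists_tendsto_prod (q := (r : ℂ)) (by simpa using hr)
  have hL' : Tendsto (fun N ↦ ∏ i ∈ range N, (1 + r ^ (i + 1)) / (1 - r ^ (i + 1)))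
      atTop (𝓝 L.re) := by
    have := (Complex.continuous_re.tendsto L).comp hL
    refine this.congr fun N ↦ ?_
    simp only [Function.comp_apply]
    rw [← Complex.ofReal_re (∏ i ∈ range N, _)]
    push_cast
    rfl
  obtain ⟨B, hB⟩ := hL'.bddAbove_range
  refine summable_of_sum_range_le (c := B) (fun n ↦ by positivity) fun K ↦ ?_
  have ht : Tendsto (fun N ↦ ∑ n ∈ range K,
      (((∏ i ∈ range N, factor (i + 1)).coeff n : ℕ) : ℝ) * r ^ n) atTop
      (𝓝 (∑ n ∈ range K, (overpartitionFn n : ℝ) * r ^ n)) := by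
    refine tendsto_finsetSum _ fun n _ ↦ Tendsto.mul_const _ ?_
    exact (continuous_of_discreteTopology.tendsto _).comp (tendsto_coeff_prod_factor n)
  refine le_of_tendsto' ht fun N ↦ ?_
  refine (sum_le_hasSum _ (fun _ _ ↦ by positivity) (hasSum_prod_factor hr N).2).trans ?_
  exact hB ⟨N, rfl⟩

/-- The generating function of overpartitions. -/
noncomputable def genFunVal (q : ℂ) : ℂ := ∑' n, (overpartitionFn n : ℂ) * q ^ n

lemma summable_norm_overpartition {q : ℂ} (hq : ‖q‖ < 1) :
    Summable fun n ↦ ‖(overpartitionFn n : ℂ) * q ^ n‖ := by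
  simpa using summable_overpartition (norm_nonneg q) hq

lemma tendsto_prod_genFunVal {q : ℂ} (hq : ‖q‖ < 1) :
    Tendsto (fun N ↦ ∏ i ∈ range N, (1 + q ^ (i + 1)) / (1 - q ^ (i + 1)))
      atTop (𝓝 (genFunVal q)) := by
  have h := tendsto_tsum_of_dominated_convergence (𝓕 := atTop)
    (f := fun N n ↦ (((∏ i ∈ range N, factor (i + 1)).coeff n : ℕ) : ℂ) * q ^ n)
    (g := fun n ↦ (overpartitionFn n : ℂ) * q ^ n) (summable_norm_overpartition hq)
    (fun n ↦ Tendsto.mul_const _ ((continuous_of_discreteTopology.tendsto _).comp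
      (tendsto_coeff_prod_factor n)))
    (Eventually.of_forall fun N n ↦ by
      rw [norm_mul, norm_mul]
      gcongr
      simpa using coeff_prod_factor_le n N)
  refine h.congr fun N ↦ (hasSum_prod_factor hq N).2.tsum_eq

/-- `1 / (q; q)_m`, extended by zero to negative `m`. -/
noncomputable def invPoch (q : ℂ) (m : ℤ) : ℂ := if 0 ≤ m then (qPoch q m.toNat)⁻¹ else 0

lemma invPoch_natCast (q : ℂ) (m : ℕ) : invPoch q m = (qPoch q m)⁻¹ := by
  simp [invPoch]

lemma invPoch_sub_one {q : ℂ} (hq : ‖q‖ < 1) (m : ℤ) :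
    invPoch q (m - 1) = (1 - q ^ m) * invPoch q m := by
  rcases lt_trichotomy m 0 with hm | rfl | hm
  · rw [invPoch, invPoch, if_neg (by omega), if_neg (by omega), mul_zero]
  · simp [invPoch]
  · obtain ⟨k, rfl⟩ : ∃ k : ℕ, m = (k + 1 : ℕ) := ⟨(m - 1).toNat, by omega⟩
    rw [show ((k + 1 : ℕ) : ℤ) - 1 = (k : ℕ) by push_cast; ring, invPoch_natCast,
      invPoch_natCast, zpow_natCast]
    have h1 := qPoch_ne_zero hq k
    have h2 := one_sub_pow_ne_zero hq k
    rw [show qPoch q (k + 1) = qPoch q k * (1 - q ^ (k + 1)) by rw [qPoch, prod_range_succ, qPoch]]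
    field_simp

/-- The `k`-th coefficient (with sign) of the finite Jacobi triple product. -/
noncomputable def finTheta (q : ℂ) (n : ℕ) (k : ℤ) : ℂ :=
  (-1) ^ k * q ^ (k ^ 2) * qPoch (q ^ 2) (2 * n) * invPoch (q ^ 2) (n + k) * invPoch (q ^ 2) (n - k)

lemma finTheta_succ {q : ℂ} (h0 : q ≠ 0) (hq : ‖q‖ < 1) (n : ℕ) (k : ℤ) :
    finTheta q (n + 1) k = (1 + q ^ (4 * n + 2)) * finTheta q n k -
      q ^ (2 * n + 1) * (finTheta q n (k - 1) + finTheta q n (k + 1)) := by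
  have hq2 : ‖q ^ 2‖ < 1 := by
    rw [norm_pow]; exact pow_lt_one₀ (norm_nonneg _) hq (by simp)
  have hQ : q ^ 2 ≠ 0 := pow_ne_zero 2 h0
  set U := invPoch (q ^ 2) (n + 1 + k) with hU
  set V := invPoch (q ^ 2) (n + 1 - k) with hV
  set A := q ^ (2 * n : ℤ) * q ^ 2 * q ^ (2 * k) with hA
  set B := q ^ (2 * n : ℤ) * q ^ 2 * (q ^ (2 * k))⁻¹ with hB
  have hqk : q ^ (2 * k) ≠ 0 := zpow_ne_zero _ h0
  have e1 : (q ^ 2) ^ ((n : ℤ) + 1 + k) = A := by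
    rw [hA, ← zpow_natCast, ← zpow_mul, ← zpow_add₀ h0, ← zpow_add₀ h0]
    congr 1; push_cast; ring
  have e2 : (q ^ 2) ^ ((n : ℤ) + 1 - k) = B := by
    rw [hB, ← zpow_natCast, ← zpow_mul, ← zpow_neg, ← zpow_add₀ h0, ← zpow_add₀ h0]
    congr 1; push_cast; ring
  have e3 : (q ^ 2) ^ ((n : ℤ) + k) = A / q ^ 2 := by
    rw [← e1, show (n : ℤ) + 1 + k = (n + k) + 1 by ring, zpow_add_one₀ hQ]
    field_simp
  have e4 : (q ^ 2) ^ ((n : ℤ) - k) = B / q ^ 2 := by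
    rw [← e2, show (n : ℤ) + 1 - k = (n - k) + 1 by ring, zpow_add_one₀ hQ]
    field_simp
  have u1 : invPoch (q ^ 2) (n + k) = (1 - A) * U := by
    rw [← e1, ← invPoch_sub_one hq2]; congr 1; ring
  have v1 : invPoch (q ^ 2) (n - k) = (1 - B) * V := by
    rw [← e2, ← invPoch_sub_one hq2]; congr 1; ring
  have u2 : invPoch (q ^ 2) (n + (k - 1)) = (1 - A / q ^ 2) * ((1 - A) * U) := by
    rw [← u1, ← e3, ← invPoch_sub_one hq2]; congr 1; ring
  have v2 : invPoch (q ^ 2) (n - (k + 1)) = (1 - B / q ^ 2) * ((1 - B) * V) := by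
    rw [← v1, ← e4, ← invPoch_sub_one hq2]; congr 1; ring
  have s1 : (-1 : ℂ) ^ (k - 1) = -(-1) ^ k := by
    rw [zpow_sub_one₀ (by norm_num)]; norm_num
  have s2 : (-1 : ℂ) ^ (k + 1) = -(-1) ^ k := by
    rw [zpow_add_one₀ (by norm_num)]; norm_num
  have t1 : q ^ (2 * n + 1) * q ^ ((k - 1) ^ 2) = q ^ (k ^ 2) * B := by
    rw [hB, ← zpow_natCast, ← zpow_natCast, ← zpow_neg, ← zpow_add₀ h0, ← zpow_add₀ h0,
      ← zpow_add₀ h0, ← zpow_add₀ h0]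
    congr 1; push_cast; ring
  have t2 : q ^ (2 * n + 1) * q ^ ((k + 1) ^ 2) = q ^ (k ^ 2) * A := by
    rw [hA, ← zpow_natCast, ← zpow_natCast, ← zpow_add₀ h0, ← zpow_add₀ h0,
      ← zpow_add₀ h0, ← zpow_add₀ h0]
    congr 1; push_cast; ring
  have t3 : q ^ (4 * n + 2) = A * B / q ^ 2 := by
    rw [hA, hB]
    field_simp
    norm_cast
    ring
  have d1 : qPoch (q ^ 2) (2 * (n + 1)) =
      qPoch (q ^ 2) (2 * n) * (1 - A * B / q ^ 2) * (1 - A * B) := by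
    rw [show 2 * (n + 1) = 2 * n + 1 + 1 by ring, qPoch, prod_range_succ, prod_range_succ,
      ← qPoch, ← t3, show A * B = q ^ 2 * q ^ (4 * n + 2) by rw [t3]; field_simp]
    ring
  have hn : ((n + 1 : ℕ) : ℤ) = n + 1 := by push_cast; ring
  have hu3 : invPoch (q ^ 2) (n + (k + 1)) = U := by rw [hU]; congr 1; ring
  have hv3 : invPoch (q ^ 2) (n - (k - 1)) = V := by rw [hV]; congr 1; ring
  simp only [finTheta, hn, d1, u1, v1, u2, v2, s1, s2, hu3, hv3, t3, ← hU, ← hV]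
  have r1 : q ^ (2 * n + 1) * (-(-1) ^ k * q ^ ((k - 1) ^ 2) * qPoch (q ^ 2) (2 * n) *
      ((1 - A / q ^ 2) * ((1 - A) * U)) * V + -(-1) ^ k * q ^ ((k + 1) ^ 2) *
      qPoch (q ^ 2) (2 * n) * U * ((1 - B / q ^ 2) * ((1 - B) * V))) =
      -(-1) ^ k * (q ^ (k ^ 2) * B) * qPoch (q ^ 2) (2 * n) *
      ((1 - A / q ^ 2) * ((1 - A) * U)) * V + -(-1) ^ k * (q ^ (k ^ 2) * A) *
      qPoch (q ^ 2) (2 * n) * U * ((1 - B / q ^ 2) * ((1 - B) * V)) := by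
    rw [← t1, ← t2]; ring
  rw [r1]
  ring

lemma hasSum_finTheta {q : ℂ} (h0 : q ≠ 0) (hq : ‖q‖ < 1) (n : ℕ) :
    HasSum (finTheta q n) ((∏ j ∈ range n, (1 - q ^ (2 * j + 1))) ^ 2) := by
  induction n with
  | zero =>
    convert! hasSum_ite_eq (0 : ℤ) (1 : ℂ) using 1
    · ext k
      rcases lt_trichotomy k 0 with hk | rfl | hk
      · simp [finTheta, invPoch, hk.not_ge, hk.ne]
      · simp [finTheta, invPoch, qPoch]
      · simp [finTheta, invPoch, hk.not_ge, hk.ne']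
    · simp
  | succ n ih =>
    have h1 := (Equiv.subRight (1 : ℤ)).hasSum_iff.mpr ih
    have h2 := (Equiv.addRight (1 : ℤ)).hasSum_iff.mpr ih
    convert! (ih.mul_left (1 + q ^ (4 * n + 2))).sub ((h1.add h2).mul_left (q ^ (2 * n + 1)))
      using 1
    · ext k
      exact finTheta_succ h0 hq n k
    · rw [prod_range_succ]
      ring

lemma summable_pow_int_sq {r : ℝ} (h0 : 0 ≤ r) (h1 : r < 1) :
    Summable fun k : ℤ ↦ r ^ (k ^ 2).toNat := by
  have hs : Summable fun k : ℕ ↦ r ^ (k ^ 2) :=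
    Summable.of_nonneg_of_le (fun _ ↦ by positivity)
      (fun k ↦ pow_le_pow_of_le_one h0 h1.le (Nat.le_self_pow two_ne_zero k))
      (summable_geometric_of_lt_one h0 h1)
  have e : ∀ k : ℕ, ((k : ℤ) ^ 2).toNat = k ^ 2 := fun k ↦ by
    rw [← Nat.cast_pow, Int.toNat_natCast]
  exact Summable.of_nat_of_neg (by simpa [e] using hs) (by simpa [e] using hs)

lemma zpow_sq_eq (q : ℂ) (k : ℤ) : q ^ (k ^ 2) = q ^ (k ^ 2).toNat := by
  rw [← zpow_natCast, Int.toNat_of_nonneg (sq_nonneg k)]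

lemma tendsto_invPoch {q L : ℂ} (hL : L ≠ 0) (h : Tendsto (qPoch q) atTop (𝓝 L))
    {f : ℕ → ℤ} (hf : Tendsto f atTop atTop) :
    Tendsto (fun n ↦ invPoch q (f n)) atTop (𝓝 L⁻¹) := by
  have h1 : Tendsto (fun n ↦ (f n).toNat) atTop atTop :=
    tendsto_atTop.mpr fun b ↦ (hf.eventually_ge_atTop (b : ℤ)).mono fun n hn ↦ by omega
  refine ((h.comp h1).inv₀ hL).congr' ?_
  filter_upwards [hf.eventually_ge_atTop 0] with n hn
  simp [invPoch, hn]

lemma qPoch_two_mul (q : ℂ) (n : ℕ) :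
    qPoch q (2 * n) = (∏ j ∈ range n, (1 - q ^ (2 * j + 1))) * qPoch (q ^ 2) n := by
  induction n with
  | zero => simp [qPoch]
  | succ n ih =>
    rw [show 2 * (n + 1) = 2 * n + 1 + 1 by ring, qPoch, prod_range_succ, prod_range_succ, ← qPoch,
      ih, prod_range_succ, show qPoch (q ^ 2) (n + 1) = qPoch (q ^ 2) n * (1 - (q ^ 2) ^ (n + 1))
        by rw [qPoch, prod_range_succ, qPoch]]
    ring

/-- Gauss's identity: the overpartition generating function is the reciprocal of
`∑ (-1) ^ k q ^ (k ^ 2)`. -/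
theorem theta_mul_genFunVal {q : ℂ} (h0 : q ≠ 0) (hq : ‖q‖ < 1) :
    (∑' k : ℤ, (-1 : ℂ) ^ k * q ^ (k ^ 2)) * genFunVal q = 1 := by
  have hq2 : ‖q ^ 2‖ < 1 := by
    rw [norm_pow]; exact pow_lt_one₀ (norm_nonneg _) hq (by simp)
  obtain ⟨L, hL, hQ⟩ := exists_tendsto_qPoch hq2
  have h2n : Tendsto (fun n : ℕ ↦ 2 * n) atTop atTop :=
    tendsto_id.const_mul_atTop' two_pos
  obtain ⟨B, hB⟩ := hQ.norm.bddAbove_range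
  obtain ⟨B', hB'⟩ := (hQ.inv₀ hL).norm.bddAbove_range
  have hB0 : 0 ≤ B := (norm_nonneg _).trans (hB ⟨0, rfl⟩)
  have hB0' : 0 ≤ B' := (norm_nonneg _).trans (hB' ⟨0, rfl⟩)
  have hinv : ∀ m, ‖invPoch (q ^ 2) m‖ ≤ B' := fun m ↦ by
    rw [invPoch]
    split_ifs
    · exact hB' ⟨m.toNat, rfl⟩
    · simpa using hB0'
  have hlim : Tendsto (fun n ↦ (∏ j ∈ range n, (1 - q ^ (2 * j + 1))) ^ 2) atTop
      (𝓝 (∑' k : ℤ, (-1 : ℂ) ^ k * q ^ (k ^ 2) * L * L⁻¹ * L⁻¹)) := by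
    refine (tendsto_tsum_of_dominated_convergence
      (bound := fun k : ℤ ↦ ‖q‖ ^ (k ^ 2).toNat * (B * B' * B'))
      ((summable_pow_int_sq (norm_nonneg q) hq).mul_right _)
      (f := fun n k ↦ finTheta q n k) (fun k ↦ ?_) (Eventually.of_forall fun n k ↦ ?_)).congr
      fun n ↦ (hasSum_finTheta h0 hq n).tsum_eq
    · refine ((tendsto_const_nhds.mul (hQ.comp h2n)).mul (tendsto_invPoch hL hQ ?_)).mul
        (tendsto_invPoch hL hQ ?_)
      · exact tendsto_atTop_add_const_right _ _ tendsto_natCast_atTop_atTop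
      · simpa [sub_eq_add_neg] using
          tendsto_atTop_add_const_right _ (-k) tendsto_natCast_atTop_atTop
    · rw [finTheta, zpow_sq_eq]
      simp only [norm_mul, norm_zpow, norm_pow, norm_neg, norm_one, one_zpow, one_mul]
      calc _ = ‖q‖ ^ (k ^ 2).toNat * (‖qPoch (q ^ 2) (2 * n)‖ * ‖invPoch (q ^ 2) (n + k)‖ *
            ‖invPoch (q ^ 2) (n - k)‖) := by ring
        _ ≤ _ := by
          gcongr
          · exact hB ⟨_, rfl⟩
          · exact hinv _
          · exact hinv _
  have hP := (tendsto_prod_genFunVal hq).comp h2n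
  have h3 := (hlim.mul hP).mul (hQ.pow 2)
  have h4 := tendsto_nhds_unique (h3.congr fun n ↦ ?_) (hQ.comp h2n)
  · simp_rw [mul_assoc _ L, mul_inv_cancel₀ hL, mul_one] at h4
    rw [tsum_mul_right] at h4
    field_simp at h4
    exact h4
  · simp only [Function.comp_apply]
    rw [prod_div_eq_qPoch hq]
    have hne := qPoch_ne_zero hq (2 * n)
    field_simp
    rw [qPoch_two_mul q]
    ring

section Modular
open Complex

lemma norm_exp_neg_lt_one {t : ℂ} (ht : 0 < t.re) : ‖cexp (-t)‖ < 1 := by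
  simpa [Complex.norm_exp] using ht

lemma norm_exp_mul_le {z : ℂ} (hz : 1 ≤ z.re) (n : ℕ) :
    ‖cexp (-z * (n * (n + 1)))‖ ≤ Real.exp (-2 * z.re) ^ n := by
  rw [Complex.norm_exp, ← Real.exp_nat_mul]
  gcongr
  have : (-z * ((n : ℂ) * (n + 1))).re = -(z.re * (n * (n + 1))) := by
    have : ((n : ℂ) * (n + 1)) = ((n * (n + 1) : ℝ) : ℂ) := by push_cast; ring
    rw [this, mul_comm, re_ofReal_mul, neg_re]
    ring
  rw [this]
  have h1 : (2 * n : ℝ) ≤ n * (n + 1) := by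
    norm_cast
    rcases n with _ | n
    · simp
    · nlinarith
  nlinarith

/-- The modular transformation of the overpartition generating function. -/
theorem genFunVal_exp_neg_mul {t : ℂ} (ht : 0 < t.re) :
    genFunVal (cexp (-t)) * (2 * ∑' n : ℕ, cexp (-(Real.pi ^ 2 / t) * (n * (n + 1)))) =
      (t / Real.pi) ^ (1 / 2 : ℂ) * cexp (Real.pi ^ 2 / (4 * t)) := by
  have hpi : (Real.pi : ℂ) ≠ 0 := by exact_mod_cast Real.pi_ne_zero
  have ht0 : t ≠ 0 := by rintro rfl; simp at ht
  have ha : 0 < (t / Real.pi).re := by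
    rw [div_ofReal_re]; exact div_pos ht Real.pi_pos
  have ha0 : t / Real.pi ≠ 0 := div_ne_zero ht0 hpi
  have h1 := theta_mul_genFunVal (exp_ne_zero (-t)) (norm_exp_neg_lt_one ht)
  have h2 := Complex.tsum_exp_neg_quadratic ha (-I / 2)
  have e1 : ∀ n : ℤ, cexp (-Real.pi * (t / Real.pi) * n ^ 2 + 2 * Real.pi * (-I / 2) * n) =
      (-1 : ℂ) ^ n * cexp (-t) ^ (n ^ 2) := fun n ↦ by
    have : (-1 : ℂ) ^ n = cexp (n * (-(Real.pi * I))) := by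
      rw [exp_int_mul, exp_neg, exp_pi_mul_I]; norm_num
    rw [this, ← exp_int_mul, ← exp_add]
    congr 1
    push_cast
    field_simp
    ring
  have e2 : ∀ n : ℤ, cexp (-Real.pi / (t / Real.pi) * (n + I * (-I / 2)) ^ 2) =
      cexp (-(Real.pi ^ 2 / (4 * t))) * cexp (-(Real.pi ^ 2 / t) * (n * (n + 1))) := fun n ↦ by
    rw [← exp_add]
    congr 1
    have : I * (-I / 2) = 1 / 2 := by
      rw [← mul_div_assoc, mul_neg, I_mul_I]; norm_num
    rw [this]
    field_simp
    ring
  simp_rw [e1, e2, tsum_mul_left] at h2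
  have hs : Summable fun n : ℤ ↦ cexp (-(Real.pi ^ 2 / t) * (n * (n + 1))) := by
    by_contra hns
    rw [tsum_eq_zero_of_not_summable hns] at h2
    rw [h2] at h1
    simp at h1
  have e3 : ∑' n : ℤ, cexp (-(Real.pi ^ 2 / t) * (n * (n + 1))) =
      2 * ∑' n : ℕ, cexp (-(Real.pi ^ 2 / t) * (n * (n + 1))) := by
    have hs1 : Summable fun n : ℕ ↦ cexp (-(Real.pi ^ 2 / t) * (n * (n + 1))) := by
      refine (hs.comp_injective (i := ((↑) : ℕ → ℤ)) Nat.cast_injective).congr fun n ↦ ?_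
      simp
    have e4 : ∀ n : ℕ, cexp (-(Real.pi ^ 2 / t) * (((-(n + 1) : ℤ) : ℂ) * ((-(n + 1) : ℤ) + 1))) =
        cexp (-(Real.pi ^ 2 / t) * (n * (n + 1))) := fun n ↦ by
      congr 1; push_cast; ring
    rw [tsum_of_nat_of_neg_add_one (by simpa using hs1) (by simpa only [e4] using hs1)]
    simp_rw [e4]
    simp [two_mul]
  rw [e3] at h2
  have hc : (t / Real.pi) ^ (1 / 2 : ℂ) ≠ 0 := by simp [cpow_eq_zero_iff, ht0, hpi]
  rw [h2, exp_neg] at h1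
  generalize (∑' n : ℕ, cexp (-(Real.pi ^ 2 / t) * (n * (n + 1)))) = S at h1 ⊢
  have he := exp_ne_zero (Real.pi ^ 2 / (4 * t))
  generalize cexp (Real.pi ^ 2 / (4 * t)) = E at h1 he ⊢
  field_simp at h1
  linear_combination h1

lemma norm_cpow_half_le_one {t : ℂ} (hn : ‖t‖ ≤ Real.pi) :
    ‖(t / Real.pi) ^ (1 / 2 : ℂ)‖ ≤ 1 := by
  rw [show (1 / 2 : ℂ) = ((1 / 2 : ℝ) : ℂ) by push_cast; ring, norm_cpow_real]
  refine Real.rpow_le_one (norm_nonneg _) ?_ (by norm_num)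
  rw [norm_div, norm_real, Real.norm_of_nonneg Real.pi_pos.le]
  exact (div_le_one Real.pi_pos).mpr hn

lemma norm_genFunVal_sub_le {t : ℂ} (ht : 0 < t.re) (hR : 1 ≤ ((Real.pi : ℂ) ^ 2 / t).re)
    (hn : ‖t‖ ≤ Real.pi) :
    ‖genFunVal (cexp (-t)) -
      1 / 2 * (t / Real.pi) ^ (1 / 2 : ℂ) * cexp (Real.pi ^ 2 / (4 * t))‖ ≤ 3 := by
  set z : ℂ := (Real.pi : ℂ) ^ 2 / t with hz
  set S : ℂ := ∑' n : ℕ, cexp (-z * (n * (n + 1))) with hS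
  have key := genFunVal_exp_neg_mul ht
  rw [← hz, ← hS] at key
  set x := Real.exp (-2 * z.re) with hx
  have hx0 : 0 < x := Real.exp_pos _
  have hx2 : x ≤ 1 / 3 := by
    refine (Real.exp_le_exp.mpr (by linarith : -2 * z.re ≤ -2)).trans ?_
    rw [Real.exp_neg, one_div]
    gcongr
    linarith [Real.add_one_le_exp (2 : ℝ)]
  have hgeo := hasSum_geometric_of_lt_one hx0.le (by linarith : x < 1)
  have hsum : Summable fun n : ℕ ↦ cexp (-z * (n * (n + 1))) :=
    Summable.of_norm_bounded hgeo.summable (norm_exp_mul_le hR)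
  have hS1 : ‖S - 1‖ ≤ 2 * x := by
    have hsplit : S - 1 = ∑' n : ℕ, cexp (-z * ((n + 1 : ℕ) * ((n + 1 : ℕ) + 1))) := by
      rw [hS, hsum.tsum_eq_zero_add]
      simp
    rw [hsplit]
    have hg2 : HasSum (fun n : ℕ ↦ x ^ (n + 1)) (x * (1 - x)⁻¹) := by
      simpa [pow_succ'] using hgeo.mul_left x
    refine (tsum_of_norm_bounded hg2 fun n ↦ norm_exp_mul_le hR (n + 1)).trans ?_
    have : (1 - x)⁻¹ ≤ 2 := by
      rw [inv_le_comm₀ (by linarith) two_pos]; linarith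
    nlinarith
  have hM : ‖cexp (Real.pi ^ 2 / (4 * t))‖ * x ≤ 1 := by
    rw [Complex.norm_exp, hx, ← Real.exp_add, Real.exp_le_one_iff]
    have : ((Real.pi : ℂ) ^ 2 / (4 * t)) = ((1 / 4 : ℝ) : ℂ) * z := by
      rw [hz]; push_cast; rw [mul_comm 4 t, ← div_div]; ring
    rw [this, re_ofReal_mul]
    linarith
  have hSlow : 1 / 3 ≤ ‖S‖ := by
    have h3 : ‖(1 : ℂ)‖ ≤ ‖S‖ + ‖S - 1‖ := by simpa using norm_sub_le S (S - 1)
    rw [norm_one] at h3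
    linarith
  have hSn : S ≠ 0 := by
    rintro h0
    norm_num [h0] at hSlow
  set M : ℂ := (t / Real.pi) ^ (1 / 2 : ℂ) * cexp (Real.pi ^ 2 / (4 * t)) with hMdef
  have hdiff : genFunVal (cexp (-t)) -
      1 / 2 * (t / Real.pi) ^ (1 / 2 : ℂ) * cexp (Real.pi ^ 2 / (4 * t)) =
      -(M * (S - 1) / (2 * S)) := by
    rw [mul_assoc, ← hMdef, ← key]
    field_simp
    ring
  have h5 : ‖M‖ * x ≤ 1 := by
    rw [hMdef, norm_mul, mul_assoc]
    exact mul_le_one₀ (norm_cpow_half_le_one hn) (by positivity) hM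
  have h6 : ‖M‖ * ‖S - 1‖ ≤ ‖M‖ * (2 * x) := by gcongr
  rw [hdiff, norm_neg, norm_div, norm_mul M (S - 1), norm_mul 2 S, Complex.norm_two,
    div_le_iff₀ (by positivity)]
  linarith

lemma norm_genFunVal_ofReal_le {a : ℝ} (h0 : 0 < a) (ha : a ≤ Real.pi) :
    ‖genFunVal (cexp (-a))‖ ≤ 4 * Real.exp (Real.pi ^ 2 / (4 * a)) := by
  have hn : ‖(a : ℂ)‖ ≤ Real.pi := by simpa [abs_of_pos h0] using ha
  have hR : 1 ≤ ((Real.pi : ℂ) ^ 2 / a).re := by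
    have : (Real.pi : ℂ) ^ 2 / a = ((Real.pi ^ 2 / a : ℝ) : ℂ) := by push_cast; rfl
    rw [this, ofReal_re, le_div_iff₀ h0]
    nlinarith [Real.pi_gt_three]
  have h1 := norm_genFunVal_sub_le (t := a) (by simpa using h0) hR hn
  have h2 := norm_cpow_half_le_one hn
  have h3 : ‖cexp (Real.pi ^ 2 / (4 * a))‖ = Real.exp (Real.pi ^ 2 / (4 * a)) := by
    rw [Complex.norm_exp]; norm_cast
  have h4 : 1 ≤ Real.exp (Real.pi ^ 2 / (4 * a)) := Real.one_le_exp (by positivity)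
  have h5 := norm_le_norm_sub_add (genFunVal (cexp (-a)))
    (1 / 2 * (a / Real.pi) ^ (1 / 2 : ℂ) * cexp (Real.pi ^ 2 / (4 * a)))
  rw [norm_mul, norm_mul, h3] at h5
  have h6 : ‖(1 / 2 : ℂ)‖ * ‖((a : ℂ) / Real.pi) ^ (1 / 2 : ℂ)‖ ≤ 1 :=
    mul_le_one₀ (by norm_num) (norm_nonneg _) h2
  nlinarith
end Modular

section MinorArc
open Complex

lemma norm_one_add_div_le {w : ℂ} (hw : ‖w‖ < 1) :
    ‖(1 + w) / (1 - w)‖ ≤ (1 + ‖w‖) / (1 - ‖w‖) * Real.exp (2 * (w.re - ‖w‖)) := by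
  have hlog : ∀ {v : ℂ}, ‖v‖ < 1 →
      HasSum (fun n : ℕ ↦ ((v ^ n - (-v) ^ n) / n).re) (Real.log ‖(1 + v) / (1 - v)‖) := by
    intro v hv
    have hne : 1 - v ≠ 0 := fun h ↦ by
      rw [sub_eq_zero] at h
      simp [← h] at hv
    have hne' : 1 + v ≠ 0 := fun h ↦ by
      rw [← eq_neg_iff_add_eq_zero] at h
      have := congrArg norm h
      rw [norm_neg, norm_one] at this
      linarith
    have h1 := hasSum_re ((hasSum_taylorSeries_neg_log hv).sub
      (hasSum_taylorSeries_neg_log (z := -v) (by simpa using hv)))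
    convert! h1 using 1
    · ext n; rw [sub_div]
    · rw [norm_div, Real.log_div (by simpa using hne') (by simpa using hne)]
      simp [log_re]
      ring
  have hρ : ‖((‖w‖ : ℝ) : ℂ)‖ < 1 := by simpa using hw
  have h1 := hlog hw
  have h2 := hlog hρ
  have hterm : ∀ n : ℕ, ((w ^ n - (-w) ^ n) / n).re ≤
      ((((‖w‖ : ℝ) : ℂ) ^ n - (-((‖w‖ : ℝ) : ℂ)) ^ n) / n).re := by
    intro n
    rcases Nat.even_or_odd n with hn | hn
    · simp [hn.neg_pow]
    · rw [hn.neg_pow, hn.neg_pow, div_natCast_re, div_natCast_re]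
      refine div_le_div_of_nonneg_right ?_ (Nat.cast_nonneg n)
      have : (w ^ n).re ≤ ‖w‖ ^ n := (re_le_norm _).trans (norm_pow w n).le
      have hre : (((‖w‖ : ℝ) : ℂ) ^ n).re = ‖w‖ ^ n := by norm_cast
      rw [sub_neg_eq_add, sub_neg_eq_add, add_re, add_re, hre]
      linarith
  have h3 := le_hasSum (h2.sub h1) 1 (fun n _ ↦ sub_nonneg.mpr (hterm n))
  have hpos : 0 < 1 - ‖w‖ := by linarith
  have e1 : ‖(1 + ((‖w‖ : ℝ) : ℂ)) / (1 - ((‖w‖ : ℝ) : ℂ))‖ = (1 + ‖w‖) / (1 - ‖w‖) := by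
    rw [← ofReal_one, ← ofReal_add, ← ofReal_sub, ← ofReal_div, norm_real,
      Real.norm_of_nonneg (by positivity)]
  rw [e1] at h3
  rcases eq_or_ne ((1 + w) / (1 - w)) 0 with h0 | h0
  · rw [h0, norm_zero]; positivity
  rw [← Real.log_le_log_iff (by positivity) (by positivity),
    Real.log_mul (by positivity) (Real.exp_ne_zero _), Real.log_exp]
  simp at h3
  rw [norm_div]
  linarith

lemma norm_genFunVal_le {q : ℂ} (hq : ‖q‖ < 1) :
    ‖genFunVal q‖ ≤ ‖genFunVal (‖q‖ : ℝ)‖ *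
      Real.exp (2 * ((q / (1 - q)).re - ‖q‖ / (1 - ‖q‖))) := by
  have hr : ‖((‖q‖ : ℝ) : ℂ)‖ < 1 := by simpa using hq
  have h1 := (tendsto_prod_genFunVal hq).norm
  have h2 := (tendsto_prod_genFunVal hr).norm
  have g1 : Tendsto (fun N ↦ ∑ i ∈ range N, (q ^ (i + 1)).re) atTop (𝓝 (q / (1 - q)).re) := by
    have := (hasSum_re ((hasSum_geometric_of_norm_lt_one hq).mul_left q)).tendsto_sum_nat
    simpa only [pow_succ', div_eq_mul_inv] using this
  have g2 : Tendsto (fun N ↦ ∑ i ∈ range N, ‖q‖ ^ (i + 1)) atTop (𝓝 (‖q‖ / (1 - ‖q‖))) := by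
    have := ((hasSum_geometric_of_lt_one (norm_nonneg q) hq).mul_left ‖q‖).tendsto_sum_nat
    simpa only [pow_succ', div_eq_mul_inv] using this
  refine le_of_tendsto_of_tendsto' h1
    (h2.mul ((Real.continuous_exp.tendsto _).comp ((g1.sub g2).const_mul 2))) fun N ↦ ?_
  simp only [Function.comp_apply]
  rw [norm_prod, norm_prod, ← sum_sub_distrib, mul_sum, Real.exp_sum, ← prod_mul_distrib]
  refine prod_le_prod (fun _ _ ↦ norm_nonneg _) fun i _ ↦ ?_
  have hw : ‖q ^ (i + 1)‖ < 1 := by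
    rw [norm_pow]; exact pow_lt_one₀ (norm_nonneg _) hq (by simp)
  have h3 := norm_one_add_div_le hw
  rw [norm_pow] at h3 hw
  have e1 : ‖(1 + ((‖q‖ : ℝ) : ℂ) ^ (i + 1)) / (1 - ((‖q‖ : ℝ) : ℂ) ^ (i + 1))‖ =
      (1 + ‖q‖ ^ (i + 1)) / (1 - ‖q‖ ^ (i + 1)) := by
    have : 0 < 1 - ‖q‖ ^ (i + 1) := by linarith
    rw [← ofReal_one, ← ofReal_pow, ← ofReal_add, ← ofReal_sub, ← ofReal_div, norm_real,
      Real.norm_of_nonneg (by positivity)]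
  rwa [e1]

lemma norm_one_sub_exp_ge {a θ θ₁ : ℝ} (ha : 0 < a) (h1 : 0 ≤ θ₁) (h : θ₁ ≤ |θ|)
    (hπ : |θ| ≤ Real.pi) :
    Real.exp (-a) * √(a ^ 2 + 4 * θ₁ ^ 2 / Real.pi ^ 2) ≤ ‖1 - cexp (-(a + θ * I))‖ := by
  set r := Real.exp (-a) with hr
  have hr0 : 0 < r := Real.exp_pos _
  have hr1 : r ≤ 1 := Real.exp_le_one_iff.mpr (by linarith)
  have hq : cexp (-(a + θ * I)) = r * (Real.cos θ - Real.sin θ * I) := by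
    rw [neg_add, exp_add, hr, ← neg_mul, exp_mul_I]
    simp [sub_eq_add_neg]
  have hsq : ‖1 - cexp (-(a + θ * I))‖ ^ 2 = (1 - r) ^ 2 + 4 * r * Real.sin (θ / 2) ^ 2 := by
    rw [hq, ← normSq_eq_norm_sq, normSq_apply]
    simp [-ofReal_cos, -ofReal_sin, -ofReal_exp]
    have := Real.sin_sq_add_cos_sq θ
    have h2 : Real.cos θ = 1 - 2 * Real.sin (θ / 2) ^ 2 := by
      rw [Real.sin_sq_eq_half_sub, mul_div_cancel₀ θ two_ne_zero]; ring
    have h3 : Real.sin (θ / 2) ^ 2 = (1 - Real.cos θ) / 2 := by rw [h2]; ring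
    rw [h3]
    nlinarith
  have hra : r * a ≤ 1 - r := by
    have h2 : a + 1 ≤ Real.exp a := Real.add_one_le_exp a
    have h3 : r * Real.exp a = 1 := by rw [hr, ← Real.exp_add]; simp
    nlinarith
  have hsin : θ₁ / Real.pi ≤ |Real.sin (θ / 2)| := by
    have h2 := Real.mul_abs_le_abs_sin (x := θ / 2) (by rw [abs_div, abs_two]; linarith)
    rw [abs_div, abs_two] at h2
    refine le_trans ?_ h2
    rw [div_mul_div_comm, mul_comm, mul_div_mul_right _ _ two_ne_zero]
    gcongr
  refine le_of_sq_le_sq ?_ (norm_nonneg _)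
  rw [hsq, mul_pow, Real.sq_sqrt (by positivity), ← sq_abs (Real.sin _)]
  have h4 : (θ₁ / Real.pi) ^ 2 ≤ |Real.sin (θ / 2)| ^ 2 := by gcongr
  have h5 : (r * a) ^ 2 ≤ (1 - r) ^ 2 := by gcongr
  have h6 : r ^ 2 ≤ r := by nlinarith
  rw [mul_add, ← mul_pow, mul_div_assoc, ← div_pow]
  nlinarith [mul_le_mul h6 h4 (by positivity) hr0.le]

/-- Exponential saving away from the dominant singularity. -/
lemma norm_genFunVal_minor_le {a θ : ℝ} (ha : 0 < a) (hπa : a ≤ Real.pi) (h : 3 / 4 * a ≤ |θ|)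
    (hπ : |θ| ≤ Real.pi) :
    ‖genFunVal (cexp (-(a + θ * I)))‖ ≤
      4 * Real.exp (Real.pi ^ 2 / (4 * a) + 2 - 0.18 / a) := by
  have hnq : ‖cexp (-(a + θ * I))‖ = Real.exp (-a) := by simp [Complex.norm_exp]
  have hq : ‖cexp (-(a + θ * I))‖ < 1 := by rw [hnq]; simpa using ha
  have h1 := norm_genFunVal_le hq
  have h2 := norm_genFunVal_ofReal_le ha hπa
  have h3 := norm_one_sub_exp_ge ha (by positivity) h hπ
  rw [hnq] at h1
  have e1 : ((Real.exp (-a) : ℝ) : ℂ) = cexp (-a) := by push_cast; rfl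
  rw [e1] at h1
  set r := Real.exp (-a) with hr
  have hr0 : 0 < r := Real.exp_pos _
  have hr1 : r < 1 := by rw [hr]; simpa using ha
  have hsq : a / 0.91 ≤ √(a ^ 2 + 4 * (3 / 4 * a) ^ 2 / Real.pi ^ 2) := by
    apply Real.le_sqrt_of_sq_le
    have hpi : Real.pi ^ 2 ≤ 10 := by nlinarith [Real.pi_lt_d2, Real.pi_gt_three]
    have : 4 * (3 / 4 * a) ^ 2 / 10 ≤ 4 * (3 / 4 * a) ^ 2 / Real.pi ^ 2 := by gcongr
    have h6 : (a / 0.91) ^ 2 ≤ 1.21 * a ^ 2 := by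
      rw [div_pow, div_le_iff₀ (by norm_num)]
      norm_num
      nlinarith [sq_nonneg a]
    norm_num at h6 ⊢
    nlinarith [sq_nonneg a]
  have h4 : (cexp (-(a + θ * I)) / (1 - cexp (-(a + θ * I)))).re ≤ 0.91 / a := by
    refine (re_le_norm _).trans ?_
    rw [norm_div, hnq]
    calc r / ‖1 - cexp (-(a + θ * I))‖ ≤ r / (r * (a / 0.91)) := by
          gcongr
          exact (mul_le_mul_of_nonneg_left hsq hr0.le).trans h3
      _ = _ := by field_simp
  have h5 : 1 / a - 1 ≤ r / (1 - r) := by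
    have : 1 - a ≤ r := by
      have := Real.add_one_le_exp (-a)
      linarith
    rw [le_div_iff₀ (by linarith), div_sub_one ha.ne', div_mul_eq_mul_div, div_le_iff₀ ha]
    nlinarith
  refine h1.trans ((mul_le_mul h2 (Real.exp_le_exp.mpr (?_ : _ ≤ 2 - 0.18 / a))
    (Real.exp_pos _).le (by positivity)).trans_eq ?_)
  · have : 0.18 / a = 2 * (1 / a - 0.91 / a) := by field_simp; norm_num
    rw [this]
    linarith
  · rw [mul_assoc, ← Real.exp_add]; congr 2; ring

end MinorArc

section CoefficientIntegral
open Complex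

lemma hasSum_genFunVal_mul_exp {a : ℝ} (ha : 0 < a) (n : ℕ) (θ : ℝ) :
    HasSum (fun k : ℕ ↦ (overpartitionFn k : ℂ) * cexp (((n : ℂ) - k) * (a + θ * I)))
      (genFunVal (cexp (-(a + θ * I))) * cexp (n * (a + θ * I))) := by
  have hq : ‖cexp (-(a + θ * I))‖ < 1 := by simpa [Complex.norm_exp] using ha
  have h := ((summable_norm_overpartition hq).of_norm.hasSum).mul_right (cexp (n * (a + θ * I)))
  refine h.congr_fun fun k ↦ ?_
  rw [← exp_nat_mul, mul_assoc, ← exp_add]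
  congr 2
  ring

lemma norm_overpartition_mul_exp (a : ℝ) (n k : ℕ) (θ : ℝ) :
    ‖(overpartitionFn k : ℂ) * cexp (((n : ℂ) - k) * (a + θ * I))‖ =
      ‖(overpartitionFn k : ℂ) * cexp (-a) ^ k‖ * Real.exp (n * a) := by
  rw [norm_mul, norm_mul, mul_assoc, norm_pow, Complex.norm_exp, Complex.norm_exp,
    ← Real.exp_nat_mul, ← Real.exp_add]
  congr 2
  simp
  ring

lemma summable_norm_overpartition_exp {a : ℝ} (ha : 0 < a) :
    Summable fun k : ℕ ↦ ‖(overpartitionFn k : ℂ) * cexp (-a) ^ k‖ :=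
  summable_norm_overpartition (by simpa [Complex.norm_exp] using ha)

lemma continuous_genFunVal_mul_exp {a : ℝ} (ha : 0 < a) (n : ℕ) :
    Continuous fun θ : ℝ ↦ genFunVal (cexp (-(a + θ * I))) * cexp (n * (a + θ * I)) := by
  have h : (fun θ : ℝ ↦ genFunVal (cexp (-(a + θ * I))) * cexp (n * (a + θ * I))) = fun θ : ℝ ↦
      ∑' k : ℕ, (overpartitionFn k : ℂ) * cexp (((n : ℂ) - k) * (a + θ * I)) :=
    funext fun θ ↦ (hasSum_genFunVal_mul_exp ha n θ).tsum_eq.symm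
  rw [h]
  exact continuous_tsum (fun k ↦ by fun_prop)
    ((summable_norm_overpartition_exp ha).mul_right (Real.exp (n * a)))
    fun k θ ↦ (norm_overpartition_mul_exp a n k θ).le

lemma integral_exp_int_mul (m : ℤ) (hm : m ≠ 0) :
    ∫ θ : ℝ in -Real.pi..Real.pi, cexp (m * I * θ) = 0 := by
  have hc : (m : ℂ) * I ≠ 0 := mul_ne_zero (by exact_mod_cast hm) I_ne_zero
  rw [integral_exp_mul_complex hc, div_eq_zero_iff, sub_eq_zero, exp_eq_exp_iff_exists_int]
  exact Or.inl ⟨m, by push_cast; ring⟩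

/-- Cauchy's formula for the coefficients of the generating function. -/
lemma integral_genFunVal_mul_exp {a : ℝ} (ha : 0 < a) (n : ℕ) :
    ∫ θ : ℝ in -Real.pi..Real.pi, genFunVal (cexp (-(a + θ * I))) * cexp (n * (a + θ * I)) =
      2 * Real.pi * overpartitionFn n := by
  have h := intervalIntegral.hasSum_integral_of_dominated_convergence
    (μ := MeasureTheory.volume) (a := -Real.pi) (b := Real.pi)
    (F := fun (k : ℕ) (θ : ℝ) ↦ (overpartitionFn k : ℂ) * cexp (((n : ℂ) - k) * (a + θ * I)))
    (f := fun θ ↦ genFunVal (cexp (-(a + θ * I))) * cexp (n * (a + θ * I)))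
    (fun (k : ℕ) _ ↦ ‖(overpartitionFn k : ℂ) * cexp (-a) ^ k‖ * Real.exp (n * a))
    (fun k ↦ by fun_prop)
    (fun k ↦ .of_forall fun θ _ ↦ (norm_overpartition_mul_exp a n k θ).le)
    (.of_forall fun θ _ ↦ (summable_norm_overpartition_exp ha).mul_right _)
    (by simp)
    (.of_forall fun θ _ ↦ hasSum_genFunVal_mul_exp ha n θ)
  refine h.unique ?_
  refine (hasSum_ite_eq n (2 * Real.pi * overpartitionFn n : ℂ)).congr_fun fun k ↦ ?_
  split_ifs with hk
  · subst hk
    simp [two_mul]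
  · have e : ∀ θ : ℝ, (overpartitionFn k : ℂ) * cexp (((n : ℂ) - k) * (a + θ * I)) =
        (overpartitionFn k * cexp (((n : ℂ) - k) * a)) *
          cexp (((n - k : ℤ) : ℂ) * I * θ) := fun θ ↦ by
      rw [mul_assoc, ← exp_add]
      congr 2
      push_cast
      ring
    simp_rw [e]
    rw [intervalIntegral.integral_const_mul, integral_exp_int_mul _ (by omega), mul_zero]

end CoefficientIntegral

section MainTerm
open MeasureTheory

lemma abs_integral_gaussian_sub_le {b u₀ : ℝ} (hb : 0 < b) (hu : 0 ≤ u₀) :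
    |(∫ u in -u₀..u₀, Real.exp (-(2 * b) * u ^ 2)) - √(Real.pi / (2 * b))| ≤
      Real.exp (-b * u₀ ^ 2) * √(Real.pi / b) := by
  have hi : Integrable fun u : ℝ ↦ Real.exp (-(2 * b) * u ^ 2) :=
    integrable_exp_neg_mul_sq (by positivity)
  have hi' : Integrable fun u : ℝ ↦ Real.exp (-b * u₀ ^ 2) * Real.exp (-b * u ^ 2) :=
    (integrable_exp_neg_mul_sq hb).const_mul _
  rw [← integral_gaussian, ← integral_gaussian b, intervalIntegral.integral_of_le (by linarith),
    ← integral_add_compl (measurableSet_Ioc (a := -u₀) (b := u₀)) hi, sub_add_cancel_left, abs_neg,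
    abs_of_nonneg (integral_nonneg fun u ↦ (Real.exp_pos _).le), ← integral_const_mul]
  refine (setIntegral_mono_on hi.integrableOn hi'.integrableOn measurableSet_Ioc.compl
    fun u hu' ↦ ?_).trans (setIntegral_le_integral hi' (.of_forall fun u ↦ by positivity))
  rw [← Real.exp_add, Real.exp_le_exp]
  have h : u₀ ^ 2 ≤ u ^ 2 := by
    rw [Set.mem_compl_iff, Set.mem_Ioc, not_and_or, not_lt, not_le] at hu'
    rcases hu' with h | h <;> nlinarith
  nlinarith

lemma abs_integral_weighted_gaussian_sub_le {b u₀ : ℝ} (hb : 1 ≤ b) (hu : 0 ≤ u₀)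
    (hu' : u₀ ≤ 1) :
    |(∫ u in -u₀..u₀, (1 - 4 * u ^ 2) * Real.exp (-(2 * b) * u ^ 2)) -
      (1 - 1 / b) * √(Real.pi / (2 * b))| ≤ 4 * Real.exp (-b * u₀ ^ 2) := by
  have hb0 : 0 < b := by linarith
  have hderiv : ∀ u : ℝ, HasDerivAt (fun u ↦ u * Real.exp (-(2 * b) * u ^ 2) / b)
      ((1 / b - 4 * u ^ 2) * Real.exp (-(2 * b) * u ^ 2)) u := by
    intro u
    have h := ((hasDerivAt_id u).mul (((hasDerivAt_pow 2 u).const_mul (-(2 * b))).exp)).div_const b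
    refine h.congr_deriv ?_
    simp
    field_simp
    ring
  have hint := intervalIntegral.integral_eq_sub_of_hasDerivAt (a := -u₀) (b := u₀)
    (fun u _ ↦ hderiv u) (Continuous.intervalIntegrable (by fun_prop) _ _)
  have hsplit : (∫ u in -u₀..u₀, (1 - 4 * u ^ 2) * Real.exp (-(2 * b) * u ^ 2)) =
      (1 - 1 / b) * (∫ u in -u₀..u₀, Real.exp (-(2 * b) * u ^ 2)) +
        2 * u₀ * Real.exp (-(2 * b) * u₀ ^ 2) / b := by
    rw [← intervalIntegral.integral_const_mul]
    trans (∫ u in -u₀..u₀, (1 - 1 / b) * Real.exp (-(2 * b) * u ^ 2)) +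
      ∫ u in -u₀..u₀, (1 / b - 4 * u ^ 2) * Real.exp (-(2 * b) * u ^ 2)
    · rw [← intervalIntegral.integral_add (Continuous.intervalIntegrable (by fun_prop) _ _)
        (Continuous.intervalIntegrable (by fun_prop) _ _)]
      congr 1
      ext u
      ring
    · rw [hint]
      ring_nf
  have hg := abs_integral_gaussian_sub_le hb0 hu
  have h1 : |1 - 1 / b| ≤ 1 := by
    have h2 : 0 < 1 / b := by positivity
    have h3 : 1 / b ≤ 1 := by rw [div_le_one hb0]; exact hb
    rw [abs_le]; constructor <;> linarith
  have h2 : √(Real.pi / b) ≤ 2 := by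
    rw [Real.sqrt_le_left two_pos.le, div_le_iff₀ hb0]
    linarith [Real.pi_lt_four]
  have h3 : 2 * u₀ * Real.exp (-(2 * b) * u₀ ^ 2) / b ≤ 2 * Real.exp (-b * u₀ ^ 2) := by
    rw [div_le_iff₀ hb0]
    have h4 : Real.exp (-(2 * b) * u₀ ^ 2) ≤ Real.exp (-b * u₀ ^ 2) :=
      Real.exp_le_exp.mpr (by nlinarith [sq_nonneg u₀])
    have h5 : u₀ * Real.exp (-(2 * b) * u₀ ^ 2) ≤ 1 * Real.exp (-b * u₀ ^ 2) := by gcongr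
    nlinarith [Real.exp_pos (-b * u₀ ^ 2)]
  rw [hsplit, add_sub_right_comm, ← mul_sub]
  refine (abs_add_le _ _).trans ?_
  rw [abs_mul, abs_of_nonneg (by positivity : 0 ≤ 2 * u₀ * Real.exp (-(2 * b) * u₀ ^ 2) / b)]
  have h6 := mul_le_mul h1 hg (abs_nonneg _) zero_le_one
  nlinarith [Real.exp_pos (-b * u₀ ^ 2)]

lemma integral_cos_mul_exp_cos (b φ₀ : ℝ) :
    ∫ φ in -φ₀..φ₀, Real.cos (3 * φ / 2) * Real.exp (b * Real.cos φ) =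
      2 * Real.exp b * ∫ u in -Real.sin (φ₀ / 2)..Real.sin (φ₀ / 2),
        (1 - 4 * u ^ 2) * Real.exp (-(2 * b) * u ^ 2) := by
  have hd : ∀ φ : ℝ, HasDerivAt (fun φ ↦ Real.sin (φ / 2)) (Real.cos (φ / 2) * (1 / 2)) φ :=
    fun φ ↦ ((hasDerivAt_id φ).div_const 2).sin
  have h := intervalIntegral.integral_comp_mul_deriv (a := -φ₀) (b := φ₀)
    (f := fun φ ↦ Real.sin (φ / 2)) (f' := fun φ ↦ Real.cos (φ / 2) * (1 / 2))
    (g := fun u ↦ (1 - 4 * u ^ 2) * Real.exp (-(2 * b) * u ^ 2))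
    (fun φ _ ↦ hd φ) (by fun_prop) (by fun_prop)
  rw [neg_div, Real.sin_neg] at h
  rw [← h, ← intervalIntegral.integral_const_mul]
  congr 1
  ext φ
  simp only [Function.comp_apply]
  obtain ⟨x, rfl⟩ : ∃ x, φ = 2 * x := ⟨φ / 2, by ring⟩
  have h1 : 3 * (2 * x) / 2 = 3 * x := by ring
  have h2 : 2 * x / 2 = x := by ring
  have h3 : b * Real.cos (2 * x) = b + -(2 * b) * Real.sin x ^ 2 := by
    rw [Real.cos_two_mul, Real.cos_sq']; ring
  rw [h1, h2, h3, Real.exp_add, Real.cos_three_mul]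
  have h4 : Real.cos x ^ 3 = Real.cos x * (1 - Real.sin x ^ 2) := by
    rw [pow_succ', Real.cos_sq']
  rw [h4]
  ring

end MainTerm

section Contour
open Complex

/-- The dominant part of the generating function at `exp (-t)` as `t → 0`. -/
noncomputable def mainPart (t : ℂ) : ℂ :=
  1 / 2 * (t / Real.pi) ^ (1 / 2 : ℂ) * cexp (Real.pi ^ 2 / (4 * t))

lemma differentiableOn_mainPart_mul_exp (c : ℂ) :
    DifferentiableOn ℂ (fun t ↦ mainPart t * cexp (c * t)) {t | 0 < t.re} := by
  intro t ht
  have h0 : t ≠ 0 := by rintro rfl; simp at ht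
  have hs : t / Real.pi ∈ slitPlane := by
    left
    rw [div_ofReal_re]
    exact div_pos ht Real.pi_pos
  unfold mainPart
  refine DifferentiableAt.differentiableWithinAt ?_
  refine DifferentiableAt.mul (DifferentiableAt.mul (DifferentiableAt.const_mul ?_ _) ?_)
    (by fun_prop)
  · exact DifferentiableAt.cpow (by fun_prop) (by fun_prop) hs
  · refine DifferentiableAt.cexp (DifferentiableAt.div (by fun_prop) (by fun_prop) ?_)
    exact mul_ne_zero (by norm_num) h0

/-- Replacing a vertical chord of a circle centred at the origin by the corresponding arc. -/
lemma integral_chord_eq_integral_arc {f : ℂ → ℂ} {r φ₀ : ℝ} (hr : 0 < r) (h0 : 0 ≤ φ₀)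
    (hφ : φ₀ < Real.pi / 3) (hf : DifferentiableOn ℂ f (Metric.ball r r)) :
    ∫ θ in -(r * Real.sin φ₀)..r * Real.sin φ₀, f ((r * Real.cos φ₀ : ℝ) + θ * I) =
      ∫ φ in -φ₀..φ₀, f (r * cexp (φ * I)) * (r * cexp (φ * I)) := by
  obtain ⟨g, hg⟩ := hf.isExactOn_ball
  have hcos : ∀ {φ}, |φ| ≤ φ₀ → 1 / 2 < Real.cos φ := by
    intro φ h
    rw [← Real.cos_pi_div_three, ← Real.cos_abs φ]
    exact Real.cos_lt_cos_of_nonneg_of_le_pi (abs_nonneg _) (by linarith [Real.pi_pos])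
      (h.trans_lt hφ)
  have hsin : 0 ≤ Real.sin φ₀ := Real.sin_nonneg_of_nonneg_of_le_pi h0 (by linarith [Real.pi_pos])
  have hmem : ∀ x y : ℝ, (x - r) ^ 2 + y ^ 2 < r ^ 2 → (x + y * I : ℂ) ∈ Metric.ball (r : ℂ) r := by
    intro x y h
    rw [mem_ball_iff_norm, ← sq_lt_sq₀ (norm_nonneg _) hr.le, ← normSq_eq_norm_sq, normSq_apply]
    simpa [← sq] using h
  have hc0 := hcos (abs_of_nonneg h0).le
  have hchord : ∀ θ ∈ Set.uIcc (-(r * Real.sin φ₀)) (r * Real.sin φ₀),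
      ((r * Real.cos φ₀ : ℝ) + θ * I : ℂ) ∈ Metric.ball (r : ℂ) r := by
    intro θ hθ
    rw [Set.uIcc_of_le (by nlinarith), Set.mem_Icc, ← abs_le] at hθ
    apply hmem
    have h1 : θ ^ 2 ≤ (r * Real.sin φ₀) ^ 2 := sq_le_sq.mpr (hθ.trans (le_abs_self _))
    have h2 := Real.sin_sq_add_cos_sq φ₀
    have h3 : 0 < r ^ 2 := by positivity
    nlinarith
  have hpolar : ∀ φ : ℝ, (r : ℂ) * cexp (φ * I) =
      (r * Real.cos φ : ℝ) + (r * Real.sin φ : ℝ) * I := by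
    intro φ; rw [exp_mul_I]; push_cast; ring
  have harc : ∀ φ ∈ Set.uIcc (-φ₀) φ₀, (r : ℂ) * cexp (φ * I) ∈ Metric.ball (r : ℂ) r := by
    intro φ hφ'
    rw [Set.uIcc_of_le (by linarith), Set.mem_Icc, ← abs_le] at hφ'
    rw [hpolar]
    apply hmem
    have h1 := hcos hφ'
    have h2 := Real.sin_sq_add_cos_sq φ
    have h3 : 0 < r ^ 2 := by positivity
    nlinarith
  have d1 : ∀ θ : ℝ, HasDerivAt (fun θ : ℝ ↦ ((r * Real.cos φ₀ : ℝ) + θ * I : ℂ)) I θ := by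
    intro θ
    simpa using ((hasDerivAt_id θ).ofReal_comp.mul_const I).const_add ((r * Real.cos φ₀ : ℝ) : ℂ)
  have d2 : ∀ φ : ℝ, HasDerivAt (fun φ : ℝ ↦ (r * cexp (φ * I) : ℂ)) (r * cexp (φ * I) * I) φ := by
    intro φ
    simpa [mul_assoc] using
      (((hasDerivAt_id φ).ofReal_comp.mul_const I).cexp).const_mul (r : ℂ)
  have i1 := intervalIntegral.integral_eq_sub_of_hasDerivAt
    (fun θ hθ ↦ (hg _ (hchord θ hθ)).scomp θ (d1 θ))
    (ContinuousOn.intervalIntegrable (continuousOn_const.smul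
      (hf.continuousOn.comp (by fun_prop) hchord)))
  have i2 := intervalIntegral.integral_eq_sub_of_hasDerivAt
    (fun φ hφ ↦ (hg _ (harc φ hφ)).scomp φ (d2 φ))
    (ContinuousOn.intervalIntegrable (ContinuousOn.smul (by fun_prop)
      (hf.continuousOn.comp (by fun_prop) harc)))
  have e1 : ∀ s : ℝ, s = φ₀ ∨ s = -φ₀ → (r : ℂ) * cexp (s * I) =
      (r * Real.cos φ₀ : ℝ) + (r * Real.sin s : ℝ) * I := by
    rintro s (rfl | rfl)
    · exact hpolar _
    · rw [hpolar, Real.cos_neg]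
  have e2 := e1 φ₀ (.inl rfl)
  have e3 := e1 (-φ₀) (.inr rfl)
  rw [Real.sin_neg, mul_neg] at e3
  simp only [Function.comp_apply, smul_eq_mul] at i1 i2
  rw [e2, e3, ← i1] at i2
  apply mul_left_cancel₀ I_ne_zero
  rw [← intervalIntegral.integral_const_mul, ← intervalIntegral.integral_const_mul, ← i2]
  congr 1
  ext φ
  ring

end Contour

section Asymptotics
open Complex

lemma mainPart_mul_exp_polar {b φ : ℝ} (hb : 0 < b) (hφ : |φ| < Real.pi) {r : ℝ}
    (hr : r = Real.pi ^ 2 / (2 * b)) :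
    mainPart (r * cexp (φ * I)) * cexp ((b ^ 2 / Real.pi ^ 2 : ℝ) * (r * cexp (φ * I))) *
        (r * cexp (φ * I)) =
      (r / 2 * √(Real.pi / (2 * b)) : ℝ) *
        (cexp ((3 * φ / 2 : ℝ) * I) * (Real.exp (b * Real.cos φ) : ℝ)) := by
  have hpi := Real.pi_pos
  have hπ : (Real.pi : ℂ) ≠ 0 := by exact_mod_cast hpi.ne'
  have hb' : (b : ℂ) ≠ 0 := by exact_mod_cast hb.ne'
  rw [abs_lt] at hφ
  have hpow : (r * cexp (φ * I) / Real.pi) ^ (1 / 2 : ℂ) =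
      (√(Real.pi / (2 * b)) : ℝ) * cexp (φ / 2 * I) := by
    have e1 : r * cexp (φ * I) / Real.pi = ((Real.pi / (2 * b) : ℝ) : ℂ) * cexp (φ * I) := by
      rw [hr]; push_cast; field_simp
    have hpos : 0 < Real.pi / (2 * b) := by positivity
    rw [e1, cpow_def_of_ne_zero (mul_ne_zero (by exact_mod_cast hpos.ne') (exp_ne_zero _)),
      log_ofReal_mul hpos (exp_ne_zero _), log_exp (by simpa using hφ.1) (by simpa using hφ.2.le),
      Real.sqrt_eq_rpow, Real.rpow_def_of_pos hpos, ofReal_exp, ← exp_add]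
    congr 1
    push_cast
    ring
  have hexp : cexp (Real.pi ^ 2 / (4 * (r * cexp (φ * I)))) *
      cexp ((b ^ 2 / Real.pi ^ 2 : ℝ) * (r * cexp (φ * I))) = cexp (b * Real.cos φ) := by
    rw [← exp_add]
    congr 1
    have : Real.pi ^ 2 / (4 * (r * cexp (φ * I))) = b / 2 * cexp (-φ * I) := by
      rw [neg_mul, exp_neg, hr]; push_cast; field_simp; ring
    rw [this, ofReal_cos, Complex.cos, hr]
    push_cast
    field_simp
    ring
  unfold mainPart
  rw [hpow]
  calc _ = r / 2 * (√(Real.pi / (2 * b)) : ℝ) * (cexp (φ / 2 * I) * cexp (φ * I)) *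
      (cexp (Real.pi ^ 2 / (4 * (r * cexp (φ * I)))) *
      cexp ((b ^ 2 / Real.pi ^ 2 : ℝ) * (r * cexp (φ * I)))) := by ring
    _ = _ := by
      rw [hexp, ← exp_add]
      push_cast
      ring_nf

lemma exists_angle : ∃ φ₀ : ℝ, 0 ≤ φ₀ ∧ φ₀ < Real.pi / 3 ∧ Real.sin φ₀ = 3 / 5 ∧
    Real.cos φ₀ = 4 / 5 ∧ Real.sin (φ₀ / 2) ^ 2 = 1 / 10 := by
  have hcos : Real.cos (Real.arcsin (3 / 5)) = 4 / 5 := by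
    rw [Real.cos_arcsin, Real.sqrt_eq_iff_eq_sq] <;> norm_num
  refine ⟨Real.arcsin (3 / 5), Real.arcsin_nonneg.mpr (by norm_num), ?_,
    Real.sin_arcsin (by norm_num) (by norm_num), hcos, ?_⟩
  · rw [Real.arcsin_lt_iff_lt_sin' ⟨by linarith [Real.pi_pos], by linarith [Real.pi_pos]⟩,
      Real.sin_pi_div_three, lt_div_iff₀ two_pos, Real.lt_sqrt (by norm_num)]
    norm_num
  · rw [Real.sin_sq_eq_half_sub, mul_div_cancel₀ _ two_ne_zero, hcos]
    norm_num

lemma abs_re_integral_mainPart_sub_le {b r : ℝ} (hb : 5 ≤ b) (hr : r = Real.pi ^ 2 / (2 * b)) :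
    |(∫ θ in -(3 / 5 * r)..3 / 5 * r, mainPart ((4 / 5 * r : ℝ) + θ * I) *
        cexp ((b ^ 2 / Real.pi ^ 2 : ℝ) * ((4 / 5 * r : ℝ) + θ * I))).re -
      2 * Real.pi * (Real.pi ^ 2 * Real.exp b / (8 * b ^ 2) * (1 - 1 / b))| ≤
      4 * Real.exp (0.9 * b) := by
  obtain ⟨φ₀, h0, hlt, hsin, hcos, hhalf⟩ := exists_angle
  have hpi := Real.pi_pos
  have hb0 : 0 < b := by linarith
  have hr0 : 0 < r := by rw [hr]; positivity
  have hr1 : r ≤ 1 := by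
    rw [hr, div_le_one (by positivity)]
    nlinarith [Real.pi_lt_d2, Real.pi_gt_three]
  have hdiff : DifferentiableOn ℂ
      (fun t ↦ mainPart t * cexp ((b ^ 2 / Real.pi ^ 2 : ℝ) * t)) (Metric.ball r r) := by
    refine (differentiableOn_mainPart_mul_exp _).mono fun t ht ↦ ?_
    rw [mem_ball_iff_norm] at ht
    have := (neg_le_abs _).trans (abs_re_le_norm (t - r))
    simp at this
    simp only [Set.mem_ofPred_eq]
    linarith
  have hkey := integral_chord_eq_integral_arc hr0 h0 hlt hdiff
  rw [hsin, hcos, mul_comm r, mul_comm r] at hkey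
  set K := r / 2 * √(Real.pi / (2 * b)) with hK
  have harc : ∫ φ in -φ₀..φ₀, mainPart (r * cexp (φ * I)) *
      cexp ((b ^ 2 / Real.pi ^ 2 : ℝ) * (r * cexp (φ * I))) * (r * cexp (φ * I)) =
      ∫ φ in -φ₀..φ₀, (K : ℂ) *
        (cexp ((3 * φ / 2 : ℝ) * I) * (Real.exp (b * Real.cos φ) : ℝ)) := by
    refine intervalIntegral.integral_congr fun φ hφ ↦ ?_
    rw [Set.uIcc_of_le (by linarith), Set.mem_Icc, ← abs_le] at hφ
    exact mainPart_mul_exp_polar hb0 (by linarith) hr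
  have hre : (∫ φ in -φ₀..φ₀, (K : ℂ) *
        (cexp ((3 * φ / 2 : ℝ) * I) * (Real.exp (b * Real.cos φ) : ℝ))).re =
      K * ∫ φ in -φ₀..φ₀, Real.cos (3 * φ / 2) * Real.exp (b * Real.cos φ) := by
    rw [intervalIntegral.integral_const_mul, re_ofReal_mul]
    congr 1
    have := reCLM.intervalIntegral_comp_comm (μ := MeasureTheory.volume) (a := -φ₀) (b := φ₀)
      (f := fun φ : ℝ ↦ cexp ((3 * φ / 2 : ℝ) * I) * (Real.exp (b * Real.cos φ) : ℝ))
      (Continuous.intervalIntegrable (by fun_prop) _ _)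
    rw [reCLM_apply] at this
    rw [← this]
    congr 1
    ext φ
    rw [reCLM_apply, re_mul_ofReal, exp_ofReal_mul_I_re]
  rw [hkey, harc, hre, integral_cos_mul_exp_cos]
  set u₀ := Real.sin (φ₀ / 2) with hu
  have hu0 : 0 ≤ u₀ := Real.sin_nonneg_of_nonneg_of_le_pi (by linarith) (by linarith)
  have hG := abs_integral_weighted_gaussian_sub_le (b := b) (by linarith) hu0
    (Real.sin_le_one _)
  rw [hhalf] at hG
  set W := ∫ u in -u₀..u₀, (1 - 4 * u ^ 2) * Real.exp (-(2 * b) * u ^ 2)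
  have hsq : √(Real.pi / (2 * b)) * √(Real.pi / (2 * b)) = Real.pi / (2 * b) :=
    Real.mul_self_sqrt (by positivity)
  have hsq1 : √(Real.pi / (2 * b)) ≤ 1 := by
    rw [Real.sqrt_le_left zero_le_one, one_pow, div_le_one (by positivity)]
    linarith [Real.pi_lt_four]
  have e : K * (2 * Real.exp b * W) -
      2 * Real.pi * (Real.pi ^ 2 * Real.exp b / (8 * b ^ 2) * (1 - 1 / b)) =
      2 * K * Real.exp b * (W - (1 - 1 / b) * √(Real.pi / (2 * b))) := by
    have : 2 * K * Real.exp b * ((1 - 1 / b) * √(Real.pi / (2 * b))) =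
        r * (√(Real.pi / (2 * b)) * √(Real.pi / (2 * b))) * Real.exp b * (1 - 1 / b) := by
      rw [hK]; ring
    rw [mul_sub (2 * K * Real.exp b), this, hsq, hr]
    field_simp
    ring
  rw [e, abs_mul, abs_of_nonneg (by positivity)]
  have hK1 : 2 * K ≤ 1 := by
    rw [hK]
    nlinarith [Real.sqrt_nonneg (Real.pi / (2 * b))]
  calc 2 * K * Real.exp b * |W - (1 - 1 / b) * √(Real.pi / (2 * b))|
      ≤ 1 * Real.exp b * (4 * Real.exp (-b * (1 / 10))) := by gcongr
    _ = 4 * (Real.exp b * Real.exp (-b * (1 / 10))) := by ring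
    _ = _ := by rw [← Real.exp_add]; congr 2; ring

lemma abs_overpartition_sub_le {n : ℕ} {b : ℝ} (hb : 8 ≤ b) (hn : b ^ 2 = Real.pi ^ 2 * n) :
    |(overpartitionFn n : ℝ) - Real.pi ^ 2 * Real.exp b / (8 * b ^ 2) * (1 - 1 / b)| ≤
      50 * Real.exp (0.98 * b) := by
  have hpi := Real.pi_gt_three
  have hpi2 : Real.pi ^ 2 ≤ 10 := by nlinarith [Real.pi_lt_d2]
  have hb0 : 0 < b := by linarith
  obtain ⟨r, hr⟩ : ∃ r, r = Real.pi ^ 2 / (2 * b) := ⟨_, rfl⟩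
  have hr0 : 0 < r := by rw [hr]; positivity
  have hr1 : r ≤ 1 := by
    rw [hr, div_le_one (by positivity)]
    linarith
  have hnr : (n : ℝ) * r = b / 2 := by
    rw [hr]; field_simp; linarith
  have hnb : b ^ 2 / Real.pi ^ 2 = n := by rw [hn]; field_simp
  have hmain := abs_re_integral_mainPart_sub_le (by linarith) hr
  rw [hnb, ofReal_natCast] at hmain
  set a := 4 / 5 * r with ha
  set s := 3 / 5 * r with hs
  have ha0 : 0 < a := by positivity
  set F : ℝ → ℂ := fun θ ↦ genFunVal (cexp (-(a + θ * I))) * cexp (n * (a + θ * I)) with hF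
  set H : ℝ → ℂ := fun θ ↦ mainPart (a + θ * I) * cexp (n * (a + θ * I)) with hH
  change |(∫ θ in -s..s, H θ).re - _| ≤ _ at hmain
  have hFc : Continuous F := continuous_genFunVal_mul_exp ha0 n
  have hHc : Continuous H := by
    refine ContinuousOn.comp_continuous (differentiableOn_mainPart_mul_exp n).continuousOn
      (by fun_prop : Continuous fun θ : ℝ ↦ (a + θ * I : ℂ)) fun θ ↦ ?_
    simpa using ha0
  have hnorm : ∀ θ : ℝ, ‖cexp (n * (a + θ * I))‖ = Real.exp (n * a) := by
    intro θ; simp [Complex.norm_exp]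
  have hna : (n : ℝ) * a = 0.4 * b := by
    rw [ha]; linarith
  have hmajor : ‖∫ θ in -s..s, (F θ - H θ)‖ ≤ 3 * Real.exp (0.98 * b) * |s - -s| := by
    refine intervalIntegral.norm_integral_le_of_norm_le_const fun θ hθ ↦ ?_
    rw [Set.uIoc_of_le (by linarith), Set.mem_Ioc] at hθ
    have hθ2 : θ ^ 2 ≤ s ^ 2 := by nlinarith
    have hnsq : normSq (a + θ * I) = a ^ 2 + θ ^ 2 := by simp [normSq_apply, sq]
    have h1 : normSq (a + θ * I) ≤ r ^ 2 := by rw [hnsq]; nlinarith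
    have h2 : ‖(a + θ * I : ℂ)‖ ≤ Real.pi := by
      refine le_of_sq_le_sq ?_ Real.pi_pos.le
      rw [← normSq_eq_norm_sq]
      nlinarith
    have h3 : 1 ≤ ((Real.pi : ℂ) ^ 2 / (a + θ * I)).re := by
      have : ((Real.pi : ℂ) ^ 2 / (a + θ * I)).re = Real.pi ^ 2 * a / normSq (a + θ * I) := by
        rw [← ofReal_pow, div_eq_mul_inv, re_ofReal_mul, inv_re]
        simp [mul_div_assoc]
      rw [this, le_div_iff₀ (by rw [hnsq]; positivity)]
      have h4 : 9 * a ≤ Real.pi ^ 2 * a := by gcongr; nlinarith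
      nlinarith
    have h4 := norm_genFunVal_sub_le (t := a + θ * I) (by simpa using ha0) h3 h2
    rw [hF, hH]
    simp only
    rw [← sub_mul, norm_mul, hnorm, hna]
    exact mul_le_mul h4 (Real.exp_le_exp.mpr (by linarith)) (Real.exp_pos _).le (by norm_num)
  have hminor : ∀ θ : ℝ, s ≤ |θ| → |θ| ≤ Real.pi → ‖F θ‖ ≤ 36 * Real.exp (0.98 * b) := by
    intro θ h1 h2
    have h3 := norm_genFunVal_minor_le ha0 (by linarith) (by linarith) h2
    rw [hF]
    simp only
    rw [norm_mul, hnorm]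
    have h4 : Real.pi ^ 2 / (4 * a) = 0.625 * b := by
      rw [ha, hr]; field_simp; norm_num
    have h5 : 0.045 * b ≤ 0.18 / a := by
      rw [le_div_iff₀ ha0]
      have : a * b = 2 / 5 * Real.pi ^ 2 := by rw [ha, hr]; field_simp; norm_num
      nlinarith
    have h6 : Real.exp 2 ≤ 9 := by
      have : Real.exp 2 = Real.exp 1 * Real.exp 1 := by rw [← Real.exp_add]; norm_num
      nlinarith [Real.exp_one_lt_d9, Real.exp_pos 1]
    calc _ ≤ 4 * Real.exp (Real.pi ^ 2 / (4 * a) + 2 - 0.18 / a) * Real.exp (n * a) := by gcongr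
      _ = 4 * Real.exp (Real.pi ^ 2 / (4 * a) + 2 - 0.18 / a + n * a) := by
        rw [mul_assoc, ← Real.exp_add]
      _ ≤ 4 * Real.exp (2 + 0.98 * b) := by
        rw [h4, hna]
        refine mul_le_mul_of_nonneg_left (Real.exp_le_exp.mpr ?_) (by norm_num)
        linarith
      _ = 4 * (Real.exp 2 * Real.exp (0.98 * b)) := by rw [Real.exp_add]
      _ ≤ 4 * (9 * Real.exp (0.98 * b)) := by gcongr
      _ = _ := by ring
  have hs1 : s ≤ 1 := by linarith
  have hs0 : 0 < s := by positivity
  have hright : ‖∫ θ in s..Real.pi, F θ‖ ≤ 36 * Real.exp (0.98 * b) * |Real.pi - s| := by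
    refine intervalIntegral.norm_integral_le_of_norm_le_const fun θ hθ ↦ ?_
    rw [Set.uIoc_of_le (by linarith), Set.mem_Ioc] at hθ
    have : |θ| = θ := abs_of_pos (by linarith)
    exact hminor θ (by linarith) (by linarith)
  have hleft : ‖∫ θ in -Real.pi..-s, F θ‖ ≤ 36 * Real.exp (0.98 * b) * |-s - -Real.pi| := by
    refine intervalIntegral.norm_integral_le_of_norm_le_const fun θ hθ ↦ ?_
    rw [Set.uIoc_of_le (by linarith), Set.mem_Ioc] at hθ
    have : |θ| = -θ := abs_of_neg (by linarith)
    exact hminor θ (by linarith) (by linarith)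
  have hi : ∀ x y, IntervalIntegrable F MeasureTheory.volume x y := hFc.intervalIntegrable
  have htotal : (∫ θ in -Real.pi..Real.pi, F θ) - ∫ θ in -s..s, H θ =
      (∫ θ in -Real.pi..-s, F θ) + (∫ θ in -s..s, (F θ - H θ)) + ∫ θ in s..Real.pi, F θ := by
    rw [intervalIntegral.integral_sub (hi _ _) (hHc.intervalIntegrable _ _),
      ← intervalIntegral.integral_add_adjacent_intervals (hi (-Real.pi) s) (hi s Real.pi),
      ← intervalIntegral.integral_add_adjacent_intervals (hi (-Real.pi) (-s)) (hi (-s) s)]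
    ring
  have hcoef : (∫ θ in -Real.pi..Real.pi, F θ) = 2 * Real.pi * overpartitionFn n :=
    integral_genFunVal_mul_exp ha0 n
  rw [hcoef] at htotal
  have hre := abs_re_le_norm ((2 * Real.pi * overpartitionFn n : ℂ) - ∫ θ in -s..s, H θ)
  have hre2 : ((2 * Real.pi * overpartitionFn n : ℂ) - ∫ θ in -s..s, H θ).re =
      2 * Real.pi * overpartitionFn n - (∫ θ in -s..s, H θ).re := by
    rw [sub_re]; congr 1; norm_cast
  rw [hre2] at hre
  have hbound := (congrArg norm htotal).le.trans (norm_add₃_le)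
  rw [abs_of_nonneg (by linarith)] at hmajor hright hleft
  set P := Real.pi ^ 2 * Real.exp b / (8 * b ^ 2) * (1 - 1 / b)
  set E := Real.exp (0.98 * b) with hE
  have hE0 : 0 < E := Real.exp_pos _
  have hE1 : Real.exp (0.9 * b) ≤ E := Real.exp_le_exp.mpr (by linarith)
  have hfin : |2 * Real.pi * overpartitionFn n - 2 * Real.pi * P| ≤ 2 * Real.pi * (50 * E) := by
    refine (abs_sub_le _ (∫ θ in -s..s, H θ).re _).trans ?_
    have h1 : 0 < E * s := by positivity
    have h2 : E * 3 ≤ E * Real.pi := by gcongr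
    linarith
  rw [← mul_sub, abs_mul, abs_of_pos (by positivity)] at hfin
  exact le_of_mul_le_mul_left hfin (by positivity)

lemma tendsto_muPbar : Tendsto muPbar atTop atTop :=
  (Real.tendsto_sqrt_atTop.comp tendsto_natCast_atTop_atTop).const_mul_atTop Real.pi_pos

end Asymptotics

end Overpartition

theorem overpartition_bounds_6 :
    ∃ N : ℕ, 0 < N ∧ ∀ n : ℕ, N ≤ n →
      Real.pi ^ 2 * Real.exp (muPbar n) / (8 * (muPbar n) ^ 8) *
          ((muPbar n) ^ 6 - (muPbar n) ^ 5 - 1) < (overpartitionFn n : ℝ) ∧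
      (overpartitionFn n : ℝ) <
        Real.pi ^ 2 * Real.exp (muPbar n) / (8 * (muPbar n) ^ 8) *
          ((muPbar n) ^ 6 - (muPbar n) ^ 5 + 1) := by
  have hlittle := (isLittleO_pow_exp_pos_mul_atTop 8 (by norm_num : (0 : ℝ) < 0.02)).bound
    (by norm_num : (0 : ℝ) < 1 / 400)
  obtain ⟨N, hN⟩ := Filter.eventually_atTop.mp
    (Overpartition.tendsto_muPbar.eventually (hlittle.and (Filter.eventually_ge_atTop 8)))
  refine ⟨N + 1, N.succ_pos, fun n hn ↦ ?_⟩
  obtain ⟨h1, h8⟩ := hN n (by omega)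
  have hsq : muPbar n ^ 2 = Real.pi ^ 2 * n := by
    rw [muPbar, mul_pow, Real.sq_sqrt n.cast_nonneg]
  have h := Overpartition.abs_overpartition_sub_le h8 hsq
  set b := muPbar n
  have hb0 : 0 < b := by linarith
  rw [Real.norm_of_nonneg (by positivity), Real.norm_of_nonneg (by positivity)] at h1
  have hexp : Real.exp b = Real.exp (0.98 * b) * Real.exp (0.02 * b) := by
    rw [← Real.exp_add]; congr 1; ring
  have herr : 50 * Real.exp (0.98 * b) < Real.pi ^ 2 * Real.exp b / (8 * b ^ 8) := by
    have hpi : 1 < Real.pi ^ 2 := by nlinarith [Real.pi_gt_three]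
    rw [lt_div_iff₀ (by positivity), hexp]
    have h2 : Real.exp (0.98 * b) * (400 * b ^ 8) ≤
        Real.exp (0.98 * b) * Real.exp (0.02 * b) := by gcongr; linarith
    have h3 : 0 < Real.exp (0.98 * b) * Real.exp (0.02 * b) := by positivity
    nlinarith
  have hmain : Real.pi ^ 2 * Real.exp b / (8 * b ^ 2) * (1 - 1 / b) =
      Real.pi ^ 2 * Real.exp b / (8 * b ^ 8) * (b ^ 6 - b ^ 5) := by
    field_simp
  rw [hmain, abs_le] at h
  constructor <;> nlinarith
end
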